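/- arXiv:2402.11884 — 3 statements merged into one kernel-verified Lean document; each statement's English description precedes it below -/
import Mathlib

section
/- Let a_n = 1 if the sum of the binary digits of n is even (equivalently, n indicates a 0 in the Thue–Morse sequence) and a_n = 0 otherwise. Then the sequence (a_n) is regular, has level of distribution ϑ = 1 with density g(d) = 1/d, and is locally uniform. -/
open Finset Filter Real

open scoped Classical

/-- `N a x = ∑_{1 ≤ n ≤ x} a n`. -/
noncomputable def N (a : ℕ → ℝ) (x : ℝ) : ℝ := ∑ n ∈ Finset.Icc 1 ⌊x⌋₊, a n

/-- `Nd a d x = ∑_{1 ≤ n ≤ x, d ∣ n} a n`. -/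
noncomputable def Nd (a : ℕ → ℝ) (d : ℕ) (x : ℝ) : ℝ :=
  ∑ n ∈ (Finset.Icc 1 ⌊x⌋₊).filter (fun n => d ∣ n), a n

/-- `Ω n`: number of prime factors of `n` counted with multiplicity. -/
def bigOmega (n : ℕ) : ℕ := n.primeFactorsList.length

/-- Regularity: for each fixed `0 < c < 1`, `N(x^c) = o(N(x))` as `x → ∞`. -/
def Regular (a : ℕ → ℝ) : Prop :=
  ∀ c : ℝ, 0 < c → c < 1 →
    (fun x : ℝ => N a (x ^ c)) =o[atTop] fun x : ℝ => N a x

/-- `g` is multiplicative: `g 1 = 1` and `g (m n) = g m * g n` for coprime `m, n`. -/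
def MultOn (g : ℕ → ℝ) : Prop :=
  g 1 = 1 ∧ ∀ m n : ℕ, Nat.Coprime m n → g (m * n) = g m * g n

/-- `(a n)` has level of distribution `ϑ` with density `g`. -/
def HasLevel (a : ℕ → ℝ) (ϑ : ℝ) (g : ℕ → ℝ) : Prop :=
  MultOn g ∧
  (∀ d : ℕ, 1 ≤ d → g d ∈ Set.Icc (0:ℝ) 1) ∧
  (∃ M : ℝ, ∀ x : ℝ, 2 ≤ x →
      |(∑ p ∈ (Finset.Icc 1 ⌊x⌋₊).filter Nat.Prime, g p * Real.log p) - Real.log x| ≤ M) ∧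
  (∃ C : ℝ, 1 ≤ C ∧ ∃ K : ℝ, ∀ d : ℕ, 1 ≤ d → g d ≤ K * C ^ bigOmega d / d) ∧
  (∀ c : ℝ, 0 < c → c < ϑ → ∀ A : ℝ, 0 < A → ∃ K : ℝ, ∀ x : ℝ, 2 ≤ x →
      ∑ d ∈ Finset.Icc 1 ⌊x ^ c⌋₊, |Nd a d x - g d * N a x| ≤ K * N a x / Real.log x ^ A)

/-- Local uniformity with explicit parameters `δ`, `B`, `C`. -/
def LocallyUniformWith (a : ℕ → ℝ) (δ B C : ℝ) : Prop :=
  ∃ K : ℝ, ∀ x : ℝ, 2 ≤ x → ∀ d : ℕ, 1 ≤ d → (d : ℝ) ≤ x ^ δ →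
    Nd a d x ≤ K * Real.log x ^ B * C ^ bigOmega d * N a x / d

/-- Local uniformity: some parameters `δ > 0`, `B ≥ 0`, `C ≥ 1` work. -/
def LocallyUniform (a : ℕ → ℝ) : Prop :=
  ∃ δ : ℝ, 0 < δ ∧ ∃ B : ℝ, 0 ≤ B ∧ ∃ C : ℝ, 1 ≤ C ∧ LocallyUniformWith a δ B C

/-- The `j`-th largest prime factor of `n` (with multiplicity), `1` if `n` has fewer
than `j` prime factors.  (Indexing: `j ≥ 1`.) -/
def nthPF (n j : ℕ) : ℕ :=
  (n.primeFactorsList.mergeSort (fun p q => decide (q ≤ p))).getD (j - 1) 1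

/-- `log p / log n`, with the convention that this is `1` when `n = 1`. -/
noncomputable def logRatio (n p : ℕ) : ℝ := if n = 1 then 1 else Real.log p / Real.log n

/-- The largest prime factor `P⁺(n)`, with `P⁺(1) = 1`. -/
def Pplus (n : ℕ) : ℕ := n.primeFactorsList.foldr max 1

/-- The number of roots of `F` modulo `d`. -/
def rootCount (F : Polynomial ℤ) (d : ℕ) : ℕ :=
  ((Finset.range d).filter (fun r : ℕ => (d:ℤ) ∣ F.eval (r:ℤ))).card

namespace TM

/-- shift invariance of a sum over a period -/
lemma sum_shift (P : ℕ) (φ : ℕ → ℝ) (hφ : ∀ n, φ (n + P) = φ n) (c : ℕ) :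
    ∑ n ∈ range P, φ (n + c) = ∑ n ∈ range P, φ n := by
  induction c with
  | zero => simp
  | succ c ih =>
    rw [← ih]
    have h1 := Finset.sum_range_succ (fun n => φ (n + c)) P
    have h2 := Finset.sum_range_succ' (fun n => φ (n + c)) P
    have h3 : φ (P + c) = φ (0 + c) := by rw [add_comm P c, hφ, zero_add]
    have h4 : ∀ n, φ (n + 1 + c) = φ (n + (c + 1)) := fun n => by congr 1; ring
    simp only [h4] at h2
    linarith

lemma periodic_mul (P : ℕ) (φ : ℕ → ℝ) (hφ : ∀ n, φ (n + P) = φ n) (n k : ℕ) :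
    φ (n + P * k) = φ n := by
  induction k with
  | zero => simp
  | succ k ih => rw [Nat.mul_succ, ← add_assoc, hφ, ih]

lemma periodic_mod (P : ℕ) (φ : ℕ → ℝ) (hφ : ∀ n, φ (n + P) = φ n) (n : ℕ) :
    φ (n % P) = φ n := by
  conv_rhs => rw [← Nat.mod_add_div n P]
  rw [periodic_mul P φ hφ]

lemma periodic_congr (P : ℕ) (φ : ℕ → ℝ) (hφ : ∀ n, φ (n + P) = φ n) {m n : ℕ}
    (h : m % P = n % P) : φ m = φ n := by
  rw [← periodic_mod P φ hφ m, h, periodic_mod P φ hφ]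

lemma sum_range_mul (A B : ℕ) (φ : ℕ → ℝ) :
    ∑ n ∈ range (A * B), φ n = ∑ j ∈ range B, ∑ i ∈ range A, φ (A * j + i) := by
  induction B with
  | zero => simp
  | succ B ih =>
    rw [Nat.mul_succ, Finset.sum_range_add, ih, Finset.sum_range_succ]

/-- sum over several periods -/
lemma sum_periods (P r : ℕ) (φ : ℕ → ℝ) (hφ : ∀ n, φ (n + P) = φ n) (c : ℕ) :
    ∑ n ∈ range (P * r), φ (n + c) = r * ∑ n ∈ range P, φ n := by
  rw [sum_range_mul]
  have : ∀ j ∈ range r, ∑ i ∈ range P, φ (P * j + i + c) = ∑ n ∈ range P, φ n := by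
    intro j _
    rw [← sum_shift P φ hφ (P * j + c)]
    apply Finset.sum_congr rfl
    intro i _
    congr 1; ring
  rw [Finset.sum_congr rfl this]
  simp

/-- for `δ` not divisible by `2^c`, some multiple of `δ` is `2^v` mod `2^G`, `v < c`. -/
lemma exists_mult (c G δ : ℕ) (h : ¬ 2 ^ c ∣ δ) :
    ∃ v j, v < c ∧ 2 ^ v ∣ δ ∧ (δ * j) % 2 ^ G = 2 ^ v % 2 ^ G := by
  have h0 : δ ≠ 0 := by rintro rfl; exact h (dvd_zero _)
  obtain ⟨v, m, hm, rfl⟩ := Nat.exists_eq_two_pow_mul_odd h0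
  have hv : v < c := by
    by_contra hc
    exact h (dvd_mul_of_dvd_left (pow_dvd_pow 2 (not_lt.mp hc)) _)
  rcases Nat.eq_zero_or_pos G with rfl | hG
  · exact ⟨v, 0, hv, dvd_mul_right _ _, by simp [Nat.mod_one]⟩
  have hcop : Nat.Coprime m (2 ^ G) := (Nat.Coprime.pow_right _ hm.coprime_two_right)
  obtain ⟨j, -, hj⟩ := Nat.exists_mul_mod_eq_one_of_coprime hcop
    (Nat.one_lt_two_pow (by omega))
  refine ⟨v, j, hv, dvd_mul_right _ _, ?_⟩
  rw [mul_assoc, Nat.mul_mod, hj, mul_one, Nat.mod_mod]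

/-- the Thue–Morse sign -/
noncomputable def t (n : ℕ) : ℝ := (-1) ^ ((Nat.digits 2 n).sum)

lemma t_zero : t 0 = 1 := by simp [t]

lemma t_two_mul (n : ℕ) : t (2 * n) = t n := by
  rcases Nat.eq_zero_or_pos n with rfl | hn
  · simp
  · unfold t
    rw [Nat.digits_def' (by norm_num) (by omega)]
    simp

lemma t_two_mul_add_one (n : ℕ) : t (2 * n + 1) = - t n := by
  unfold t
  rw [Nat.digits_def' (by norm_num) (by omega)]
  have h1 : (2 * n + 1) % 2 = 1 := by omega
  have h2 : (2 * n + 1) / 2 = n := by omega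
  rw [h1, h2]
  simp [pow_add]

lemma t_sq (n : ℕ) : t n * t n = 1 := by
  unfold t
  rw [← pow_add, ← two_mul, pow_mul]; simp

lemma abs_t (n : ℕ) : |t n| = 1 := by
  unfold t; rw [abs_pow]; simp

lemma t_split (k u v : ℕ) (hv : v < 2 ^ k) : t (2 ^ k * u + v) = t u * t v := by
  induction k generalizing v with
  | zero =>
    have : v = 0 := by simpa using hv
    subst this; simp [t_zero]
  | succ k ih =>
    rcases Nat.even_or_odd' v with ⟨w, rfl | rfl⟩
    · have : 2 ^ (k+1) * u + 2 * w = 2 * (2 ^ k * u + w) := by ring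
      rw [this, t_two_mul, t_two_mul, ih]
      rw [pow_succ] at hv; omega
    · have : 2 ^ (k+1) * u + (2 * w + 1) = 2 * (2 ^ k * u + w) + 1 := by ring
      rw [this, t_two_mul_add_one, t_two_mul_add_one, ih]
      · ring
      rw [pow_succ] at hv; omega

/-- truncated version -/
noncomputable def tw (L n : ℕ) : ℝ := t (n % 2 ^ L)

lemma tw_per (L n : ℕ) : tw L (n + 2 ^ L) = tw L n := by simp [tw]

lemma tw_sq (L n : ℕ) : tw L n * tw L n = 1 := t_sq _

lemma abs_tw (L n : ℕ) : |tw L n| = 1 := abs_t _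

lemma t_eq_tw (L n : ℕ) : t n = tw L n * t (n / 2 ^ L) := by
  conv_lhs => rw [← Nat.div_add_mod n (2 ^ L)]
  rw [t_split _ _ _ (Nat.mod_lt _ (by positivity)), tw, mul_comm]

lemma tw_split (p q n : ℕ) : tw (p + q) n = tw p n * tw q (n / 2 ^ p) := by
  have h := t_eq_tw p (n % 2 ^ (p + q))
  rw [tw, h, tw, tw, tw]
  congr 2
  · rw [pow_add, Nat.mod_mul_right_mod]
  · rw [pow_add, Nat.mod_mul_right_div_self]

lemma tw_split' (p q x y : ℕ) (hx : x < 2 ^ p) : tw (p + q) (x + 2 ^ p * y) = t x * tw q y := by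
  rw [tw_split]
  congr 1
  · simp [tw, Nat.mod_eq_of_lt hx]
  · rw [Nat.add_mul_div_left _ _ (by positivity), Nat.div_eq_of_lt hx, zero_add]

end TM

namespace TM

lemma tw_even (L n : ℕ) : tw (L + 1) (2 * n) = tw L n := by
  have := tw_split' 1 L 0 n (by norm_num)
  rw [add_comm 1 L] at this
  simpa [t_zero] using this

lemma t_one : t 1 = -1 := by simpa [t_zero] using t_two_mul_add_one 0

lemma tw_odd (L n : ℕ) : tw (L + 1) (2 * n + 1) = - tw L n := by
  have := tw_split' 1 L 1 n (by norm_num)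
  rw [add_comm 1 L] at this
  rw [add_comm (2 * n) 1]
  simpa [t_one] using this

noncomputable def corr (L u : ℕ) : ℝ := ∑ n ∈ range (2 ^ L), tw L n * tw L (n + u)

lemma corr_even (L u : ℕ) : corr (L + 1) (2 * u) = 2 * corr L u := by
  unfold corr
  rw [pow_succ, mul_comm, sum_range_mul, Finset.mul_sum]
  apply Finset.sum_congr rfl
  intro n _
  rw [Finset.sum_range_succ, Finset.sum_range_one]
  have h1 : 2 * n + 1 + 2 * u = 2 * (n + u) + 1 := by ring
  have h2 : 2 * n + 2 * u = 2 * (n + u) := by ring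
  rw [h1, add_zero, h2, tw_even, tw_odd, tw_even, tw_odd]; ring

lemma corr_odd (L u : ℕ) : corr (L + 1) (2 * u + 1) = - (corr L u + corr L (u + 1)) := by
  unfold corr
  rw [pow_succ, mul_comm, sum_range_mul, ← Finset.sum_add_distrib, ← Finset.sum_neg_distrib]
  apply Finset.sum_congr rfl
  intro n _
  rw [Finset.sum_range_succ, Finset.sum_range_one]
  have h1 : 2 * n + 1 + (2 * u + 1) = 2 * (n + (u + 1)) := by ring
  have h2 : 2 * n + (2 * u + 1) = 2 * (n + u) + 1 := by ring
  rw [h1, add_zero, h2, tw_even, tw_odd, tw_even, tw_odd]; ring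

lemma corr_le (L u : ℕ) : |corr L u| ≤ 2 ^ L := by
  unfold corr
  refine (Finset.abs_sum_le_sum_abs _ _).trans ?_
  simp [abs_mul, abs_tw]

noncomputable def Gm : ℕ → ℕ → ℝ
  | 0, _ => 1
  | j + 1, n => if n % 4 = 0 then Gm j (n / 4) else
      if n % 4 = 2 then (Gm j (n / 4) + Gm j (n / 4 + 1)) / 2 else
      (Gm j (n / 4) + Gm j (n / 4 + 1)) / 4

lemma Gm_nonneg (j n : ℕ) : 0 ≤ Gm j n := by
  induction j generalizing n with
  | zero => simp [Gm]
  | succ j ih =>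
    have h1 := ih (n / 4)
    have h2 := ih (n / 4 + 1)
    rw [Gm]; split_ifs <;> linarith

lemma Gm_per (j n : ℕ) : Gm j (n + 4 ^ j) = Gm j n := by
  induction j generalizing n with
  | zero => simp [Gm]
  | succ j ih =>
    have h1 : (n + 4 ^ (j+1)) % 4 = n % 4 := by
      rw [pow_succ]; omega
    have h2 : (n + 4 ^ (j+1)) / 4 = n / 4 + 4 ^ j := by
      rw [pow_succ]; omega
    have h3 : n / 4 + 4 ^ j + 1 = (n / 4 + 1) + 4 ^ j := by ring
    rw [Gm, Gm, h1, h2, h3, ih, ih]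

lemma Gm_sum (j : ℕ) : ∑ n ∈ range (4 ^ j), Gm j n = 3 ^ j := by
  induction j with
  | zero => simp [Gm]
  | succ j ih =>
    rw [pow_succ, mul_comm, sum_range_mul]
    have : ∀ n ∈ range (4 ^ j), ∑ i ∈ range 4, Gm (j + 1) (4 * n + i) = 2 * Gm j n + Gm j (n + 1) := by
      intro n _
      have e0 : (4 * n + 0) % 4 = 0 := by omega
      have e1 : (4 * n + 1) % 4 = 1 := by omega
      have e2 : (4 * n + 2) % 4 = 2 := by omega
      have e3 : (4 * n + 3) % 4 = 3 := by omega
      have f0 : (4 * n + 0) / 4 = n := by omega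
      have f1 : (4 * n + 1) / 4 = n := by omega
      have f2 : (4 * n + 2) / 4 = n := by omega
      have f3 : (4 * n + 3) / 4 = n := by omega
      simp only [Finset.sum_range_succ, Finset.sum_range_zero, Gm, e0, e1, e2, e3, f0, f1, f2, f3]
      norm_num
      ring
    rw [Finset.sum_congr rfl this, Finset.sum_add_distrib, ← Finset.mul_sum,
      sum_shift (4 ^ j) (Gm j) (Gm_per j) 1, ih]
    ring

lemma corr_Gm (j L n : ℕ) (h : 2 * j ≤ L) : |corr L n| ≤ 2 ^ L * Gm j n := by
  induction j generalizing L n with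
  | zero => simpa [Gm] using corr_le L n
  | succ j ih =>
    obtain ⟨K, rfl⟩ : ∃ K, L = K + 1 + 1 := ⟨L - 2, by omega⟩
    obtain ⟨m, hm⟩ : ∃ m, m = n / 4 := ⟨_, rfl⟩
    have i1 := ih K m (by omega)
    have i2 := ih K (m + 1) (by omega)
    have hp : (2:ℝ) ^ (K + 1 + 1) = 4 * 2 ^ K := by ring
    rw [Gm, ← hm, hp]
    have hn : n % 4 = 0 ∨ n % 4 = 1 ∨ n % 4 = 2 ∨ n % 4 = 3 := by omega
    have tri1 := abs_add_le (corr K m) (corr K (m + 1))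
    have tri2 := abs_sub (corr K m) (corr K (m + 1))
    rcases hn with h | h | h | h
    · have : n = 2 * (2 * m) := by omega
      rw [if_pos h, this, corr_even, corr_even, abs_mul, abs_mul]
      norm_num; linarith
    · have : n = 2 * (2 * m) + 1 := by omega
      rw [if_neg (by omega), if_neg (by omega), this, corr_odd, corr_odd, corr_even]
      have : -(2 * corr K m + -(corr K m + corr K (m + 1))) = -(corr K m - corr K (m + 1)) := by ring
      rw [this, abs_neg]; linarith
    · have : n = 2 * (2 * m + 1) := by omega
      rw [if_neg (by omega), if_pos h, this, corr_even, corr_odd, abs_mul, abs_neg]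
      norm_num; linarith
    · have : n = 2 * (2 * m + 1) + 1 := by omega
      have h2 : 2 * m + 1 + 1 = 2 * (m + 1) := by ring
      rw [if_neg (by omega), if_neg (by omega), this, corr_odd, corr_odd, h2, corr_even]
      have : -(-(corr K m + corr K (m + 1)) + 2 * corr K (m + 1)) = (corr K m - corr K (m + 1)) := by ring
      rw [this]; linarith

/-- average along a progression -/
lemma Gm_progression (p j c r A : ℕ) (hr : 0 < r) :
    ∑ s ∈ range (2 ^ (p + 2 * j)), Gm j ((c + (A + s) * r) / 2 ^ p) ≤ r * (2 ^ p * 3 ^ j) := by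
  set φ : ℕ → ℝ := fun u => Gm j (u / 2 ^ p) with hφ
  have hpow : 2 ^ (p + 2 * j) = 2 ^ p * 4 ^ j := by rw [pow_add, pow_mul]; norm_num
  have hper : ∀ n, φ (n + 2 ^ (p + 2 * j)) = φ n := by
    intro n
    simp only [hφ, hpow]
    rw [Nat.add_mul_div_left _ _ (by positivity), Gm_per]
  have hsum : ∑ n ∈ range (2 ^ (p + 2 * j)), φ n = 2 ^ p * 3 ^ j := by
    rw [hpow, sum_range_mul]
    have : ∀ n ∈ range (4 ^ j), ∑ i ∈ range (2 ^ p), φ (2 ^ p * n + i) = 2 ^ p * Gm j n := by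
      intro n _
      have : ∀ i ∈ range (2 ^ p), φ (2 ^ p * n + i) = Gm j n := by
        intro i hi
        simp only [hφ]
        rw [Nat.mul_add_div (by positivity), Nat.div_eq_of_lt (Finset.mem_range.mp hi), add_zero]
      rw [Finset.sum_congr rfl this]; simp
    rw [Finset.sum_congr rfl this, ← Finset.mul_sum, Gm_sum]
  rw [← hsum, ← sum_periods _ r φ hper (c + A * r)]
  have himg : (range (2 ^ (p + 2 * j))).image (fun s => s * r) ⊆ range (2 ^ (p + 2 * j) * r) := by
    intro x hx
    obtain ⟨s, hs, rfl⟩ := Finset.mem_image.mp hx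
    rw [Finset.mem_range] at hs ⊢
    exact Nat.mul_lt_mul_of_pos_right hs hr
  refine le_trans (le_of_eq ?_) (Finset.sum_le_sum_of_subset_of_nonneg himg
    (fun _ _ _ => Gm_nonneg _ _))
  rw [Finset.sum_image]
  · apply Finset.sum_congr rfl
    intro s _
    simp only [hφ]
    congr 2; ring
  · intro x _ y _ h
    exact Nat.eq_of_mul_eq_mul_right hr h

end TM

namespace TM

lemma block_sum (G c δ : ℕ) (φ : ℕ → ℝ) (hper : ∀ n, φ (n + 2 ^ G) = φ n)
    (hblk : ∀ x y, x / 2 ^ c = y / 2 ^ c → φ x = φ y) (hδ : ¬ 2 ^ c ∣ δ)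
    (hsum : ∑ n ∈ range (2 ^ G), φ n = 0) (s : ℕ) :
    ∑ m ∈ range (2 ^ G), φ (s + δ * m) = 0 := by
  obtain ⟨v, j, hv, hvd, hj⟩ := exists_mult c G δ hδ
  set A : ℕ → ℝ := fun s => ∑ m ∈ range (2 ^ G), φ (s + δ * m) with hA
  have hAper : ∀ s, A (s + 2 ^ G) = A s := by
    intro s
    simp only [hA]
    apply Finset.sum_congr rfl
    intro m _
    rw [show s + 2 ^ G + δ * m = s + δ * m + 2 ^ G by ring, hper]
  have hAδ : ∀ s j, A (s + δ * j) = A s := by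
    intro s j
    simp only [hA]
    rw [← sum_shift (2 ^ G) (fun m => φ (s + δ * m)) _ j]
    · apply Finset.sum_congr rfl
      intro m _
      congr 1; ring
    · intro n
      rw [show s + δ * (n + 2 ^ G) = s + δ * n + 2 ^ G * δ by ring, periodic_mul _ _ hper]
  have hA2 : ∀ s, A (s + 2 ^ v) = A s := by
    intro s
    rw [← hAδ s j]
    apply periodic_congr (2 ^ G) A hAper
    rw [Nat.add_mod, ← hj, ← Nat.add_mod]
  have hAblk : ∀ s, A s = A 0 := by
    intro s
    have h1 : A s = A (0 + 2 ^ v * (s / 2 ^ v)) := by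
      simp only [hA]
      apply Finset.sum_congr rfl
      intro m _
      apply hblk
      obtain ⟨w, rfl⟩ := hvd
      obtain ⟨d, rfl⟩ : ∃ d, c = v + d := ⟨c - v, by omega⟩
      rw [pow_add, ← Nat.div_div_eq_div_mul, ← Nat.div_div_eq_div_mul]
      congr 1
      rw [mul_assoc, Nat.add_mul_div_left _ _ (by positivity), zero_add, ← mul_add,
        Nat.mul_div_cancel_left _ (by positivity)]
    rw [h1, periodic_mul _ _ hA2]
  have htot : ∑ s ∈ range (2 ^ G), A s = 0 := by
    simp only [hA]
    rw [Finset.sum_comm]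
    apply Finset.sum_eq_zero
    intro m _
    rw [sum_shift (2 ^ G) φ hper, hsum]
  rw [Finset.sum_congr rfl (fun s _ => hAblk s)] at htot
  simp at htot
  have := hAblk s
  rw [htot] at this
  exact this

lemma hash_pair (G c f δ : ℕ) (φ : ℕ → ℝ) (hper : ∀ n, φ (n + 2 ^ G) = φ n)
    (hblk : ∀ x y, x / 2 ^ c = y / 2 ^ c → φ x = φ y) (hδ : ¬ 2 ^ c ∣ δ)
    (hsum : ∑ n ∈ range (2 ^ G), φ n = 0) :
    ∑ m ∈ range (2 ^ G), ∑ s ∈ range (2 ^ G), φ (s + f * m) * φ (s + (f + δ) * m) = 0 := by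
  have h1 : ∀ m ∈ range (2 ^ G), ∑ s ∈ range (2 ^ G), φ (s + f * m) * φ (s + (f + δ) * m)
      = ∑ s ∈ range (2 ^ G), φ s * φ (s + δ * m) := by
    intro m _
    rw [← sum_shift (2 ^ G) (fun s => φ s * φ (s + δ * m)) _ (f * m)]
    · apply Finset.sum_congr rfl
      intro s _
      congr 2; ring
    · intro n
      rw [hper, show n + 2 ^ G + δ * m = n + δ * m + 2 ^ G by ring, hper]
  rw [Finset.sum_congr rfl h1, Finset.sum_comm]
  apply Finset.sum_eq_zero
  intro s _
  rw [← Finset.mul_sum, block_sum G c δ φ hper hblk hδ hsum, mul_zero]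

lemma hash (G c F : ℕ) (φ : ℕ → ℝ) (hper : ∀ n, φ (n + 2 ^ G) = φ n)
    (hblk : ∀ x y, x / 2 ^ c = y / 2 ^ c → φ x = φ y) (hF : F ≤ 2 ^ c)
    (hsum : ∑ n ∈ range (2 ^ G), φ n = 0) (hb : ∀ n, |φ n| ≤ 1) :
    ∑ m ∈ range (2 ^ G), ∑ s ∈ range (2 ^ G), (∑ f ∈ range F, φ (s + f * m)) ^ 2
      ≤ F * (2 ^ G * 2 ^ G) := by
  have h1 : ∑ m ∈ range (2 ^ G), ∑ s ∈ range (2 ^ G), (∑ f ∈ range F, φ (s + f * m)) ^ 2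
      = ∑ f ∈ range F, ∑ f' ∈ range F, ∑ m ∈ range (2 ^ G), ∑ s ∈ range (2 ^ G),
        φ (s + f * m) * φ (s + f' * m) := by
    simp_rw [pow_two, Finset.sum_mul_sum]
    rw [Finset.sum_congr rfl (fun m _ => Finset.sum_comm), Finset.sum_comm]
    apply Finset.sum_congr rfl
    intro f _
    rw [Finset.sum_congr rfl (fun m _ => Finset.sum_comm), Finset.sum_comm]
  rw [h1]
  have h2 : ∀ f ∈ range F, ∑ f' ∈ range F, ∑ m ∈ range (2 ^ G), ∑ s ∈ range (2 ^ G),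
        φ (s + f * m) * φ (s + f' * m) ≤ 2 ^ G * 2 ^ G := by
    intro f hf
    rw [Finset.sum_eq_single_of_mem f hf]
    · calc _ ≤ ∑ m ∈ range (2 ^ G), ∑ s ∈ range (2 ^ G), (1:ℝ) := by
            apply Finset.sum_le_sum; intro m _
            apply Finset.sum_le_sum; intro s _
            have := hb (s + f * m)
            rw [← abs_mul_abs_self]
            nlinarith [abs_nonneg (φ (s + f * m))]
        _ = _ := by simp
    · intro f' hf' hne
      rw [Finset.mem_range] at hf hf'
      have key : ∀ δ, 0 < δ → δ < F → ¬ 2 ^ c ∣ δ := fun δ h0 h1 h2 =>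
        absurd (Nat.le_of_dvd h0 h2) (by omega)
      rcases lt_or_gt_of_ne hne with h | h
      · obtain ⟨δ, rfl⟩ : ∃ δ, f = f' + δ := ⟨f - f', by omega⟩
        have := hash_pair G c f' δ φ hper hblk (key δ (by omega) (by omega)) hsum
        simpa only [mul_comm (φ _) (φ _)] using this
      · obtain ⟨δ, rfl⟩ : ∃ δ, f' = f + δ := ⟨f' - f, by omega⟩
        exact hash_pair G c f δ φ hper hblk (key δ (by omega) (by omega)) hsum
  calc _ ≤ ∑ f ∈ range F, (2:ℝ) ^ G * 2 ^ G := Finset.sum_le_sum h2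
    _ = _ := by simp

lemma hash_abs (G y : ℕ) (φ : ℕ → ℝ) (hper : ∀ n, φ (n + 2 ^ G) = φ n)
    (hblk : ∀ x z, x / 2 ^ (2 * y) = z / 2 ^ (2 * y) → φ x = φ z)
    (hsum : ∑ n ∈ range (2 ^ G), φ n = 0) (hb : ∀ n, |φ n| ≤ 1) :
    ∑ m ∈ range (2 ^ G), ∑ s ∈ range (2 ^ G), |∑ f ∈ range (2 ^ (2 * y)), φ (s + f * m)|
      ≤ 2 * 2 ^ y * (2 ^ G * 2 ^ G) := by
  have h := hash G (2 * y) (2 ^ (2 * y)) φ hper hblk le_rfl hsum hb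
  have hy : (0:ℝ) < 2 ^ y := by positivity
  have key : ∀ x : ℝ, |x| ≤ x ^ 2 / 2 ^ y + 2 ^ y := by
    intro x
    rw [← sq_abs, ← sub_nonneg]
    have : |x| ^ 2 / 2 ^ y + 2 ^ y - |x| = ((|x| - 2 ^ y) ^ 2 + |x| * 2 ^ y) / 2 ^ y := by
      field_simp; ring
    rw [this]; positivity
  calc _ ≤ ∑ m ∈ range (2 ^ G), ∑ s ∈ range (2 ^ G),
        ((∑ f ∈ range (2 ^ (2 * y)), φ (s + f * m)) ^ 2 / 2 ^ y + 2 ^ y) :=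
        Finset.sum_le_sum fun m _ => Finset.sum_le_sum fun s _ => key _
    _ = (∑ m ∈ range (2 ^ G), ∑ s ∈ range (2 ^ G),
        (∑ f ∈ range (2 ^ (2 * y)), φ (s + f * m)) ^ 2) / 2 ^ y + 2 ^ G * 2 ^ G * 2 ^ y := by
        simp only [Finset.sum_add_distrib, Finset.sum_div]; simp; ring
    _ ≤ ((2 ^ (2 * y) : ℕ) : ℝ) * (2 ^ G * 2 ^ G) / 2 ^ y + 2 ^ G * 2 ^ G * 2 ^ y := by gcongr
    _ = _ := by push_cast; rw [two_mul, pow_add]; field_simp; ring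

end TM

namespace TM

/-- cell number of n -/
def cell (U e y n : ℕ) : ℕ := (n / 2 ^ (2 * y + e)) % 2 ^ U

noncomputable def kap (U e y z n : ℕ) : ℝ :=
  if cell U e y n = z ∧ (n / 2 ^ (2 * y)) % 2 ^ e ≠ 0 then 1 else 0

lemma cell_lt (U e y n : ℕ) : cell U e y n < 2 ^ U := Nat.mod_lt _ (by positivity)

lemma div_add_mul (n a b k : ℕ) : (n + 2 ^ (a + b) * k) / 2 ^ a = n / 2 ^ a + 2 ^ b * k := by
  rw [pow_add, mul_assoc, Nat.add_mul_div_left _ _ (by positivity)]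

lemma kap_per (U e y z n : ℕ) : kap U e y z (n + 2 ^ (U + e + 2 * y)) = kap U e y z n := by
  unfold kap cell
  have h1 : (n + 2 ^ (U + e + 2 * y)) / 2 ^ (2 * y + e) = n / 2 ^ (2 * y + e) + 2 ^ U * 1 := by
    rw [← div_add_mul, mul_one]; congr 3; ring
  have h2 : (n + 2 ^ (U + e + 2 * y)) / 2 ^ (2 * y) = n / 2 ^ (2 * y) + 2 ^ (e + U) * 1 := by
    rw [← div_add_mul, mul_one]; congr 3; ring
  rw [h1, h2, Nat.add_mul_mod_self_left, pow_add 2 e U, mul_assoc, Nat.add_mul_mod_self_left]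

lemma kap_blk (U e y z n m : ℕ) (h : n / 2 ^ (2 * y) = m / 2 ^ (2 * y)) :
    kap U e y z n = kap U e y z m := by
  unfold kap cell
  rw [pow_add, ← Nat.div_div_eq_div_mul, ← Nat.div_div_eq_div_mul, h]

lemma kap_nonneg (U e y z n : ℕ) : 0 ≤ kap U e y z n := by unfold kap; split_ifs <;> simp
lemma kap_le_one (U e y z n : ℕ) : kap U e y z n ≤ 1 := by unfold kap; split_ifs <;> simp

lemma kap_sum (U e y z : ℕ) (hz : z < 2 ^ U) :
    ∑ n ∈ range (2 ^ (U + e + 2 * y)), kap U e y z n = 2 ^ (2 * y) * (2 ^ e - 1) := by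
  rw [show 2 ^ (U + e + 2 * y) = 2 ^ (2 * y) * (2 ^ e * 2 ^ U) by ring, sum_range_mul,
    sum_range_mul]
  have h1 : ∀ l ∈ range (2 ^ U), ∀ r ∈ range (2 ^ e), ∀ i ∈ range (2 ^ (2 * y)),
      kap U e y z (2 ^ (2 * y) * (2 ^ e * l + r) + i) =
        if l = z ∧ r ≠ 0 then 1 else 0 := by
    intro l hl r hr i hi
    rw [Finset.mem_range] at hl hr hi
    unfold kap cell
    have e1 : (2 ^ (2 * y) * (2 ^ e * l + r) + i) / 2 ^ (2 * y) = 2 ^ e * l + r := by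
      rw [Nat.mul_add_div (by positivity), Nat.div_eq_of_lt hi, add_zero]
    rw [pow_add, ← Nat.div_div_eq_div_mul, e1, Nat.mul_add_div (by positivity),
      Nat.div_eq_of_lt hr, add_zero, Nat.mod_eq_of_lt hl, Nat.mul_add_mod, Nat.mod_eq_of_lt hr]
  rw [Finset.sum_congr rfl fun l hl => Finset.sum_congr rfl fun r hr =>
    Finset.sum_congr rfl fun i hi => h1 l hl r hr i hi]
  rw [Finset.sum_eq_single_of_mem z (Finset.mem_range.2 hz)]
  · simp only [Finset.sum_const, Finset.card_range, nsmul_eq_mul, true_and]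
    rw [← Finset.mul_sum]
    push_cast
    congr 1
    have : ∀ r ∈ range (2 ^ e), (if r ≠ 0 then (1:ℝ) else 0) = 1 - if r = 0 then 1 else 0 := by
      intro r _; by_cases h : r = 0 <;> simp [h]
    rw [Finset.sum_congr rfl this]
    simp
  · intro l _ hl
    simp [hl]

lemma kap_le_cell (U e y z n i : ℕ) (hi : i < 2 ^ (2 * y)) :
    kap U e y z (n + i) ≤ if cell U e y n = z then 1 else 0 := by
  by_cases hk : cell U e y (n + i) = z ∧ ((n + i) / 2 ^ (2 * y)) % 2 ^ e ≠ 0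
  · have : cell U e y n = cell U e y (n + i) := by
      unfold cell
      rw [pow_add, ← Nat.div_div_eq_div_mul, ← Nat.div_div_eq_div_mul]
      have hm := hk.2
      have a1 : (n + i) / 2 ^ (2 * y) ≤ n / 2 ^ (2 * y) + 1 := by
        rw [← Nat.add_div_right _ (by positivity)]
        exact Nat.div_le_div_right (by omega)
      have a2 : n / 2 ^ (2 * y) ≤ (n + i) / 2 ^ (2 * y) := Nat.div_le_div_right (by omega)
      rcases Nat.lt_or_ge (n / 2 ^ (2 * y)) ((n + i) / 2 ^ (2 * y)) with h | h
      · have h3 : (n + i) / 2 ^ (2 * y) = n / 2 ^ (2 * y) + 1 := by omega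
        rw [h3] at hm ⊢
        rw [Nat.succ_div, if_neg (fun hd => hm (Nat.mod_eq_zero_of_dvd hd)), add_zero]
      · rw [le_antisymm h a2]
    unfold kap
    rw [if_pos hk, if_pos (this.trans hk.1)]
  · unfold kap
    rw [if_neg hk]; split_ifs <;> simp

noncomputable def phz (U e y z n : ℕ) : ℝ := kap U e y z n - (2 ^ e - 1) / 2 ^ (U + e)

noncomputable def Dz (U e y z m : ℕ) : ℝ :=
  ∑ s ∈ range (2 ^ (U + e + 2 * y)), |∑ f ∈ range (2 ^ (2 * y)), phz U e y z (s + f * m)|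

noncomputable def Del (U e y m : ℕ) : ℝ :=
  2 * ∑ z ∈ range (2 ^ U), (2 ^ (2 * y) / 2 ^ (U + e) + Dz U e y z m / 2 ^ (2 * y))

lemma phz_per (U e y z n : ℕ) : phz U e y z (n + 2 ^ (U + e + 2 * y)) = phz U e y z n := by
  unfold phz; rw [kap_per]

lemma Dz_nonneg (U e y z m : ℕ) : 0 ≤ Dz U e y z m :=
  Finset.sum_nonneg fun _ _ => abs_nonneg _

lemma Del_nonneg (U e y m : ℕ) : 0 ≤ Del U e y m := by
  unfold Del
  apply mul_nonneg (by norm_num)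
  apply Finset.sum_nonneg
  intro z _
  have := Dz_nonneg U e y z m
  positivity

lemma Dz_sum (U e y z : ℕ) (hz : z < 2 ^ U) :
    ∑ m ∈ range (2 ^ (U + e + 2 * y)), Dz U e y z m ≤
      2 * 2 ^ y * (2 ^ (U + e + 2 * y) * 2 ^ (U + e + 2 * y)) := by
  apply hash_abs (U + e + 2 * y) y (phz U e y z) (phz_per U e y z)
  · intro x w h
    unfold phz; rw [kap_blk _ _ _ _ _ _ h]
  · unfold phz
    rw [Finset.sum_sub_distrib, kap_sum U e y z hz]
    simp only [Finset.sum_const, Finset.card_range, nsmul_eq_mul]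
    push_cast
    rw [pow_add _ (U + e)]; field_simp; ring
  · intro n
    have h1 := kap_nonneg U e y z n
    have h2 := kap_le_one U e y z n
    have h3 : (0:ℝ) ≤ (2 ^ e - 1) / 2 ^ (U + e) := by
      apply div_nonneg _ (by positivity)
      have := one_le_pow₀ (M₀ := ℝ) (a := 2) (n := e) (by norm_num); linarith
    have h4 : ((2:ℝ) ^ e - 1) / 2 ^ (U + e) ≤ 1 := by
      rw [div_le_one (by positivity)]
      have : (2:ℝ) ^ e ≤ 2 ^ (U + e) := pow_le_pow_right₀ (by norm_num) (by omega)
      linarith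
    unfold phz
    rw [abs_le]; constructor <;> linarith

lemma Del_sum (U e y : ℕ) : ∑ m ∈ range (2 ^ (U + e + 2 * y)), Del U e y m ≤
    2 * 2 ^ (U + e + 2 * y) * (2 ^ (2 * y) / 2 ^ e + 2 * 2 ^ (U + (U + e) + y)) := by
  unfold Del
  rw [← Finset.mul_sum, Finset.sum_comm, mul_assoc]
  apply mul_le_mul_of_nonneg_left _ (by norm_num)
  have : ∀ z ∈ range (2 ^ U), ∑ m ∈ range (2 ^ (U + e + 2 * y)),
      ((2:ℝ) ^ (2 * y) / 2 ^ (U + e) + Dz U e y z m / 2 ^ (2 * y)) ≤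
      2 ^ (U + e + 2 * y) * (2 ^ (2 * y) / 2 ^ (U + e)) +
       2 * 2 ^ y * (2 ^ (U + e + 2 * y) * 2 ^ (U + e + 2 * y)) / 2 ^ (2 * y) := by
    intro z hz
    rw [Finset.sum_add_distrib, Finset.sum_const, Finset.card_range, nsmul_eq_mul,
      ← Finset.sum_div]
    push_cast
    apply add_le_add le_rfl
    gcongr
    exact Dz_sum U e y z (Finset.mem_range.1 hz)
  apply (Finset.sum_le_sum this).trans
  simp only [Finset.sum_const, Finset.card_range, nsmul_eq_mul]
  push_cast
  apply le_of_eq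
  simp only [pow_add]
  field_simp

lemma disc (U e y m s : ℕ) (φ : ℕ → ℝ) (hφ : ∀ n, |φ n| ≤ 1) :
    |∑ f ∈ range (2 ^ (2 * y)), φ (cell U e y (s + f * m))
      - 2 ^ (2 * y) / 2 ^ U * ∑ z ∈ range (2 ^ U), φ z| ≤ Del U e y m := by
  set Cz : ℕ → ℝ := fun z => ∑ f ∈ range (2 ^ (2 * y)),
    if cell U e y (s + f * m) = z then (1:ℝ) else 0 with hC
  have h1 : ∑ f ∈ range (2 ^ (2 * y)), φ (cell U e y (s + f * m)) =
      ∑ z ∈ range (2 ^ U), Cz z * φ z := by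
    simp only [hC, Finset.sum_mul]
    rw [Finset.sum_comm]
    apply Finset.sum_congr rfl
    intro f _
    simp only [ite_mul, one_mul, zero_mul]
    rw [Finset.sum_ite_eq, if_pos (Finset.mem_range.2 (cell_lt _ _ _ _))]
  have h2 : ∑ z ∈ range (2 ^ U), Cz z = 2 ^ (2 * y) := by
    simp only [hC]
    rw [Finset.sum_comm]
    rw [Finset.sum_congr rfl (fun f _ => by
      rw [Finset.sum_ite_eq, if_pos (Finset.mem_range.2 (cell_lt _ _ _ _))])]
    simp
  have h3 : ∀ z ∈ range (2 ^ U), 2 ^ (2 * y) / 2 ^ U -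
      (2 ^ (2 * y) / 2 ^ (U + e) + Dz U e y z m / 2 ^ (2 * y)) ≤ Cz z := by
    intro z _
    have a1 : ∑ i ∈ range (2 ^ (2 * y)), ∑ f ∈ range (2 ^ (2 * y)), kap U e y z (s + i + f * m)
        ≤ 2 ^ (2 * y) * Cz z := by
      calc _ ≤ ∑ i ∈ range (2 ^ (2 * y)), Cz z := by
            apply Finset.sum_le_sum; intro i hi
            apply Finset.sum_le_sum; intro f hf
            rw [show s + i + f * m = s + f * m + i by ring]
            exact kap_le_cell _ _ _ _ _ _ (Finset.mem_range.1 hi)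
        _ = _ := by simp
    have a2 : ∑ i ∈ range (2 ^ (2 * y)), ∑ f ∈ range (2 ^ (2 * y)), kap U e y z (s + i + f * m)
        = 2 ^ (2 * y) * (2 ^ (2 * y) * ((2 ^ e - 1) / 2 ^ (U + e))) +
         ∑ i ∈ range (2 ^ (2 * y)), ∑ f ∈ range (2 ^ (2 * y)), phz U e y z (s + i + f * m) := by
      unfold phz
      simp only [Finset.sum_sub_distrib]
      simp
    have a3 : |∑ i ∈ range (2 ^ (2 * y)), ∑ f ∈ range (2 ^ (2 * y)),
        phz U e y z (s + i + f * m)| ≤ Dz U e y z m := by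
      apply (Finset.abs_sum_le_sum_abs _ _).trans
      unfold Dz
      rw [← sum_shift (2 ^ (U + e + 2 * y))
        (fun s => |∑ f ∈ range (2 ^ (2 * y)), phz U e y z (s + f * m)|) _ s]
      · calc _ ≤ ∑ i ∈ range (2 ^ (U + e + 2 * y)), |∑ f ∈ range (2 ^ (2 * y)),
              phz U e y z (s + i + f * m)| := by
              apply Finset.sum_le_sum_of_subset_of_nonneg
              · apply Finset.range_mono
                exact Nat.pow_le_pow_right (by norm_num) (by omega)
              · intros; positivity
          _ = _ := by
              apply Finset.sum_congr rfl; intro i _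
              congr 1; apply Finset.sum_congr rfl; intro f _
              rw [add_comm s i]
      · intro n
        congr 1; apply Finset.sum_congr rfl; intro f _
        rw [show n + 2 ^ (U + e + 2 * y) + f * m = n + f * m + 2 ^ (U + e + 2 * y) by ring,
          phz_per]
    have a4 := neg_le_of_abs_le a3
    have hF : (0:ℝ) < 2 ^ (2 * y) := by positivity
    rw [a2] at a1
    rw [← mul_le_mul_iff_right₀ hF]
    have : (2:ℝ) ^ (2 * y) * (2 ^ (2 * y) / 2 ^ U -
      (2 ^ (2 * y) / 2 ^ (U + e) + Dz U e y z m / 2 ^ (2 * y))) =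
      2 ^ (2 * y) * (2 ^ (2 * y) * ((2 ^ e - 1) / 2 ^ (U + e))) - Dz U e y z m := by
      rw [pow_add 2 U e]; field_simp; ring
    rw [this]; linarith
  have h4 : ∑ f ∈ range (2 ^ (2 * y)), φ (cell U e y (s + f * m))
      - 2 ^ (2 * y) / 2 ^ U * ∑ z ∈ range (2 ^ U), φ z =
      ∑ z ∈ range (2 ^ U), (Cz z - 2 ^ (2 * y) / 2 ^ U) * φ z := by
    rw [h1, Finset.mul_sum, ← Finset.sum_sub_distrib]
    apply Finset.sum_congr rfl; intros; ring
  rw [h4]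
  have h5 : ∀ z ∈ range (2 ^ U), |(Cz z - 2 ^ (2 * y) / 2 ^ U) * φ z| ≤
      (Cz z - 2 ^ (2 * y) / 2 ^ U) +
      2 * (2 ^ (2 * y) / 2 ^ (U + e) + Dz U e y z m / 2 ^ (2 * y)) := by
    intro z hz
    have b1 := h3 z hz
    have b2 : 0 ≤ (2:ℝ) ^ (2 * y) / 2 ^ (U + e) + Dz U e y z m / 2 ^ (2 * y) := by
      have := Dz_nonneg U e y z m; positivity
    rw [abs_mul]
    apply (mul_le_of_le_one_right (abs_nonneg _) (hφ z)).trans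
    rw [abs_le]; constructor <;> linarith
  apply (Finset.abs_sum_le_sum_abs _ _).trans
  apply (Finset.sum_le_sum h5).trans
  rw [Finset.sum_add_distrib, Finset.sum_sub_distrib, h2, ← Finset.mul_sum]
  unfold Del
  simp only [Finset.sum_const, Finset.card_range, nsmul_eq_mul]
  push_cast
  rw [mul_div_cancel₀ _ (by positivity)]
  simp

end TM

namespace TM

lemma tw_perm (L n k : ℕ) : tw L (n + 2 ^ L * k) = tw L n :=
  periodic_mul _ _ (tw_per L) n k

lemma inner_corr (p q x K : ℕ) (hx : x < 2 ^ p) :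
    |∑ M ∈ range (2 ^ q), tw (p + q) (2 ^ p * M + x) * tw (p + q) (2 ^ p * M + x + K)|
      = |corr q ((x + K) / 2 ^ p)| := by
  have h : ∀ M ∈ range (2 ^ q), tw (p + q) (2 ^ p * M + x) * tw (p + q) (2 ^ p * M + x + K)
      = t x * t ((x + K) % 2 ^ p) * (tw q M * tw q (M + (x + K) / 2 ^ p)) := by
    intro M _
    have e1 : 2 ^ p * M + x = x + 2 ^ p * M := by ring
    have e2 : 2 ^ p * M + x + K = (x + K) % 2 ^ p + 2 ^ p * (M + (x + K) / 2 ^ p) := by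
      have := Nat.mod_add_div (x + K) (2 ^ p)
      rw [mul_add]; omega
    rw [e2, e1, tw_split' _ _ _ _ hx, tw_split' _ _ _ _ (Nat.mod_lt _ (by positivity))]
    ring
  rw [Finset.sum_congr rfl h, ← Finset.mul_sum, abs_mul, abs_mul, abs_t, abs_t]
  simp [corr]

lemma per_of_dvd (P Q : ℕ) (φ : ℕ → ℝ) (hφ : ∀ n, φ (n + P) = φ n) (h : P ∣ Q) (n : ℕ) :
    φ (n + Q) = φ n := by
  obtain ⟨k, rfl⟩ := h
  exact periodic_mul P φ hφ n k

lemma core_bound (p q b c g m0 ℓ r s1 s2 κ : ℕ) (hg : p + q ≤ g) (hc : b + c ≤ p)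
    (hκ : ∀ m, (s1 * m + κ * m) % 2 ^ (p + q) = (s2 * m) % 2 ^ (p + q)) (hκc : ¬ 2 ^ c ∣ κ) :
    |∑ J ∈ range (2 ^ g), ∑ n ∈ range (2 ^ (p + q)),
      tw (p + q) (n + s1 * (m0 + 2 ^ b * J)) * tw (p + q) (n + s2 * (m0 + 2 ^ b * J)) *
      (tw (p + q) (n + ℓ + s1 * (m0 + 2 ^ b * J + r)) *
       tw (p + q) (n + ℓ + s2 * (m0 + 2 ^ b * J + r)))|
    ≤ 2 ^ g * ∑ x ∈ range (2 ^ p), |corr q ((x + ℓ + s1 * r) / 2 ^ p)| := by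
  set w := tw (p + q) with hw
  have hwp : ∀ n, w (n + 2 ^ (p + q)) = w n := tw_per _
  set β1 : ℕ → ℝ := fun n => w n * w (n + (ℓ + s1 * r)) with hβ1
  set β2 : ℕ → ℝ := fun n => w n * w (n + (ℓ + s2 * r)) with hβ2
  have hβ1p : ∀ n, β1 (n + 2 ^ (p + q)) = β1 n := by
    intro n; simp only [hβ1]; rw [hwp, add_right_comm, hwp]
  have hβ2p : ∀ n, β2 (n + 2 ^ (p + q)) = β2 n := by
    intro n; simp only [hβ2]; rw [hwp, add_right_comm, hwp]
  have hβ2b : ∀ n, |β2 n| ≤ 1 := by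
    intro n; simp only [hβ2, hw]; rw [abs_mul, abs_tw, abs_tw]; norm_num
  set B2 : ℕ → ℝ := fun n => ∑ J ∈ range (2 ^ g), β2 (n + κ * (m0 + 2 ^ b * J)) with hB2
  have e1 : ∀ J ∈ range (2 ^ g), ∑ n ∈ range (2 ^ (p + q)),
      w (n + s1 * (m0 + 2 ^ b * J)) * w (n + s2 * (m0 + 2 ^ b * J)) *
      (w (n + ℓ + s1 * (m0 + 2 ^ b * J + r)) * w (n + ℓ + s2 * (m0 + 2 ^ b * J + r)))
      = ∑ n ∈ range (2 ^ (p + q)), β1 n * β2 (n + κ * (m0 + 2 ^ b * J)) := by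
    intro J _
    generalize m0 + 2 ^ b * J = m
    rw [← sum_shift (2 ^ (p + q)) (fun n => β1 n * β2 (n + κ * m)) _ (s1 * m)]
    · apply Finset.sum_congr rfl
      intro n _
      have : β2 (n + s1 * m + κ * m) = β2 (n + s2 * m) := by
        apply periodic_congr _ _ hβ2p
        rw [add_assoc, Nat.add_mod, hκ, ← Nat.add_mod]
      rw [this]
      simp only [hβ1, hβ2]
      rw [show n + ℓ + s1 * (m + r) = n + s1 * m + (ℓ + s1 * r) by ring,
        show n + ℓ + s2 * (m + r) = n + s2 * m + (ℓ + s2 * r) by ring]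
      ring
    · intro n
      rw [hβ1p, add_right_comm, hβ2p]
  rw [Finset.sum_congr rfl e1, Finset.sum_comm]
  have e2 : ∀ n ∈ range (2 ^ (p + q)), ∑ J ∈ range (2 ^ g), β1 n * β2 (n + κ * (m0 + 2 ^ b * J))
      = β1 n * B2 n := by
    intro n _; rw [← Finset.mul_sum]
  rw [Finset.sum_congr rfl e2]
  have hB2p : ∀ n, B2 (n + 2 ^ (p + q)) = B2 n := by
    intro n; simp only [hB2]
    apply Finset.sum_congr rfl; intro J _
    rw [add_right_comm, hβ2p]
  have hB2k : ∀ n j, B2 (n + κ * (2 ^ b * j)) = B2 n := by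
    intro n j
    simp only [hB2]
    rw [← sum_shift (2 ^ g) (fun J => β2 (n + κ * (m0 + 2 ^ b * J))) _ j]
    · apply Finset.sum_congr rfl; intro J _
      congr 1; ring
    · intro J
      rw [show n + κ * (m0 + 2 ^ b * (J + 2 ^ g)) = n + κ * (m0 + 2 ^ b * J) +
        2 ^ g * (κ * 2 ^ b) by ring]
      apply per_of_dvd _ _ _ hβ2p
      exact Dvd.dvd.mul_right (pow_dvd_pow _ hg) _
  obtain ⟨v, j, hv, hvd, hj⟩ := exists_mult c (p + q) κ hκc
  have hB2v : ∀ n, B2 (n + 2 ^ (v + b)) = B2 n := by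
    intro n
    rw [← hB2k n j]
    apply periodic_congr _ _ hB2p
    rw [show κ * (2 ^ b * j) = κ * j * 2 ^ b by ring, pow_add 2 v b, Nat.add_mod,
      Nat.mul_mod (2 ^ v), ← hj, ← Nat.mul_mod, ← Nat.add_mod]
  have hB2P : ∀ n, B2 (n + 2 ^ p) = B2 n :=
    per_of_dvd _ _ _ hB2v (pow_dvd_pow _ (by omega))
  have hB2b : ∀ n, |B2 n| ≤ 2 ^ g := by
    intro n
    apply (Finset.abs_sum_le_sum_abs _ _).trans
    apply (Finset.sum_le_sum fun J _ => hβ2b _).trans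
    simp
  have e3 : ∑ n ∈ range (2 ^ (p + q)), β1 n * B2 n =
      ∑ x ∈ range (2 ^ p), B2 x * ∑ M ∈ range (2 ^ q), β1 (2 ^ p * M + x) := by
    rw [pow_add, sum_range_mul, Finset.sum_comm]
    apply Finset.sum_congr rfl; intro x _
    rw [Finset.mul_sum]
    apply Finset.sum_congr rfl; intro M _
    rw [mul_comm]
    congr 1
    rw [add_comm, periodic_mul _ _ hB2P]
  rw [e3, Finset.mul_sum]
  apply (Finset.abs_sum_le_sum_abs _ _).trans
  apply Finset.sum_le_sum
  intro x hx
  rw [abs_mul]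
  apply mul_le_mul (hB2b x) _ (abs_nonneg _) (by positivity)
  simp only [hβ1, hw]
  rw [inner_corr p q x _ (Finset.mem_range.1 hx), add_assoc]

/-- the quadruple product -/
noncomputable def Psi (ρ h Ξ s1 s2 m r z : ℕ) : ℝ :=
  tw ρ (z / 2 ^ h + s1 * m) * tw ρ (z / 2 ^ h + s2 * m) *
    (tw ρ ((z + Ξ) / 2 ^ h + s1 * (m + r)) * tw ρ ((z + Ξ) / 2 ^ h + s2 * (m + r)))

noncomputable def maj (p q h g j Ξ r s1 : ℕ) : ℝ :=
  2 ^ g * ∑ z0 ∈ range (2 ^ h), ∑ x ∈ range (2 ^ p),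
    2 ^ q * Gm j ((x + (z0 + Ξ) / 2 ^ h + s1 * r) / 2 ^ p)

lemma maj_nonneg (p q h g j Ξ r s1 : ℕ) : 0 ≤ maj p q h g j Ξ r s1 := by
  unfold maj
  apply mul_nonneg (by positivity)
  apply Finset.sum_nonneg; intro _ _
  apply Finset.sum_nonneg; intro _ _
  exact mul_nonneg (by positivity) (Gm_nonneg _ _)

lemma Psi_sum (p q b c g h j m0 Ξ r s1 s2 κ : ℕ) (hg : p + q ≤ g) (hc : b + c ≤ p)
    (hj : 2 * j ≤ q)
    (hκ : ∀ m, (s1 * m + κ * m) % 2 ^ (p + q) = (s2 * m) % 2 ^ (p + q)) (hκc : ¬ 2 ^ c ∣ κ) :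
    |∑ J ∈ range (2 ^ g), ∑ z ∈ range (2 ^ (p + q + h)),
      Psi (p + q) h Ξ s1 s2 (m0 + 2 ^ b * J) r z| ≤ maj p q h g j Ξ r s1 := by
  have e1 : ∀ J ∈ range (2 ^ g), ∑ z ∈ range (2 ^ (p + q + h)),
      Psi (p + q) h Ξ s1 s2 (m0 + 2 ^ b * J) r z = ∑ z0 ∈ range (2 ^ h),
      ∑ n ∈ range (2 ^ (p + q)),
      tw (p + q) (n + s1 * (m0 + 2 ^ b * J)) * tw (p + q) (n + s2 * (m0 + 2 ^ b * J)) *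
      (tw (p + q) (n + (z0 + Ξ) / 2 ^ h + s1 * (m0 + 2 ^ b * J + r)) *
       tw (p + q) (n + (z0 + Ξ) / 2 ^ h + s2 * (m0 + 2 ^ b * J + r))) := by
    intro J _
    rw [pow_add 2 (p + q) h, mul_comm, sum_range_mul, Finset.sum_comm]
    apply Finset.sum_congr rfl; intro z0 hz0
    apply Finset.sum_congr rfl; intro n _
    unfold Psi
    rw [Finset.mem_range] at hz0
    rw [add_assoc (2 ^ h * n) z0 Ξ, Nat.mul_add_div (by positivity), Nat.mul_add_div (by positivity),
      Nat.div_eq_of_lt hz0, add_zero]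
  rw [Finset.sum_congr rfl e1, Finset.sum_comm]
  unfold maj
  rw [Finset.mul_sum]
  apply (Finset.abs_sum_le_sum_abs _ _).trans
  apply Finset.sum_le_sum; intro z0 _
  apply (core_bound p q b c g m0 _ r s1 s2 κ hg hc hκ hκc).trans
  gcongr
  exact corr_Gm j q _ hj

lemma maj_sum (p q h g j Ξ r A : ℕ) (hr : 0 < r) :
    ∑ s ∈ range (2 ^ (p + 2 * j)), maj p q h g j Ξ r (A + s) ≤
      2 ^ g * (2 ^ h * (2 ^ p * (2 ^ q * (r * (2 ^ p * 3 ^ j))))) := by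
  unfold maj
  rw [← Finset.mul_sum, Finset.sum_comm]
  gcongr
  calc _ ≤ ∑ z0 ∈ range (2 ^ h), (2:ℝ) ^ p * (2 ^ q * (r * (2 ^ p * 3 ^ j))) := by
        apply Finset.sum_le_sum; intro z0 _
        rw [Finset.sum_comm]
        calc _ ≤ ∑ x ∈ range (2 ^ p), (2:ℝ) ^ q * (r * (2 ^ p * 3 ^ j)) := by
              apply Finset.sum_le_sum; intro x _
              rw [← Finset.mul_sum]
              gcongr
              exact Gm_progression p j _ r A hr
          _ = _ := by simp
    _ = _ := by simp

lemma Psi_abs (ρ h Ξ s1 s2 m r z : ℕ) : |Psi ρ h Ξ s1 s2 m r z| = 1 := by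
  unfold Psi; simp [abs_mul, abs_tw]

end TM

namespace TM

noncomputable def Pr (l' ρ s1 s2 m r e : ℕ) : ℝ :=
  tw ρ (e * m / 2 ^ l' + s1 * m) * tw ρ (e * m / 2 ^ l' + s2 * m) *
    (tw ρ (e * (m + r) / 2 ^ l' + s1 * (m + r)) * tw ρ (e * (m + r) / 2 ^ l' + s2 * (m + r)))

lemma Pr_abs (l' ρ s1 s2 m r e : ℕ) : |Pr l' ρ s1 s2 m r e| = 1 := by
  unfold Pr; simp [abs_mul, abs_tw]

lemma Del_per (U e y m : ℕ) : Del U e y (m + 2 ^ (U + e + 2 * y)) = Del U e y m := by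
  unfold Del Dz
  congr 1
  apply Finset.sum_congr rfl; intro z _
  congr 2
  apply Finset.sum_congr rfl; intro s _
  congr 1
  apply Finset.sum_congr rfl; intro f _
  rw [show s + f * (m + 2 ^ (U + e + 2 * y)) = s + f * m + 2 ^ (U + e + 2 * y) * f by ring]
  exact periodic_mul _ _ (phz_per U e y z) _ _

/-- bad indicator -/
noncomputable def bad (h Ξ z : ℕ) : ℝ := if 2 ^ h ≤ (z + Ξ) % 2 ^ h + 2 then 1 else 0

lemma bad_per (h Ξ z : ℕ) : bad h Ξ (z + 2 ^ h) = bad h Ξ z := by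
  unfold bad; rw [add_right_comm, Nat.add_mod_right]

lemma bad_nonneg (h Ξ z : ℕ) : 0 ≤ bad h Ξ z := by unfold bad; split_ifs <;> simp
lemma bad_abs (h Ξ z : ℕ) : |bad h Ξ z| ≤ 1 := by unfold bad; split_ifs <;> simp

lemma bad_sum (h Ξ ρ : ℕ) : ∑ z ∈ range (2 ^ (ρ + h)), bad h Ξ z ≤ 2 * 2 ^ ρ := by
  rw [show 2 ^ (ρ + h) = 2 ^ h * 2 ^ ρ by ring]
  have := sum_periods (2 ^ h) (2 ^ ρ) (bad h Ξ) (bad_per h Ξ) 0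
  simp only [add_zero] at this
  rw [this]
  have h2 : ∑ z ∈ range (2 ^ h), bad h Ξ z = ∑ z ∈ range (2 ^ h), bad h 0 z := by
    rw [← sum_shift (2 ^ h) (bad h 0) (bad_per h 0) Ξ]
    rfl
  rw [h2]
  have h3 : ∑ z ∈ range (2 ^ h), bad h 0 z ≤ 2 := by
    have h4 : ∀ z ∈ range (2 ^ h), bad h 0 z = if 2 ^ h ≤ z + 2 then 1 else 0 := by
      intro z hz
      unfold bad
      rw [add_zero, Nat.mod_eq_of_lt (Finset.mem_range.1 hz)]
    rw [Finset.sum_congr rfl h4, Finset.sum_ite, Finset.sum_const_zero, add_zero,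
      Finset.sum_const, nsmul_eq_mul, mul_one]
    have : (range (2 ^ h)).filter (fun z => 2 ^ h ≤ z + 2) ⊆ Finset.Ico (2 ^ h - 2) (2 ^ h) := by
      intro z hz
      simp only [Finset.mem_filter, Finset.mem_range] at hz
      rw [Finset.mem_Ico]; omega
    have h5 := Finset.card_le_card this
    rw [Nat.card_Ico] at h5
    have h6 : ((range (2 ^ h)).filter (fun z => 2 ^ h ≤ z + 2)).card ≤ 2 := by omega
    exact_mod_cast h6
  push_cast
  nlinarith [pow_pos (show (0:ℝ) < 2 by norm_num) ρ]

lemma Psi_cell (ρ h Ξ s1 s2 m r X : ℕ) :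
    Psi ρ h Ξ s1 s2 m r (X % 2 ^ (ρ + h)) = Psi ρ h Ξ s1 s2 m r X := by
  apply periodic_mod
  intro n
  unfold Psi
  have h1 : (n + 2 ^ (ρ + h)) / 2 ^ h = n / 2 ^ h + 2 ^ ρ := by
    rw [add_comm ρ h]; have := div_add_mul n h ρ 1; simpa using this
  have h2 : (n + 2 ^ (ρ + h) + Ξ) / 2 ^ h = (n + Ξ) / 2 ^ h + 2 ^ ρ := by
    rw [add_comm ρ h]; have := div_add_mul (n + Ξ) h ρ 1
    rw [mul_one, mul_one] at this
    rw [← this]; congr 1; ring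
  rw [h1, h2]
  simp only [add_right_comm _ (2 ^ ρ) _, tw_per]

lemma bad_cell (ρ h Ξ X : ℕ) : bad h Ξ (X % 2 ^ (ρ + h)) = bad h Ξ X := by
  apply periodic_mod
  intro n
  rw [add_comm ρ h]
  exact per_of_dvd _ _ _ (bad_per h Ξ) (pow_dvd_pow _ (by omega)) n

lemma pointwise (ρ h ee y l b u E f s1 s2 m r : ℕ) (hr : r ≤ 2 ^ b)
    (hb : b ≤ ee) (hf : f < 2 ^ (2 * y)) :
    |Pr (h + (ee + 2 * y + l)) ρ s1 s2 m r (2 ^ l * (2 ^ (2 * y) * E + f) + u) -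
      Psi ρ h ((2 ^ l * (2 ^ (2 * y) * E) + u) * r / 2 ^ (ee + 2 * y + l)) s1 s2 m r
        (cell (ρ + h) ee y ((u * m / 2 ^ l + 2 ^ (2 * y) * E * m) + f * m))|
    ≤ 2 * bad h ((2 ^ l * (2 ^ (2 * y) * E) + u) * r / 2 ^ (ee + 2 * y + l))
        (cell (ρ + h) ee y ((u * m / 2 ^ l + 2 ^ (2 * y) * E * m) + f * m)) := by
  set Ξ := (2 ^ l * (2 ^ (2 * y) * E) + u) * r / 2 ^ (ee + 2 * y + l) with hΞ
  set e := 2 ^ l * (2 ^ (2 * y) * E + f) + u with he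
  set X := e * m / 2 ^ (ee + 2 * y + l) with hX
  have hcell : cell (ρ + h) ee y ((u * m / 2 ^ l + 2 ^ (2 * y) * E * m) + f * m)
      = X % 2 ^ (ρ + h) := by
    unfold cell
    congr 1
    rw [hX, show ee + 2 * y + l = l + (2 * y + ee) by ring, pow_add 2 l, ← Nat.div_div_eq_div_mul]
    congr 1
    rw [he, show (2 ^ l * (2 ^ (2 * y) * E + f) + u) * m =
      2 ^ l * (2 ^ (2 * y) * E * m + f * m) + u * m by ring, Nat.mul_add_div (by positivity)]
    ring
  rw [hcell, Psi_cell, bad_cell]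
  have hn1 : e * m / 2 ^ (h + (ee + 2 * y + l)) = X / 2 ^ h := by
    rw [hX, Nat.div_div_eq_div_mul, ← pow_add, add_comm h]
  have hn2 : e * (m + r) / 2 ^ (h + (ee + 2 * y + l)) =
      (e * (m + r) / 2 ^ (ee + 2 * y + l)) / 2 ^ h := by
    rw [Nat.div_div_eq_div_mul, ← pow_add, add_comm h]
  set D := 2 ^ (ee + 2 * y + l) with hD
  have hD0 : 0 < D := by positivity
  have hb1 : X + Ξ ≤ e * (m + r) / D := by
    rw [hX, hΞ, mul_add, Nat.le_div_iff_mul_le hD0, add_mul]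
    apply add_le_add (Nat.div_mul_le_self _ _)
    apply (Nat.div_mul_le_self _ _).trans
    apply Nat.mul_le_mul_right
    rw [he, mul_add]; omega
  have hb2 : e * (m + r) / D < X + Ξ + 3 := by
    rw [Nat.div_lt_iff_lt_mul hD0]
    have a1 := Nat.lt_div_mul_add (a := e * m) hD0
    have a2 := Nat.lt_div_mul_add (a := (2 ^ l * (2 ^ (2 * y) * E) + u) * r) hD0
    have a3 : 2 ^ l * f * r ≤ D := by
      have : D = 2 ^ l * 2 ^ (2 * y) * 2 ^ ee := by rw [hD]; ring
      rw [this]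
      apply Nat.mul_le_mul (Nat.mul_le_mul le_rfl hf.le)
      exact hr.trans (Nat.pow_le_pow_right (by norm_num) hb)
    rw [← hX] at a1
    rw [← hΞ] at a2
    have a4 : e * (m + r) = e * m + (2 ^ l * (2 ^ (2 * y) * E) + u) * r + 2 ^ l * f * r := by
      rw [he]; ring
    rw [a4, show (X + Ξ + 3) * D = X * D + Ξ * D + 3 * D by ring]
    omega
  by_cases hbad : 2 ^ h ≤ (X + Ξ) % 2 ^ h + 2
  · have : bad h Ξ X = 1 := by unfold bad; rw [if_pos hbad]
    rw [this]
    have h1 := Pr_abs (h + (ee + 2 * y + l)) ρ s1 s2 m r e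
    have h2 := Psi_abs ρ h Ξ s1 s2 m r X
    calc _ ≤ _ := abs_sub _ _
      _ = _ := by rw [h1, h2]; norm_num
  · have e2 : e * (m + r) / D / 2 ^ h = (X + Ξ) / 2 ^ h := by
      have c1 := Nat.mod_add_div (X + Ξ) (2 ^ h)
      apply Nat.div_eq_of_lt_le
      · rw [mul_comm]; omega
      · rw [show ((X + Ξ) / 2 ^ h + 1) * 2 ^ h = 2 ^ h * ((X + Ξ) / 2 ^ h) + 2 ^ h by ring]
        omega
    have : Pr (h + (ee + 2 * y + l)) ρ s1 s2 m r e = Psi ρ h Ξ s1 s2 m r X := by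
      unfold Pr Psi
      rw [hn1, hn2, e2]
    rw [this, sub_self, abs_zero]
    exact mul_nonneg (by norm_num) (bad_nonneg _ _ _)

lemma fsum (ρ h ee y l b u E s1 s2 m r : ℕ) (hr : r ≤ 2 ^ b) (hb : b ≤ ee) :
    |∑ f ∈ range (2 ^ (2 * y)),
      Pr (h + (ee + 2 * y + l)) ρ s1 s2 m r (2 ^ l * (2 ^ (2 * y) * E + f) + u) -
      2 ^ (2 * y) / 2 ^ (ρ + h) * ∑ z ∈ range (2 ^ (ρ + h)),
        Psi ρ h ((2 ^ l * (2 ^ (2 * y) * E) + u) * r / 2 ^ (ee + 2 * y + l)) s1 s2 m r z|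
    ≤ 3 * Del (ρ + h) ee y m + 4 * (2 ^ (2 * y) / 2 ^ h) := by
  set Ξ := (2 ^ l * (2 ^ (2 * y) * E) + u) * r / 2 ^ (ee + 2 * y + l) with hΞ
  set s := u * m / 2 ^ l + 2 ^ (2 * y) * E * m with hs
  have h1 : |∑ f ∈ range (2 ^ (2 * y)),
      Pr (h + (ee + 2 * y + l)) ρ s1 s2 m r (2 ^ l * (2 ^ (2 * y) * E + f) + u) -
      ∑ f ∈ range (2 ^ (2 * y)), Psi ρ h Ξ s1 s2 m r (cell (ρ + h) ee y (s + f * m))|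
      ≤ 2 * ∑ f ∈ range (2 ^ (2 * y)), bad h Ξ (cell (ρ + h) ee y (s + f * m)) := by
    rw [← Finset.sum_sub_distrib, Finset.mul_sum]
    apply (Finset.abs_sum_le_sum_abs _ _).trans
    apply Finset.sum_le_sum; intro f hf
    exact pointwise ρ h ee y l b u E f s1 s2 m r hr hb (Finset.mem_range.1 hf)
  have h2 := disc (ρ + h) ee y m s (fun z => Psi ρ h Ξ s1 s2 m r z) (fun n => (Psi_abs _ _ _ _ _ _ _ _).le)
  have h3 := disc (ρ + h) ee y m s (fun z => bad h Ξ z) (bad_abs h Ξ)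
  have h4 := bad_sum h Ξ ρ
  have h5 : (2:ℝ) ^ (2 * y) / 2 ^ (ρ + h) * ∑ z ∈ range (2 ^ (ρ + h)), bad h Ξ z
      ≤ 2 * (2 ^ (2 * y) / 2 ^ h) := by
    calc _ ≤ (2:ℝ) ^ (2 * y) / 2 ^ (ρ + h) * (2 * 2 ^ ρ) := by gcongr
      _ = _ := by rw [pow_add 2 ρ h]; field_simp
  rw [abs_le] at h1 h2 h3 ⊢
  constructor <;> linarith [h1.1, h1.2, h2.1, h2.2, h3.1, h3.2]

end TM

namespace TM

lemma Del_J (U e y b g μ i1 : ℕ) (hi : i1 < 2 ^ b) (hg : b + g = U + e + 2 * y) :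
    ∑ J ∈ range (2 ^ g), Del U e y (2 ^ (U + e + 2 * y) * μ + i1 + 2 ^ b * J) ≤
      ∑ m ∈ range (2 ^ (U + e + 2 * y)), Del U e y m := by
  rw [← sum_shift _ (Del U e y) (Del_per U e y) (2 ^ (U + e + 2 * y) * μ)]
  conv_rhs => rw [← hg, pow_add, sum_range_mul]
  apply Finset.sum_le_sum; intro J _
  have := Finset.single_le_sum (f := fun i => Del U e y (2 ^ b * J + i + 2 ^ b * 2 ^ g * μ))
    (s := range (2 ^ b)) (fun i _ => Del_nonneg _ _ _ _) (Finset.mem_range.2 hi)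
  refine le_trans (le_of_eq ?_) this
  rw [← hg]
  congr 1; ring

noncomputable def Esum (l' ρ g b M r s1 s2 : ℕ) : ℝ :=
  ∑ J ∈ range (2 ^ g), ∑ e ∈ range (2 ^ l'), Pr l' ρ s1 s2 (M + 2 ^ b * J) r e

noncomputable def Wb (p q h ee y l g j r : ℕ) (SD : ℝ) (s1 : ℕ) : ℝ :=
  ∑ u ∈ range (2 ^ l), ∑ E ∈ range (2 ^ (h + ee)),
    (2 ^ (2 * y) / 2 ^ (p + q + h) *
      maj p q h g j ((2 ^ l * (2 ^ (2 * y) * E) + u) * r / 2 ^ (ee + 2 * y + l)) r s1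
      + (3 * SD + 4 * (2 ^ (2 * y) / 2 ^ h) * 2 ^ g))

lemma Esum_le (p q b c g h ee y l j M r s1 s2 κ : ℕ) (SD : ℝ) (hg : p + q ≤ g) (hc : b + c ≤ p)
    (hj : 2 * j ≤ q) (hr : r ≤ 2 ^ b) (hb : b ≤ ee)
    (hSD : ∑ J ∈ range (2 ^ g), Del (p + q + h) ee y (M + 2 ^ b * J) ≤ SD)
    (hκ : ∀ m, (s1 * m + κ * m) % 2 ^ (p + q) = (s2 * m) % 2 ^ (p + q)) (hκc : ¬ 2 ^ c ∣ κ) :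
    |Esum (h + (ee + 2 * y + l)) (p + q) g b M r s1 s2| ≤ Wb p q h ee y l g j r SD s1 := by
  have e1 : Esum (h + (ee + 2 * y + l)) (p + q) g b M r s1 s2 =
      ∑ u ∈ range (2 ^ l), ∑ E ∈ range (2 ^ (h + ee)), ∑ J ∈ range (2 ^ g),
        ∑ f ∈ range (2 ^ (2 * y)), Pr (h + (ee + 2 * y + l)) (p + q) s1 s2 (M + 2 ^ b * J) r
          (2 ^ l * (2 ^ (2 * y) * E + f) + u) := by
    unfold Esum
    have : ∀ J ∈ range (2 ^ g), ∑ e ∈ range (2 ^ (h + (ee + 2 * y + l))),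
      Pr (h + (ee + 2 * y + l)) (p + q) s1 s2 (M + 2 ^ b * J) r e =
        ∑ u ∈ range (2 ^ l), ∑ E ∈ range (2 ^ (h + ee)),
        ∑ f ∈ range (2 ^ (2 * y)), Pr (h + (ee + 2 * y + l)) (p + q) s1 s2 (M + 2 ^ b * J) r
          (2 ^ l * (2 ^ (2 * y) * E + f) + u) := by
      intro J _
      have hh : range (2 ^ (h + (ee + 2 * y + l))) = range (2 ^ l * (2 ^ (2 * y) * 2 ^ (h + ee))) := by
        congr 1; ring
      rw [hh, sum_range_mul, Finset.sum_comm]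
      apply Finset.sum_congr rfl; intro u _
      rw [sum_range_mul (2 ^ (2 * y)) (2 ^ (h + ee)) (fun k =>
        Pr (h + (ee + 2 * y + l)) (p + q) s1 s2 (M + 2 ^ b * J) r (2 ^ l * k + u))]
    rw [Finset.sum_congr rfl this, Finset.sum_comm]
    apply Finset.sum_congr rfl; intro u _
    rw [Finset.sum_comm]
  rw [e1]
  unfold Wb
  apply (Finset.abs_sum_le_sum_abs _ _).trans
  apply Finset.sum_le_sum; intro u _
  apply (Finset.abs_sum_le_sum_abs _ _).trans
  apply Finset.sum_le_sum; intro E _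
  set Ξ := (2 ^ l * (2 ^ (2 * y) * E) + u) * r / 2 ^ (ee + 2 * y + l) with hΞ
  have h1 := Psi_sum p q b c g h j M Ξ r s1 s2 κ hg hc hj hκ hκc
  have h2 : |∑ J ∈ range (2 ^ g), (∑ f ∈ range (2 ^ (2 * y)),
      Pr (h + (ee + 2 * y + l)) (p + q) s1 s2 (M + 2 ^ b * J) r
          (2 ^ l * (2 ^ (2 * y) * E + f) + u) - 2 ^ (2 * y) / 2 ^ (p + q + h) *
      ∑ z ∈ range (2 ^ (p + q + h)), Psi (p + q) h Ξ s1 s2 (M + 2 ^ b * J) r z)|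
      ≤ 3 * SD + 4 * (2 ^ (2 * y) / 2 ^ h) * 2 ^ g := by
    apply (Finset.abs_sum_le_sum_abs _ _).trans
    apply (Finset.sum_le_sum fun J _ => fsum (p + q) h ee y l b u E s1 s2 (M + 2 ^ b * J) r hr hb).trans
    rw [Finset.sum_add_distrib, ← Finset.mul_sum]
    simp only [Finset.sum_const, Finset.card_range, nsmul_eq_mul]
    push_cast
    linarith
  rw [Finset.sum_sub_distrib, ← Finset.mul_sum] at h2
  have h3 : |(2:ℝ) ^ (2 * y) / 2 ^ (p + q + h) * ∑ J ∈ range (2 ^ g),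
      ∑ z ∈ range (2 ^ (p + q + h)), Psi (p + q) h Ξ s1 s2 (M + 2 ^ b * J) r z| ≤
      2 ^ (2 * y) / 2 ^ (p + q + h) * maj p q h g j Ξ r s1 := by
    rw [abs_mul, abs_of_nonneg (show (0:ℝ) ≤ 2 ^ (2 * y) / 2 ^ (p + q + h) by positivity)]
    gcongr
  rw [abs_le] at h2 h3 ⊢
  constructor <;> linarith [h2.1, h2.2, h3.1, h3.2]

lemma Wb_nonneg (p q h ee y l g j r : ℕ) (SD : ℝ) (hSD : 0 ≤ SD) (s1 : ℕ) :
    0 ≤ Wb p q h ee y l g j r SD s1 := by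
  unfold Wb
  apply Finset.sum_nonneg; intro _ _
  apply Finset.sum_nonneg; intro _ _
  have := maj_nonneg p q h g j
  apply add_nonneg (mul_nonneg (by positivity) (this _ _ _)) (by positivity)

lemma Wb_sum (p q h ee y l g j r A : ℕ) (SD : ℝ) (hr : 0 < r) :
    ∑ s ∈ range (2 ^ (p + 2 * j)), Wb p q h ee y l g j r SD (A + s) ≤
    2 ^ l * (2 ^ (h + ee) * (2 ^ (2 * y) / 2 ^ (p + q + h) *
      (2 ^ g * (2 ^ h * (2 ^ p * (2 ^ q * (r * (2 ^ p * 3 ^ j))))))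
      + 2 ^ (p + 2 * j) * (3 * SD + 4 * (2 ^ (2 * y) / 2 ^ h) * 2 ^ g))) := by
  unfold Wb
  rw [Finset.sum_comm]
  calc _ ≤ ∑ u ∈ range (2 ^ l), ((2:ℝ) ^ (h + ee) * (2 ^ (2 * y) / 2 ^ (p + q + h) *
      (2 ^ g * (2 ^ h * (2 ^ p * (2 ^ q * (r * (2 ^ p * 3 ^ j))))))
      + 2 ^ (p + 2 * j) * (3 * SD + 4 * (2 ^ (2 * y) / 2 ^ h) * 2 ^ g))) := by
        apply Finset.sum_le_sum; intro u _
        rw [Finset.sum_comm]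
        calc _ ≤ ∑ E ∈ range (2 ^ (h + ee)), ((2:ℝ) ^ (2 * y) / 2 ^ (p + q + h) *
              (2 ^ g * (2 ^ h * (2 ^ p * (2 ^ q * (r * (2 ^ p * 3 ^ j))))))
              + 2 ^ (p + 2 * j) * (3 * SD + 4 * (2 ^ (2 * y) / 2 ^ h) * 2 ^ g)) := by
              apply Finset.sum_le_sum; intro E _
              rw [Finset.sum_add_distrib, ← Finset.mul_sum, Finset.sum_const, Finset.card_range,
                nsmul_eq_mul]
              push_cast
              gcongr
              exact maj_sum p q h g j _ r A hr
          _ = _ := by rw [Finset.sum_const, Finset.card_range, nsmul_eq_mul]; push_cast; rfl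
    _ = _ := by rw [Finset.sum_const, Finset.card_range, nsmul_eq_mul]; push_cast; rfl

lemma Esum_triv (l' ρ g b M r s1 s2 : ℕ) : |Esum l' ρ g b M r s1 s2| ≤ 2 ^ g * 2 ^ l' := by
  unfold Esum
  apply (Finset.abs_sum_le_sum_abs _ _).trans
  calc _ ≤ ∑ J ∈ range (2 ^ g), (2:ℝ) ^ l' := by
        apply Finset.sum_le_sum; intro J _
        apply (Finset.abs_sum_le_sum_abs _ _).trans
        simp [Pr_abs]
    _ = _ := by simp

lemma count_div (c d A B : ℕ) :
    ∑ s ∈ range (2 ^ (c + d)), (if 2 ^ c ∣ A + s + B then (1:ℝ) else 0) = 2 ^ d := by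
  have h := sum_periods (2 ^ c) (2 ^ d) (fun s => if 2 ^ c ∣ s then (1:ℝ) else 0) (by
    intro n; simp) (A + B)
  rw [pow_add]
  have e : ∀ s ∈ range (2 ^ c * 2 ^ d), (if 2 ^ c ∣ A + s + B then (1:ℝ) else 0) =
      if 2 ^ c ∣ s + (A + B) then 1 else 0 := by
    intro s _; rw [show A + s + B = s + (A + B) by ring]
  rw [Finset.sum_congr rfl e, h]
  have : ∑ n ∈ range (2 ^ c), (if 2 ^ c ∣ n then (1:ℝ) else 0) = 1 := by
    rw [Finset.sum_eq_single_of_mem 0 (by simp)]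
    · simp
    · intro n hn hn0
      rw [if_neg]
      intro hd
      have := Nat.le_of_dvd (by omega) hd
      rw [Finset.mem_range] at hn; omega
  rw [this]; simp

end TM

namespace TM

lemma pow83 (b : ℕ) : (3:ℝ) ^ (8 * b) ≤ 2 ^ (13 * b) := by
  rw [pow_mul, pow_mul]
  exact pow_le_pow_left₀ (by norm_num) (by norm_num) _

lemma Wb_total (b l r A : ℕ) (SD : ℝ) (hr : 0 < r) (hrb : r ≤ 2 ^ b)
    (hSD : SD ≤ 6 * 2 ^ (231 * b + 9)) :
    ∑ s ∈ range (2 ^ (3 * b + 2 * (8 * b))),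
      Wb (3 * b) (18 * b + 1) (2 * b) (3 * b) (52 * b + 2) l (129 * b + 5) (8 * b) r SD (A + s)
      ≤ 23 * 2 ^ (255 * b + 9 + l) := by
  apply (Wb_sum _ _ _ _ _ _ _ _ _ _ _ hr).trans
  have h1 : (r:ℝ) ≤ 2 ^ b := by exact_mod_cast hrb
  have h2 := pow83 b
  have h3 : (r:ℝ) * (2 ^ (3 * b) * 3 ^ (8 * b)) ≤ 2 ^ b * (2 ^ (3 * b) * 2 ^ (13 * b)) := by
    gcongr
  calc _ ≤ (2:ℝ) ^ l * (2 ^ (2 * b + 3 * b) * (2 ^ (2 * (52 * b + 2)) / 2 ^ (3 * b + (18 * b + 1) + 2 * b) *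
      (2 ^ (129 * b + 5) * (2 ^ (2 * b) * (2 ^ (3 * b) * (2 ^ (18 * b + 1) *
        (2 ^ b * (2 ^ (3 * b) * 2 ^ (13 * b)))))))
      + 2 ^ (3 * b + 2 * (8 * b)) * (3 * (6 * 2 ^ (231 * b + 9)) +
        4 * (2 ^ (2 * (52 * b + 2)) / 2 ^ (2 * b)) * 2 ^ (129 * b + 5)))) := by
        gcongr
    _ = _ := by
        have e1 : (2:ℝ) ^ (2 * (52 * b + 2)) / 2 ^ (2 * b) = 2 ^ (102 * b + 4) := by
          rw [div_eq_iff (by positivity), ← pow_add]; congr 1; ring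
        have e2 : (2:ℝ) ^ (2 * (52 * b + 2)) / 2 ^ (3 * b + (18 * b + 1) + 2 * b) *
          (2 ^ (129 * b + 5) * (2 ^ (2 * b) * (2 ^ (3 * b) * (2 ^ (18 * b + 1) *
          (2 ^ b * (2 ^ (3 * b) * 2 ^ (13 * b)))))))  = 2 ^ (250 * b + 9) := by
          rw [div_mul_eq_mul_div, div_eq_iff (by positivity)]
          simp only [← pow_add]; congr 1; ring
        rw [e1, e2]
        have e3 : (2:ℝ) ^ (3 * b + 2 * (8 * b)) * (3 * (6 * 2 ^ (231 * b + 9)) +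
          4 * 2 ^ (102 * b + 4) * 2 ^ (129 * b + 5)) = 22 * 2 ^ (250 * b + 9) := by
          ring
        rw [e3]; ring

lemma SD_bound (b : ℕ) : ∑ m ∈ range (2 ^ ((3 * b + (18 * b + 1) + 2 * b) + 3 * b + 2 * (52 * b + 2))),
    Del (3 * b + (18 * b + 1) + 2 * b) (3 * b) (52 * b + 2) m ≤ 6 * 2 ^ (231 * b + 9) := by
  apply (Del_sum _ _ _).trans
  apply le_of_eq
  have e1 : (2:ℝ) ^ (2 * (52 * b + 2)) / 2 ^ (3 * b) = 2 ^ (101 * b + 4) := by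
    rw [div_eq_iff (by positivity), ← pow_add]; congr 1; ring
  rw [e1]; ring

lemma Esum_total (b l μ i1 r l' ρ g G : ℕ) (hr : 0 < r) (hrb : r ≤ 2 ^ b) (hi : i1 < 2 ^ b)
    (hl' : l' = 109 * b + 4 + l) (hρ : ρ = 21 * b + 1) (hg : g = 129 * b + 5)
    (hG : G = 130 * b + 5) :
    ∑ s1 ∈ range (2 ^ (19 * b)), ∑ s2 ∈ range (2 ^ (19 * b)),
      |Esum l' ρ g b (2 ^ G * μ + i1) r (2 ^ (19 * b) + s1) (2 ^ (19 * b) + s2)|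
      ≤ 24 * 2 ^ (274 * b + 9 + l) := by
  obtain rfl : l' = 2 * b + (3 * b + 2 * (52 * b + 2) + l) := by omega
  obtain rfl : ρ = 3 * b + (18 * b + 1) := by omega
  obtain rfl : G = (3 * b + (18 * b + 1) + 2 * b) + 3 * b + 2 * (52 * b + 2) := by omega
  subst hg
  set SD := ∑ m ∈ range (2 ^ ((3 * b + (18 * b + 1) + 2 * b) + 3 * b + 2 * (52 * b + 2))),
    Del (3 * b + (18 * b + 1) + 2 * b) (3 * b) (52 * b + 2) m with hSD
  have hSD0 : 0 ≤ SD := Finset.sum_nonneg fun _ _ => Del_nonneg _ _ _ _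
  have hSD1 : SD ≤ 6 * 2 ^ (231 * b + 9) := SD_bound b
  have hSDJ := Del_J (3 * b + (18 * b + 1) + 2 * b) (3 * b) (52 * b + 2) b (129 * b + 5) μ i1 hi
    (by ring)
  rw [← hSD] at hSDJ
  set A := 2 ^ (19 * b) with hA
  set W := Wb (3 * b) (18 * b + 1) (2 * b) (3 * b) (52 * b + 2) l (129 * b + 5) (8 * b) r SD with hW
  set P := 2 ^ (3 * b + (18 * b + 1)) with hP
  have hP1 : 1 ≤ P := Nat.one_le_two_pow
  have key : ∀ s1 s2, |Esum (2 * b + (3 * b + 2 * (52 * b + 2) + l)) (3 * b + (18 * b + 1)) (129 * b + 5) b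
      (2 ^ ((3 * b + (18 * b + 1) + 2 * b) + 3 * b + 2 * (52 * b + 2)) * μ + i1) r (A + s1) (A + s2)|
      ≤ W (A + s1) + (2 ^ (129 * b + 5) * 2 ^ (2 * b + (3 * b + 2 * (52 * b + 2) + l))) *
        (if 2 ^ (2 * b) ∣ A + s2 + (P - 1) * (A + s1) then 1 else 0) := by
    intro s1 s2
    by_cases hd : 2 ^ (2 * b) ∣ A + s2 + (P - 1) * (A + s1)
    · rw [if_pos hd, mul_one]
      have := Wb_nonneg (3 * b) (18 * b + 1) (2 * b) (3 * b) (52 * b + 2) l (129 * b + 5) (8 * b) r SD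
        hSD0 (A + s1)
      have h2 := Esum_triv (2 * b + (3 * b + 2 * (52 * b + 2) + l)) (3 * b + (18 * b + 1)) (129 * b + 5) b
        (2 ^ ((3 * b + (18 * b + 1) + 2 * b) + 3 * b + 2 * (52 * b + 2)) * μ + i1) r (A + s1) (A + s2)
      linarith
    · rw [if_neg hd, mul_zero, add_zero]
      apply Esum_le (3 * b) (18 * b + 1) b (2 * b) (129 * b + 5) (2 * b) (3 * b) (52 * b + 2) l (8 * b)
        _ r (A + s1) (A + s2) _ SD (by omega) (by omega) (by omega) hrb (by omega) hSDJ _ hd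
      intro m
      rw [← hP]
      have : (A + s1) * m + (A + s2 + (P - 1) * (A + s1)) * m = (A + s2) * m + P * ((A + s1) * m) := by
        obtain ⟨k, hk⟩ : ∃ k, P = k + 1 := ⟨P - 1, by omega⟩
        rw [hk]; simp only [Nat.add_sub_cancel]; ring
      rw [this, Nat.add_mul_mod_self_left]
  have h1 := Wb_total b l r A SD hr hrb hSD1
  rw [← hW] at h1
  have hA2 : A = 2 ^ (3 * b + 2 * (8 * b)) := by rw [hA]; congr 1; ring
  rw [← hA2] at h1
  have hA3 : A = 2 ^ (2 * b + 17 * b) := by rw [hA]; congr 1; ring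
  calc _ ≤ ∑ s1 ∈ range A, ∑ s2 ∈ range A, (W (A + s1) +
        (2 ^ (129 * b + 5) * 2 ^ (2 * b + (3 * b + 2 * (52 * b + 2) + l))) *
        (if 2 ^ (2 * b) ∣ A + s2 + (P - 1) * (A + s1) then (1:ℝ) else 0)) :=
        Finset.sum_le_sum fun s1 _ => Finset.sum_le_sum fun s2 _ => key s1 s2
    _ = A * ∑ s1 ∈ range A, W (A + s1) +
        A * ((2 ^ (129 * b + 5) * 2 ^ (2 * b + (3 * b + 2 * (52 * b + 2) + l))) * 2 ^ (17 * b)) := by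
        rw [Finset.mul_sum]
        have : (A:ℝ) * ((2 ^ (129 * b + 5) * 2 ^ (2 * b + (3 * b + 2 * (52 * b + 2) + l))) * 2 ^ (17 * b))
          = ∑ s1 ∈ range A, ((2 ^ (129 * b + 5) * 2 ^ (2 * b + (3 * b + 2 * (52 * b + 2) + l))) * (2:ℝ) ^ (17 * b)) := by
          rw [Finset.sum_const, Finset.card_range, nsmul_eq_mul]
        rw [this, ← Finset.sum_add_distrib]
        apply Finset.sum_congr rfl; intro s1 _
        rw [Finset.sum_add_distrib, ← Finset.mul_sum, Finset.sum_const, Finset.card_range, nsmul_eq_mul]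
        congr 2
        have := count_div (2 * b) (17 * b) A ((P - 1) * (A + s1))
        rw [← hA3] at this
        exact this
    _ ≤ A * (23 * 2 ^ (255 * b + 9 + l)) +
        A * ((2 ^ (129 * b + 5) * 2 ^ (2 * b + (3 * b + 2 * (52 * b + 2) + l))) * 2 ^ (17 * b)) := by
        gcongr
    _ = _ := by
        rw [hA]; push_cast; ring

end TM

namespace TM

lemma tw_decomp (l' ρ S e m : ℕ) : tw (l' + ρ) ((2 ^ l' * S + e) * m) =
    tw l' (e * m) * tw ρ (e * m / 2 ^ l' + S * m) := by
  rw [tw_split, show (2 ^ l' * S + e) * m = e * m + 2 ^ l' * (S * m) by ring, tw_perm,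
    Nat.add_mul_div_left _ _ (by positivity)]

lemma CS2 (l' ρ a g b M r : ℕ) :
    (∑ J ∈ range (2 ^ g), |∑ d ∈ range (2 ^ (l' + a)),
      tw (l' + ρ) ((2 ^ (l' + a) + d) * (M + 2 ^ b * J)) *
      tw (l' + ρ) ((2 ^ (l' + a) + d) * (M + 2 ^ b * J + r))|) ^ 2 ≤
    2 ^ g * 2 ^ l' * ∑ s1 ∈ range (2 ^ a), ∑ s2 ∈ range (2 ^ a),
      |Esum l' ρ g b M r (2 ^ a + s1) (2 ^ a + s2)| := by
  set Am : ℕ → ℕ → ℕ → ℝ := fun J e s =>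
    tw ρ (e * (M + 2 ^ b * J) / 2 ^ l' + (2 ^ a + s) * (M + 2 ^ b * J)) *
    tw ρ (e * (M + 2 ^ b * J + r) / 2 ^ l' + (2 ^ a + s) * (M + 2 ^ b * J + r)) with hAm
  have h1 : ∀ J ∈ range (2 ^ g), |∑ d ∈ range (2 ^ (l' + a)),
      tw (l' + ρ) ((2 ^ (l' + a) + d) * (M + 2 ^ b * J)) *
      tw (l' + ρ) ((2 ^ (l' + a) + d) * (M + 2 ^ b * J + r))| ≤
      ∑ e ∈ range (2 ^ l'), |∑ s ∈ range (2 ^ a), Am J e s| := by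
    intro J _
    rw [show range (2 ^ (l' + a)) = range (2 ^ l' * 2 ^ a) by rw [pow_add], sum_range_mul,
      Finset.sum_comm]
    apply (Finset.abs_sum_le_sum_abs _ _).trans
    apply Finset.sum_le_sum; intro e _
    have : ∀ s ∈ range (2 ^ a),
        tw (l' + ρ) ((2 ^ (l' + a) + (2 ^ l' * s + e)) * (M + 2 ^ b * J)) *
        tw (l' + ρ) ((2 ^ (l' + a) + (2 ^ l' * s + e)) * (M + 2 ^ b * J + r)) =
        tw l' (e * (M + 2 ^ b * J)) * tw l' (e * (M + 2 ^ b * J + r)) * Am J e s := by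
      intro s _
      rw [show 2 ^ (l' + a) + (2 ^ l' * s + e) = 2 ^ l' * (2 ^ a + s) + e by ring,
        tw_decomp, tw_decomp]
      simp only [hAm]; ring
    rw [Finset.sum_congr rfl this, ← Finset.mul_sum, abs_mul, abs_mul, abs_tw, abs_tw]
    simp
  have h2 : (∑ J ∈ range (2 ^ g), ∑ e ∈ range (2 ^ l'), |∑ s ∈ range (2 ^ a), Am J e s|) ^ 2 ≤
      2 ^ g * 2 ^ l' * ∑ J ∈ range (2 ^ g), ∑ e ∈ range (2 ^ l'), (∑ s ∈ range (2 ^ a), Am J e s) ^ 2 := by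
    rw [← Finset.sum_product', ← Finset.sum_product']
    apply (sq_sum_le_card_mul_sum_sq).trans
    simp only [Finset.card_product, Finset.card_range, sq_abs]
    push_cast
    rfl
  have h3 : ∑ J ∈ range (2 ^ g), ∑ e ∈ range (2 ^ l'), (∑ s ∈ range (2 ^ a), Am J e s) ^ 2 =
      ∑ s1 ∈ range (2 ^ a), ∑ s2 ∈ range (2 ^ a), Esum l' ρ g b M r (2 ^ a + s1) (2 ^ a + s2) := by
    unfold Esum
    simp_rw [pow_two, Finset.sum_mul_sum]
    have e1 : ∀ J e s1 s2, Am J e s1 * Am J e s2 = Pr l' ρ (2 ^ a + s1) (2 ^ a + s2) (M + 2 ^ b * J) r e := by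
      intro J e s1 s2
      simp only [hAm, Pr]; ring
    simp_rw [e1]
    rw [Finset.sum_congr rfl fun J _ => Finset.sum_comm, Finset.sum_comm]
    apply Finset.sum_congr rfl; intro s1 _
    rw [Finset.sum_congr rfl fun J _ => Finset.sum_comm, Finset.sum_comm]
  have h4 : (∑ J ∈ range (2 ^ g), |∑ d ∈ range (2 ^ (l' + a)),
      tw (l' + ρ) ((2 ^ (l' + a) + d) * (M + 2 ^ b * J)) *
      tw (l' + ρ) ((2 ^ (l' + a) + d) * (M + 2 ^ b * J + r))|) ^ 2 ≤
     (∑ J ∈ range (2 ^ g), ∑ e ∈ range (2 ^ l'), |∑ s ∈ range (2 ^ a), Am J e s|) ^ 2 := by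
    gcongr with J hJ
    exact h1 J hJ
  apply h4.trans (h2.trans _)
  rw [h3]
  gcongr
  exact le_abs_self _

lemma Q1_bound (b l μ i1 r k lam g G : ℕ) (hr : 0 < r) (hrb : r ≤ 2 ^ b) (hi : i1 < 2 ^ b)
    (hk : k = 128 * b + 4 + l) (hlam : lam = 130 * b + 5 + l) (hg : g = 129 * b + 5)
    (hG : G = 130 * b + 5) :
    ∑ J ∈ range (2 ^ g), |∑ d ∈ range (2 ^ k),
      tw lam ((2 ^ k + d) * (2 ^ G * μ + i1 + 2 ^ b * J)) *
      tw lam ((2 ^ k + d) * (2 ^ G * μ + i1 + 2 ^ b * J + r))| ≤ 5 * 2 ^ (256 * b + 9 + l) := by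
  have h := CS2 (109 * b + 4 + l) (21 * b + 1) (19 * b) g b (2 ^ G * μ + i1) r
  have h2 := Esum_total b l μ i1 r _ _ g G hr hrb hi rfl rfl hg hG
  rw [show 109 * b + 4 + l + 19 * b = k by omega,
    show 109 * b + 4 + l + (21 * b + 1) = lam by omega] at h
  apply le_of_sq_le_sq _ (by positivity)
  apply h.trans
  calc _ ≤ (2:ℝ) ^ g * 2 ^ (109 * b + 4 + l) * (24 * 2 ^ (274 * b + 9 + l)) := by gcongr
    _ = 24 * (2 ^ (256 * b + 9 + l)) ^ 2 := by
        rw [hg]; ring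
    _ ≤ _ := by
        rw [mul_pow]; gcongr; norm_num

end TM

namespace TM

lemma trunc_pt (lam d m r B : ℕ) (hr : r ≤ B) :
    |t (d * m) * t (d * (m + r)) - tw lam (d * m) * tw lam (d * (m + r))| ≤
      2 * (((d * (m + B) / 2 ^ lam : ℕ) : ℝ) - ((d * m / 2 ^ lam : ℕ) : ℝ)) := by
  have h1 : d * m / 2 ^ lam ≤ d * (m + r) / 2 ^ lam :=
    Nat.div_le_div_right (Nat.mul_le_mul_left _ (by omega))
  have h2 : d * (m + r) / 2 ^ lam ≤ d * (m + B) / 2 ^ lam :=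
    Nat.div_le_div_right (Nat.mul_le_mul_left _ (by omega))
  rcases Nat.lt_or_ge (d * m / 2 ^ lam) (d * (m + r) / 2 ^ lam) with h | h
  · have h3 : ((d * m / 2 ^ lam : ℕ) : ℝ) + 1 ≤ ((d * (m + B) / 2 ^ lam : ℕ) : ℝ) := by
      exact_mod_cast (by omega : d * m / 2 ^ lam + 1 ≤ d * (m + B) / 2 ^ lam)
    apply (abs_sub _ _).trans
    rw [abs_mul, abs_mul, abs_t, abs_t, abs_tw, abs_tw]
    linarith
  · have he : d * (m + r) / 2 ^ lam = d * m / 2 ^ lam := le_antisymm h h1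
    rw [t_eq_tw lam (d * m), t_eq_tw lam (d * (m + r)), he]
    have := t_sq (d * m / 2 ^ lam)
    have e : tw lam (d * m) * t (d * m / 2 ^ lam) * (tw lam (d * (m + r)) * t (d * m / 2 ^ lam)) -
      tw lam (d * m) * tw lam (d * (m + r)) =
      tw lam (d * m) * tw lam (d * (m + r)) * (t (d * m / 2 ^ lam) ^ 2 - 1) := by ring
    rw [e]
    have h5 : t (d * m / 2 ^ lam) ^ 2 = 1 := by first | exact this | (rw [pow_two]; exact this)
    rw [h5, sub_self, mul_zero, abs_zero]
    have : ((d * m / 2 ^ lam : ℕ) : ℝ) ≤ ((d * (m + B) / 2 ^ lam : ℕ) : ℝ) := by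
      exact_mod_cast h1.trans h2
    linarith

lemma trunc_sum (lam d M b g r v : ℕ) (hr : r ≤ 2 ^ b) (hd : d * 2 ^ (b + g) ≤ 2 ^ lam * 2 ^ v) :
    ∑ J ∈ range (2 ^ g), |t (d * (M + 2 ^ b * J)) * t (d * (M + 2 ^ b * J + r)) -
      tw lam (d * (M + 2 ^ b * J)) * tw lam (d * (M + 2 ^ b * J + r))| ≤ 4 * 2 ^ v := by
  calc _ ≤ ∑ J ∈ range (2 ^ g), 2 * (((d * (M + 2 ^ b * (J + 1)) / 2 ^ lam : ℕ) : ℝ) -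
          ((d * (M + 2 ^ b * J) / 2 ^ lam : ℕ) : ℝ)) := by
        apply Finset.sum_le_sum; intro J _
        have := trunc_pt lam d (M + 2 ^ b * J) r (2 ^ b) hr
        rwa [show M + 2 ^ b * J + 2 ^ b = M + 2 ^ b * (J + 1) by ring] at this
    _ = 2 * (((d * (M + 2 ^ b * 2 ^ g) / 2 ^ lam : ℕ) : ℝ) -
          ((d * (M + 2 ^ b * 0) / 2 ^ lam : ℕ) : ℝ)) := by
        rw [← Finset.mul_sum,
          Finset.sum_range_sub (fun J => ((d * (M + 2 ^ b * J) / 2 ^ lam : ℕ) : ℝ))]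
    _ ≤ _ := by
        have h1 : d * (M + 2 ^ b * 2 ^ g) / 2 ^ lam ≤ d * (M + 2 ^ b * 0) / 2 ^ lam + 2 ^ v := by
          rw [← Nat.add_mul_div_left _ _ (by positivity : 0 < 2 ^ lam)]
          apply Nat.div_le_div_right
          rw [mul_add, ← pow_add]; simp; exact hd
        have h2 : ((d * (M + 2 ^ b * 2 ^ g) / 2 ^ lam : ℕ) : ℝ) ≤
          ((d * (M + 2 ^ b * 0) / 2 ^ lam : ℕ) : ℝ) + 2 ^ v := by exact_mod_cast h1
        have : (0:ℝ) < 2 ^ v := by positivity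
        linarith

noncomputable def Qc (k g b G μ i1 i2 : ℕ) : ℝ := ∑ J ∈ range (2 ^ g), ∑ d ∈ range (2 ^ k),
  t ((2 ^ k + d) * (2 ^ G * μ + i1 + 2 ^ b * J)) * t ((2 ^ k + d) * (2 ^ G * μ + i2 + 2 ^ b * J))

lemma Qc_symm (k g b G μ i1 i2 : ℕ) : Qc k g b G μ i1 i2 = Qc k g b G μ i2 i1 := by
  unfold Qc
  apply Finset.sum_congr rfl; intro _ _
  apply Finset.sum_congr rfl; intro _ _
  ring

lemma Qc_lt (b l μ i1 i2 k g G : ℕ) (hi : i1 < i2) (hi2 : i2 < 2 ^ b)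
    (hk : k = 128 * b + 4 + l) (hg : g = 129 * b + 5) (hG : G = 130 * b + 5) :
    |Qc k g b G μ i1 i2| ≤ 9 * 2 ^ (256 * b + 9 + l) := by
  obtain ⟨r, rfl⟩ : ∃ r, i2 = i1 + r := ⟨i2 - i1, by omega⟩
  set lam := 130 * b + 5 + l with hlam
  set M := 2 ^ G * μ + i1 with hM
  have h1 := Q1_bound b l μ i1 r k lam g G (by omega) (by omega) (by omega) hk hlam hg hG
  rw [← hM] at h1
  have h2 : ∀ d ∈ range (2 ^ k), ∑ J ∈ range (2 ^ g),
      |t ((2 ^ k + d) * (M + 2 ^ b * J)) * t ((2 ^ k + d) * (M + 2 ^ b * J + r)) -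
      tw lam ((2 ^ k + d) * (M + 2 ^ b * J)) * tw lam ((2 ^ k + d) * (M + 2 ^ b * J + r))|
      ≤ 4 * 2 ^ (128 * b + 5) := by
    intro d hd
    apply trunc_sum lam _ M b g r _ (by omega)
    rw [Finset.mem_range] at hd
    calc (2 ^ k + d) * 2 ^ (b + g) ≤ (2 ^ k * 2) * 2 ^ (b + g) := by
          apply Nat.mul_le_mul_right; omega
      _ = _ := by rw [hk, hg, hlam]; ring
  have e1 : Qc k g b G μ i1 (i1 + r) =
      ∑ J ∈ range (2 ^ g), ∑ d ∈ range (2 ^ k),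
        tw lam ((2 ^ k + d) * (M + 2 ^ b * J)) * tw lam ((2 ^ k + d) * (M + 2 ^ b * J + r)) +
      ∑ d ∈ range (2 ^ k), ∑ J ∈ range (2 ^ g),
      (t ((2 ^ k + d) * (M + 2 ^ b * J)) * t ((2 ^ k + d) * (M + 2 ^ b * J + r)) -
      tw lam ((2 ^ k + d) * (M + 2 ^ b * J)) * tw lam ((2 ^ k + d) * (M + 2 ^ b * J + r))) := by
    unfold Qc
    rw [Finset.sum_comm (s := range (2 ^ k)), ← Finset.sum_add_distrib]
    apply Finset.sum_congr rfl; intro J _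
    rw [← Finset.sum_add_distrib]
    apply Finset.sum_congr rfl; intro d _
    rw [← hM, show 2 ^ G * μ + (i1 + r) + 2 ^ b * J = M + 2 ^ b * J + r by rw [hM]; ring]
    ring
  rw [e1]
  apply (abs_add_le _ _).trans
  have h3 := (Finset.abs_sum_le_sum_abs (fun J => ∑ d ∈ range (2 ^ k),
        tw lam ((2 ^ k + d) * (M + 2 ^ b * J)) * tw lam ((2 ^ k + d) * (M + 2 ^ b * J + r)))
        (range (2 ^ g))).trans h1
  have h4 : |∑ d ∈ range (2 ^ k), ∑ J ∈ range (2 ^ g),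
      (t ((2 ^ k + d) * (M + 2 ^ b * J)) * t ((2 ^ k + d) * (M + 2 ^ b * J + r)) -
      tw lam ((2 ^ k + d) * (M + 2 ^ b * J)) * tw lam ((2 ^ k + d) * (M + 2 ^ b * J + r)))| ≤
      4 * 2 ^ (256 * b + 9 + l) := by
    apply (Finset.abs_sum_le_sum_abs _ _).trans
    calc _ ≤ ∑ d ∈ range (2 ^ k), (4:ℝ) * 2 ^ (128 * b + 5) := by
          apply Finset.sum_le_sum; intro d hd
          exact (Finset.abs_sum_le_sum_abs _ _).trans (h2 d hd)
      _ = _ := by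
          rw [Finset.sum_const, Finset.card_range, nsmul_eq_mul, hk]; push_cast; ring
  linarith

lemma T_sq (b l μ k g G : ℕ)
    (hk : k = 128 * b + 4 + l) (hg : g = 129 * b + 5) (hG : G = 130 * b + 5) :
    (∑ J ∈ range (2 ^ g), ∑ d ∈ range (2 ^ k),
      |∑ i ∈ range (2 ^ b), t ((2 ^ k + d) * (2 ^ G * μ + i + 2 ^ b * J))|) ^ 2 ≤
      10 * (2 ^ g * 2 ^ k) ^ 2 * 2 ^ b := by
  have h2 : (∑ J ∈ range (2 ^ g), ∑ d ∈ range (2 ^ k),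
      |∑ i ∈ range (2 ^ b), t ((2 ^ k + d) * (2 ^ G * μ + i + 2 ^ b * J))|) ^ 2 ≤
      2 ^ g * 2 ^ k * ∑ J ∈ range (2 ^ g), ∑ d ∈ range (2 ^ k),
      (∑ i ∈ range (2 ^ b), t ((2 ^ k + d) * (2 ^ G * μ + i + 2 ^ b * J))) ^ 2 := by
    rw [← Finset.sum_product', ← Finset.sum_product']
    apply (sq_sum_le_card_mul_sum_sq).trans
    simp only [Finset.card_product, Finset.card_range, sq_abs]
    push_cast
    rfl
  have h3 : ∑ J ∈ range (2 ^ g), ∑ d ∈ range (2 ^ k),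
      (∑ i ∈ range (2 ^ b), t ((2 ^ k + d) * (2 ^ G * μ + i + 2 ^ b * J))) ^ 2 =
      ∑ i1 ∈ range (2 ^ b), ∑ i2 ∈ range (2 ^ b), Qc k g b G μ i1 i2 := by
    unfold Qc
    simp_rw [pow_two, Finset.sum_mul_sum]
    rw [Finset.sum_congr rfl fun J _ => Finset.sum_comm, Finset.sum_comm]
    apply Finset.sum_congr rfl; intro s1 _
    rw [Finset.sum_congr rfl fun J _ => Finset.sum_comm, Finset.sum_comm]
  have h4 : ∀ i1 ∈ range (2 ^ b), ∀ i2 ∈ range (2 ^ b), Qc k g b G μ i1 i2 ≤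
      9 * 2 ^ (256 * b + 9 + l) + (if i2 = i1 then 2 ^ g * 2 ^ k else 0) := by
    intro i1 h1 i2 h2
    rw [Finset.mem_range] at h1 h2
    rcases lt_trichotomy i1 i2 with h | h | h
    · rw [if_neg (by omega), add_zero]
      exact (le_abs_self _).trans (Qc_lt b l μ i1 i2 k g G h h2 hk hg hG)
    · rw [if_pos h.symm]
      have : Qc k g b G μ i1 i2 ≤ 2 ^ g * 2 ^ k := by
        unfold Qc
        subst h
        calc _ ≤ ∑ J ∈ range (2 ^ g), ∑ d ∈ range (2 ^ k), (1:ℝ) := by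
              apply Finset.sum_le_sum; intro J _
              apply Finset.sum_le_sum; intro d _
              rw [← abs_mul_abs_self, abs_t]; norm_num
          _ = _ := by simp
      have : (0:ℝ) ≤ 9 * 2 ^ (256 * b + 9 + l) := by positivity
      linarith
    · rw [if_neg (by omega), add_zero, Qc_symm]
      exact (le_abs_self _).trans (Qc_lt b l μ i2 i1 k g G h h1 hk hg hG)
  have h5 : ∑ i1 ∈ range (2 ^ b), ∑ i2 ∈ range (2 ^ b), Qc k g b G μ i1 i2 ≤
      10 * (2 ^ g * 2 ^ k) * 2 ^ b := by
    calc _ ≤ ∑ i1 ∈ range (2 ^ b), ∑ i2 ∈ range (2 ^ b), ((9:ℝ) * 2 ^ (256 * b + 9 + l) +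
            (if i2 = i1 then 2 ^ g * 2 ^ k else 0)) :=
          Finset.sum_le_sum fun i1 h1 => Finset.sum_le_sum fun i2 h2 => h4 i1 h1 i2 h2
      _ = ∑ i1 ∈ range (2 ^ b), ((2:ℝ) ^ b * (9 * 2 ^ (256 * b + 9 + l)) + 2 ^ g * 2 ^ k) := by
          apply Finset.sum_congr rfl; intro i1 hi1
          rw [Finset.sum_add_distrib, Finset.sum_ite_eq', if_pos hi1]
          simp
      _ = _ := by
          rw [Finset.sum_const, Finset.card_range, nsmul_eq_mul, hk, hg]; push_cast; ring
  apply h2.trans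
  rw [h3]
  calc _ ≤ (2:ℝ) ^ g * 2 ^ k * (10 * (2 ^ g * 2 ^ k) * 2 ^ b) := by gcongr
    _ = _ := by ring

lemma T_bound (β l μ k g G : ℕ)
    (hk : k = 256 * β + 4 + l) (hg : g = 258 * β + 5) (hG : G = 260 * β + 5) :
    ∑ J ∈ range (2 ^ g), ∑ d ∈ range (2 ^ k),
      |∑ i ∈ range (2 ^ (2 * β)), t ((2 ^ k + d) * (2 ^ G * μ + i + 2 ^ (2 * β) * J))| ≤
      4 * (2 ^ g * 2 ^ k * 2 ^ β) := by
  apply le_of_sq_le_sq _ (by positivity)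
  apply (T_sq (2 * β) l μ k g G (by omega) (by omega) (by omega)).trans
  have : (4 * ((2:ℝ) ^ g * 2 ^ k * 2 ^ β)) ^ 2 = 16 * (2 ^ g * 2 ^ k) ^ 2 * 2 ^ (2 * β) := by
    rw [two_mul β, pow_add]; ring
  rw [this]; gcongr; norm_num

end TM

namespace TM

lemma blocks (b D Y Q : ℕ) (hY : Y ≤ 2 ^ b * Q) :
    |∑ m ∈ range Y, t (D * m)| ≤
      ∑ j ∈ range Q, |∑ i ∈ range (2 ^ b), t (D * (2 ^ b * j + i))| + 2 ^ b := by
  have e : Y = 2 ^ b * (Y / 2 ^ b) + Y % 2 ^ b := (Nat.div_add_mod _ _).symm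
  have hq : Y / 2 ^ b ≤ Q := by
    apply Nat.div_le_of_le_mul; exact hY
  rw [e, Finset.sum_range_add]
  apply (abs_add_le _ _).trans
  apply add_le_add
  · rw [sum_range_mul]
    apply (Finset.abs_sum_le_sum_abs _ _).trans
    apply Finset.sum_le_sum_of_subset_of_nonneg (Finset.range_mono hq)
    intros; positivity
  · apply (Finset.abs_sum_le_sum_abs _ _).trans
    simp only [abs_t, Finset.sum_const, Finset.card_range, nsmul_eq_mul, mul_one]
    exact_mod_cast (Nat.mod_lt Y (by positivity : 0 < 2 ^ b)).le

lemma large_k (β l X k : ℕ) (hk : k = 256 * β + 4 + l) :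
    ∑ d ∈ range (2 ^ k), |∑ m ∈ range (X / (2 ^ k + d) + 1), t ((2 ^ k + d) * m)| ≤
      4 * X / 2 ^ β + 9 * (2 ^ (260 * β + 5) * 2 ^ k) := by
  set G := 260 * β + 5 with hG
  set g := 258 * β + 5 with hg
  set Mu := X / 2 ^ k / 2 ^ G + 1 with hMu
  have h1 : ∀ d ∈ range (2 ^ k), |∑ m ∈ range (X / (2 ^ k + d) + 1), t ((2 ^ k + d) * m)| ≤
      ∑ μ ∈ range Mu, ∑ J ∈ range (2 ^ g), |∑ i ∈ range (2 ^ (2 * β)),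
        t ((2 ^ k + d) * (2 ^ G * μ + i + 2 ^ (2 * β) * J))| + 2 ^ (2 * β) := by
    intro d _
    have hY : X / (2 ^ k + d) + 1 ≤ 2 ^ (2 * β) * (2 ^ g * Mu) := by
      have a1 : X / (2 ^ k + d) ≤ X / 2 ^ k := Nat.div_le_div_left (by omega) (by positivity)
      have a2 : 2 ^ (2 * β) * (2 ^ g * Mu) = X / 2 ^ k / 2 ^ G * 2 ^ G + 2 ^ G := by
        rw [hMu, hG, hg]; ring
      rw [a2]
      have := Nat.lt_div_mul_add (a := X / 2 ^ k) (b := 2 ^ G) (by positivity)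
      omega
    apply (blocks (2 * β) (2 ^ k + d) _ _ hY).trans
    rw [sum_range_mul]
    apply le_of_eq
    congr 1
    apply Finset.sum_congr rfl; intro μ _
    apply Finset.sum_congr rfl; intro J _
    congr 1
    apply Finset.sum_congr rfl; intro i _
    congr 2
    rw [hG, hg]; ring
  apply (Finset.sum_le_sum h1).trans
  rw [Finset.sum_add_distrib, Finset.sum_comm]
  have h2 : ∀ μ ∈ range Mu, ∑ d ∈ range (2 ^ k), ∑ J ∈ range (2 ^ g), |∑ i ∈ range (2 ^ (2 * β)),
        t ((2 ^ k + d) * (2 ^ G * μ + i + 2 ^ (2 * β) * J))| ≤ 4 * (2 ^ g * 2 ^ k * 2 ^ β) := by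
    intro μ _
    rw [Finset.sum_comm]
    exact T_bound β l μ k g G hk hg hG
  have h3 := Finset.sum_le_sum h2
  rw [Finset.sum_const, Finset.card_range, nsmul_eq_mul] at h3
  have h4 : (Mu:ℝ) * (4 * (2 ^ g * 2 ^ k * 2 ^ β)) = 4 * (Mu * (2 ^ k * 2 ^ G)) / 2 ^ β := by
    rw [eq_div_iff (by positivity), hG, hg]; ring
  have h5 : (Mu:ℝ) * (2 ^ k * 2 ^ G) ≤ X + 2 ^ G * 2 ^ k := by
    have : Mu * (2 ^ k * 2 ^ G) ≤ X + 2 ^ G * 2 ^ k := by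
      rw [hMu, Nat.div_div_eq_div_mul, add_mul, one_mul, mul_comm (2 ^ G)]
      exact add_le_add (Nat.div_mul_le_self _ _) le_rfl
    exact_mod_cast this
  rw [h4] at h3
  have h6 : 4 * ((Mu:ℝ) * (2 ^ k * 2 ^ G)) / 2 ^ β ≤ 4 * (X + 2 ^ G * 2 ^ k) / 2 ^ β := by gcongr
  have h7 : 4 * ((X:ℝ) + 2 ^ G * 2 ^ k) / 2 ^ β ≤ 4 * X / 2 ^ β + 4 * (2 ^ G * 2 ^ k) := by
    rw [mul_add, add_div]
    gcongr
    apply div_le_self (by positivity) (one_le_pow₀ (by norm_num))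
  have h8 : ∑ d ∈ range (2 ^ k), (2:ℝ) ^ (2 * β) ≤ 2 ^ G * 2 ^ k := by
    rw [Finset.sum_const, Finset.card_range, nsmul_eq_mul, mul_comm]
    push_cast
    gcongr
    · norm_num
    · omega
  have : (0:ℝ) ≤ 2 ^ G * 2 ^ k := by positivity
  linarith

end TM

namespace TM

noncomputable def Sz (z : ℂ) (X : ℕ) : ℂ := ∑ n ∈ range X, (t n : ℂ) * z ^ n

lemma fac_bound (z : ℂ) (hz : ‖z‖ = 1) : ‖(1 - z) * (1 - z ^ 2)‖ ≤ 3.1 := by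
  have h1 : z.re ^ 2 + z.im ^ 2 = 1 := by
    have := Complex.sq_norm z
    rw [hz, Complex.normSq_apply] at this
    linarith
  have h2 : ‖1 - z‖ ^ 2 = 2 - 2 * z.re := by
    rw [Complex.sq_norm, Complex.normSq_apply]; simp; linarith
  have h3 : ‖1 + z‖ ^ 2 = 2 + 2 * z.re := by
    rw [Complex.sq_norm, Complex.normSq_apply]; simp; linarith
  have e : (1 - z) * (1 - z ^ 2) = (1 - z) * (1 - z) * (1 + z) := by ring
  rw [e, norm_mul, norm_mul]
  apply le_of_sq_le_sq _ (by norm_num)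
  have e2 : (‖1 - z‖ * ‖1 - z‖ * ‖1 + z‖) ^ 2 = (‖1 - z‖ ^ 2) * (‖1 - z‖ ^ 2) * ‖1 + z‖ ^ 2 := by
    ring
  rw [e2, h2, h3]
  have hc : z.re ≤ 1 := by nlinarith [sq_nonneg z.im]
  have := mul_nonneg (sq_nonneg (z.re + 1 / 3)) (show (0:ℝ) ≤ 5 / 3 - z.re by linarith)
  nlinarith

lemma t_four (m : ℕ) : t (4 * m) = t m ∧ t (4 * m + 1) = - t m ∧ t (4 * m + 2) = - t m ∧
    t (4 * m + 3) = t m := by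
  have e0 : 4 * m = 2 * (2 * m) := by ring
  have e2 : 4 * m + 2 = 2 * (2 * m + 1) := by ring
  have e3 : 4 * m + 3 = 2 * (2 * m + 1) + 1 := by ring
  refine ⟨?_, ?_, ?_, ?_⟩
  · rw [e0, t_two_mul, t_two_mul]
  · rw [e0, t_two_mul_add_one, t_two_mul]
  · rw [e2, t_two_mul, t_two_mul_add_one]
  · rw [e3, t_two_mul_add_one, t_two_mul_add_one]; ring

lemma Sz_four (z : ℂ) (Y : ℕ) : Sz z (4 * Y) = (1 - z) * (1 - z ^ 2) * Sz (z ^ 4) Y := by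
  unfold Sz
  induction Y with
  | zero => simp
  | succ Y ih =>
    rw [Nat.mul_succ, Finset.sum_range_add, ih, Finset.sum_range_succ _ Y, mul_add]
    congr 1
    obtain ⟨h0, h1, h2, h3⟩ := t_four Y
    simp only [Finset.sum_range_succ, Finset.sum_range_zero, add_zero, h0, h1, h2, h3]
    push_cast
    rw [← pow_mul]; ring

lemma Sz_bound (L X : ℕ) (z : ℂ) (hz : ‖z‖ = 1) (hX : X < 4 ^ L) :
    ‖Sz z X‖ ≤ 2 * 3.1 ^ L - 2 := by
  induction L generalizing X z with
  | zero =>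
    have : X = 0 := by simpa using hX
    subst this; simp [Sz]
  | succ L ih =>
    have hq : X / 4 < 4 ^ L := by
      rw [Nat.div_lt_iff_lt_mul (by norm_num)]; rwa [pow_succ] at hX
    have h1 := ih (X / 4) (z ^ 4) (by rw [norm_pow, hz, one_pow]) hq
    have e : Sz z X = Sz z (4 * (X / 4)) +
        ∑ i ∈ range (X % 4), (t (4 * (X / 4) + i) : ℂ) * z ^ (4 * (X / 4) + i) := by
      unfold Sz
      conv_lhs => rw [← Nat.div_add_mod X 4]
      rw [Finset.sum_range_add]
    rw [e, Sz_four]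
    have h2 : ‖∑ i ∈ range (X % 4), (t (4 * (X / 4) + i) : ℂ) * z ^ (4 * (X / 4) + i)‖ ≤ 3 := by
      apply (norm_sum_le _ _).trans
      have : ∀ i ∈ range (X % 4), ‖(t (4 * (X / 4) + i) : ℂ) * z ^ (4 * (X / 4) + i)‖ = 1 := by
        intro i _
        rw [norm_mul, norm_pow, hz, one_pow, mul_one, Complex.norm_real, Real.norm_eq_abs, abs_t]
      rw [Finset.sum_congr rfl this]
      simp only [Finset.sum_const, Finset.card_range, nsmul_eq_mul, mul_one]
      have : X % 4 ≤ 3 := by omega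
      exact_mod_cast this
    apply (norm_add_le _ _).trans
    rw [norm_mul]
    have h3 := fac_bound z hz
    have h4 : ‖(1 - z) * (1 - z ^ 2)‖ * ‖Sz (z ^ 4) (X / 4)‖ ≤ 3.1 * (2 * 3.1 ^ L - 2) := by
      gcongr
    rw [pow_succ (3.1:ℝ)]
    linarith

lemma small_d (L X d : ℕ) (hd : 0 < d) (hX : X < 4 ^ L) :
    |∑ n ∈ (range X).filter (fun n => d ∣ n), t n| ≤ 2 * 3.1 ^ L := by
  set ω : ℂ := Complex.exp (2 * π * Complex.I / d) with hω
  have hprim : IsPrimitiveRoot ω d := Complex.isPrimitiveRoot_exp d (by omega)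
  have hnorm : ‖ω‖ = 1 := hprim.norm'_eq_one (by omega)
  have hfil : ∀ n, ∑ h ∈ range d, (ω ^ h) ^ n = if d ∣ n then (d:ℂ) else 0 := by
    intro n
    have e : ∀ h ∈ range d, (ω ^ h) ^ n = (ω ^ n) ^ h := by
      intro h _; rw [← pow_mul, ← pow_mul, mul_comm]
    rw [Finset.sum_congr rfl e]
    split_ifs with hdn
    · rw [(hprim.pow_eq_one_iff_dvd n).2 hdn]; simp
    · have h1 : ω ^ n ≠ 1 := fun h => hdn ((hprim.pow_eq_one_iff_dvd n).1 h)
      rw [geom_sum_eq h1, ← pow_mul, mul_comm, pow_mul, hprim.pow_eq_one]; simp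
  have h1 : ((d:ℂ)) * ((∑ n ∈ (range X).filter (fun n => d ∣ n), t n : ℝ) : ℂ) =
      ∑ h ∈ range d, Sz (ω ^ h) X := by
    unfold Sz
    rw [Finset.sum_comm]
    simp_rw [← Finset.mul_sum, hfil]
    rw [Finset.sum_filter]
    push_cast
    rw [Finset.mul_sum]
    apply Finset.sum_congr rfl; intro n _
    split_ifs <;> simp [mul_comm]
  have h2 : ‖∑ h ∈ range d, Sz (ω ^ h) X‖ ≤ d * (2 * 3.1 ^ L) := by
    apply (norm_sum_le _ _).trans
    calc _ ≤ ∑ h ∈ range d, (2 * 3.1 ^ L : ℝ) := by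
          apply Finset.sum_le_sum; intro h _
          have := Sz_bound L X (ω ^ h) (by rw [norm_pow, hnorm, one_pow]) hX
          linarith
      _ = _ := by simp
  rw [← h1, norm_mul, Complex.norm_real, Real.norm_eq_abs, Complex.norm_natCast] at h2
  exact le_of_mul_le_mul_left h2 (by exact_mod_cast hd)

lemma small_d' (L X d : ℕ) (hd : 0 < d) (hX : X + 1 < 4 ^ L) :
    |∑ m ∈ range (X / d + 1), t (d * m)| ≤ 2 * 3.1 ^ L := by
  have h := small_d L (X + 1) d hd hX
  have e : ∑ n ∈ (range (X + 1)).filter (fun n => d ∣ n), t n = ∑ m ∈ range (X / d + 1), t (d * m) := by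
    symm
    apply Finset.sum_bij (fun m _ => d * m)
    · intro m hm
      rw [Finset.mem_range] at hm
      rw [Finset.mem_filter, Finset.mem_range]
      refine ⟨?_, dvd_mul_right _ _⟩
      have := Nat.mul_div_le X d
      have : d * m ≤ d * (X / d) := Nat.mul_le_mul_left _ (by omega)
      omega
    · intro a _ b _ hab
      exact Nat.eq_of_mul_eq_mul_left hd hab
    · intro n hn
      rw [Finset.mem_filter, Finset.mem_range] at hn
      obtain ⟨hn1, m, rfl⟩ := hn
      refine ⟨m, ?_, rfl⟩
      rw [Finset.mem_range, Nat.lt_succ_iff, Nat.le_div_iff_mul_le hd]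
      rw [mul_comm]; omega
    · intros; rfl
  rwa [e] at h

end TM

namespace TM

noncomputable def Sd (X d : ℕ) : ℝ := ∑ m ∈ range (X / d + 1), t (d * m)

lemma dyadic (K : ℕ) (f : ℕ → ℝ) :
    ∑ d ∈ Finset.Ico 1 (2 ^ K), f d = ∑ k ∈ range K, ∑ d ∈ range (2 ^ k), f (2 ^ k + d) := by
  induction K with
  | zero => simp
  | succ K ih =>
    rw [Finset.sum_range_succ, ← ih, ← Finset.sum_Ico_consecutive f (Nat.one_le_two_pow)
      (Nat.pow_le_pow_right (by norm_num) (Nat.le_succ K)), Finset.sum_Ico_eq_sum_range f (2 ^ K)]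
    congr 2
    rw [pow_succ]; congr 1; omega

lemma sum_two_pow (K : ℕ) : ∑ k ∈ range K, (2:ℝ) ^ k ≤ 2 ^ K := by
  rw [geom_sum_eq (by norm_num)]; norm_num

lemma total (β X K L : ℕ) (hX : X + 1 < 4 ^ L) :
    ∑ d ∈ Finset.Ico 1 (2 ^ K), |Sd X d| ≤ 2 ^ (256 * β + 4) * (2 * 3.1 ^ L) +
      K * (4 * X / 2 ^ β) + 9 * 2 ^ (260 * β + 5) * 2 ^ K := by
  rw [dyadic]
  have h1 : ∀ k ∈ range K, ∑ d ∈ range (2 ^ k), |Sd X (2 ^ k + d)| ≤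
      (if k < 256 * β + 4 then (2:ℝ) ^ k else 0) * (2 * 3.1 ^ L) + 4 * X / 2 ^ β +
        9 * 2 ^ (260 * β + 5) * 2 ^ k := by
    intro k _
    have p1 : (0:ℝ) ≤ 4 * X / 2 ^ β := by positivity
    have p2 : (0:ℝ) ≤ 9 * 2 ^ (260 * β + 5) * 2 ^ k := by positivity
    split_ifs with hk
    · have : ∑ d ∈ range (2 ^ k), |Sd X (2 ^ k + d)| ≤ ∑ d ∈ range (2 ^ k), (2 * 3.1 ^ L : ℝ) := by
        apply Finset.sum_le_sum; intro d _
        exact small_d' L X _ (by positivity) hX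
      rw [Finset.sum_const, Finset.card_range, nsmul_eq_mul] at this
      push_cast at this
      linarith
    · have := large_k β (k - (256 * β + 4)) X k (by omega)
      unfold Sd
      linarith
  apply (Finset.sum_le_sum h1).trans
  rw [Finset.sum_add_distrib, Finset.sum_add_distrib, ← Finset.sum_mul, ← Finset.mul_sum,
    Finset.sum_const, Finset.card_range, nsmul_eq_mul]
  have h2 : ∑ k ∈ range K, (if k < 256 * β + 4 then (2:ℝ) ^ k else 0) ≤ 2 ^ (256 * β + 4) := by
    refine le_trans ?_ (sum_two_pow (256 * β + 4))
    rw [← Finset.sum_filter]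
    apply Finset.sum_le_sum_of_subset_of_nonneg
    · intro k hk
      rw [Finset.mem_filter] at hk
      exact Finset.mem_range.2 hk.2
    · intros; positivity
  have h3 := sum_two_pow K
  gcongr

/-- main error estimate, at a scale -/
lemma scale_bound (c : ℝ) (hc0 : 0 < c) (hc1 : c < 1) :
    ∃ C : ℝ, 0 ≤ C ∧ ∃ R : ℕ, ∀ x : ℝ, 2 ≤ x → ∃ β : ℕ, x < 2 ^ (R * (β + 1)) ∧
      ∑ d ∈ Finset.Icc 1 ⌊x ^ c⌋₊, (2 + |Sd ⌊x⌋₊ d|) ≤ C * (β + 1) * x / 2 ^ β := by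
  obtain ⟨R0, hR0⟩ := exists_nat_ge (261 / (1 - c))
  set R' := max R0 257 with hR'
  have hR'1 : 257 ≤ R' := le_max_right _ _
  have hR'2 : 261 ≤ (6 * R' : ℕ) * (1 - c) := by
    have h1 : (261:ℝ) ≤ R0 * (1 - c) := by
      rwa [div_le_iff₀ (by linarith)] at hR0
    have h2 : (R0:ℝ) ≤ R' := by exact_mod_cast le_max_left _ _
    push_cast
    nlinarith
  refine ⟨2 ^ (7 + 5 * R') + 578 + 4 * (6 * R'), by positivity, 6 * R', ?_⟩
  intro x hx
  set X := ⌊x⌋₊ with hX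
  have hX2 : 2 ≤ X := Nat.le_floor (by exact_mod_cast hx)
  have hXx : (X:ℝ) ≤ x := Nat.floor_le (by linarith)
  have hxX : x < X + 1 := Nat.lt_floor_add_one x
  set P := 2 ^ (6 * R') with hP
  have hP1 : 1 < P := Nat.one_lt_two_pow (by omega)
  set β := Nat.log P X with hβ
  have hb1 : P ^ β ≤ X := Nat.pow_log_le_self P (by omega)
  have hb2 : X < P ^ (β + 1) := Nat.lt_pow_succ_log_self hP1 X
  rw [hP, ← pow_mul] at hb1 hb2
  have hxlt : x < 2 ^ (6 * R' * (β + 1)) := by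
    have : (X:ℝ) + 1 ≤ 2 ^ (6 * R' * (β + 1)) := by exact_mod_cast hb2
    linarith
  have hxge : (2:ℝ) ^ (6 * R' * β) ≤ x := by
    have : (2:ℝ) ^ (6 * R' * β) ≤ X := by exact_mod_cast hb1
    linarith
  refine ⟨β, hxlt, ?_⟩
  -- key: x^c * 2^(261 β) ≤ x
  have key : x ^ c * 2 ^ (261 * β) ≤ x := by
    have h1 : x = x ^ c * x ^ (1 - c) := by
      rw [← Real.rpow_add (by linarith)]; simp
    conv_rhs => rw [h1]
    apply mul_le_mul_of_nonneg_left _ (by positivity)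
    have h2 : ((2:ℝ) ^ (6 * R' * β)) ^ (1 - c) ≤ x ^ (1 - c) :=
      Real.rpow_le_rpow (by positivity) hxge (by linarith)
    refine le_trans ?_ h2
    rw [← Real.rpow_natCast, ← Real.rpow_natCast, ← Real.rpow_mul (by norm_num)]
    apply Real.rpow_le_rpow_of_exponent_le (by norm_num)
    push_cast at hR'2 ⊢
    have : (0:ℝ) ≤ β := by positivity
    nlinarith
  set Y := ⌊x ^ c⌋₊ with hY
  have hxc1 : 1 ≤ x ^ c := Real.one_le_rpow (by linarith) hc0.le
  have hY1 : 1 ≤ Y := Nat.le_floor (by exact_mod_cast hxc1)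
  have hYx : (Y:ℝ) ≤ x ^ c := Nat.floor_le (by linarith)
  have hxcx : x ^ c ≤ x := by
    conv_rhs => rw [← Real.rpow_one x]
    exact Real.rpow_le_rpow_of_exponent_le (by linarith) hc1.le
  have hYX : Y ≤ X := Nat.floor_le_floor hxcx
  set K := Nat.log 2 Y + 1 with hK
  have hK1 : Y < 2 ^ K := Nat.lt_pow_succ_log_self (by norm_num) Y
  have hK2 : (2:ℝ) ^ K ≤ 2 * x ^ c := by
    have : 2 ^ Nat.log 2 Y ≤ Y := Nat.pow_log_le_self 2 (by omega)
    have h2 : (2:ℝ) ^ Nat.log 2 Y ≤ Y := by exact_mod_cast this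
    rw [hK, pow_succ]; linarith
  have hK3 : K ≤ 6 * R' * (β + 1) := by
    have : Nat.log 2 Y < 6 * R' * (β + 1) :=
      Nat.log_lt_of_lt_pow (by omega) (lt_of_le_of_lt hYX hb2)
    omega
  set L := 3 * R' * (β + 1) + 1 with hL
  have hXL : X + 1 < 4 ^ L := by
    have e : 4 ^ L = 4 * 2 ^ (6 * R' * (β + 1)) := by
      rw [hL, show (4:ℕ) = 2 ^ 2 by norm_num, ← pow_mul, ← pow_add]; congr 1; ring
    rw [e]; omega
  have htot := total β X K L hXL
  have hx0 : 0 < x := by linarith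
  have hB : (0:ℝ) < 2 ^ β := by positivity
  -- small
  have hs : (2:ℝ) ^ (256 * β + 4) * (2 * 3.1 ^ L) ≤ 2 ^ (7 + 5 * R') * (x / 2 ^ β) := by
    have h1 : (3.1:ℝ) ^ L ≤ 4 * 2 ^ (5 * (R' * (β + 1))) := by
      have h31 : (3.1:ℝ) ^ (3 * (R' * (β + 1))) ≤ 2 ^ (5 * (R' * (β + 1))) := by
        rw [pow_mul, pow_mul (2:ℝ)]
        exact pow_le_pow_left₀ (by norm_num) (by norm_num) _
      rw [hL, pow_succ, show 3 * R' * (β + 1) = 3 * (R' * (β + 1)) by ring]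
      have p : (0:ℝ) < 2 ^ (5 * (R' * (β + 1))) := by positivity
      linarith
    have h2 : (2:ℝ) ^ ((5 * R' + 257) * β) ≤ x := by
      refine le_trans ?_ hxge
      apply pow_le_pow_right₀ (by norm_num)
      apply Nat.mul_le_mul_right; omega
    calc (2:ℝ) ^ (256 * β + 4) * (2 * 3.1 ^ L) ≤ 2 ^ (256 * β + 4) * (2 * (4 * 2 ^ (5 * (R' * (β + 1))))) := by
          gcongr
      _ = 2 ^ (7 + 5 * R') * (2 ^ ((5 * R' + 257) * β) / 2 ^ β) := by
          rw [mul_div_assoc', eq_div_iff hB.ne']; ring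
      _ ≤ _ := by gcongr
  have h3 : x ^ c * 2 ^ (260 * β) ≤ x / 2 ^ β := by
    rw [le_div_iff₀ hB]
    refine le_trans (le_of_eq ?_) key
    ring
  have hl : 9 * (2:ℝ) ^ (260 * β + 5) * 2 ^ K ≤ 576 * (x / 2 ^ β) := by
    calc 9 * (2:ℝ) ^ (260 * β + 5) * 2 ^ K ≤ 9 * (2:ℝ) ^ (260 * β + 5) * (2 * x ^ c) := by gcongr
      _ = 576 * (x ^ c * 2 ^ (260 * β)) := by ring
      _ ≤ _ := by gcongr
  have hm : (K:ℝ) * (4 * X / 2 ^ β) ≤ 4 * (6 * R') * (β + 1) * (x / 2 ^ β) := by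
    have : (K:ℝ) ≤ 6 * R' * (β + 1) := by exact_mod_cast hK3
    calc (K:ℝ) * (4 * X / 2 ^ β) ≤ (6 * R' * (β + 1)) * (4 * x / 2 ^ β) := by gcongr
      _ = _ := by ring
  have hy : 2 * (Y:ℝ) ≤ 2 * (x / 2 ^ β) := by
    have : x ^ c ≤ x ^ c * 2 ^ (260 * β) := le_mul_of_one_le_right (by linarith) (one_le_pow₀ (by norm_num))
    linarith
  have hsum : ∑ d ∈ Finset.Icc 1 Y, |Sd X d| ≤ ∑ d ∈ Finset.Ico 1 (2 ^ K), |Sd X d| := by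
    apply Finset.sum_le_sum_of_subset_of_nonneg
    · intro d hd
      rw [Finset.mem_Icc] at hd
      rw [Finset.mem_Ico]; omega
    · intros; positivity
  rw [Finset.sum_add_distrib, Finset.sum_const, Nat.card_Icc, nsmul_eq_mul, Nat.add_sub_cancel]
  have hq : 0 ≤ x / 2 ^ β := by positivity
  have e : (2 ^ (7 + 5 * R') + 578 + 4 * (6 * (R':ℝ))) * (β + 1) * x / 2 ^ β =
    2 ^ (7 + 5 * R') * (x / 2 ^ β) + 578 * (x / 2 ^ β) + 4 * (6 * R') * (β + 1) * (x / 2 ^ β) +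
     (2 ^ (7 + 5 * R') + 578) * β * (x / 2 ^ β) := by ring
  rw [e]
  have : 0 ≤ ((2:ℝ) ^ (7 + 5 * R') + 578) * β * (x / 2 ^ β) := by positivity
  linarith

end TM

namespace TM

lemma tele (n : ℕ) : ∑ m ∈ Finset.range n, Real.log ((m:ℝ) + 2) / (((m:ℝ) + 2) * (m + 1)) ≤
    2 - (Real.log ((n:ℝ) + 1) + 2) / (n + 1) := by
  induction n with
  | zero => simp
  | succ k ih =>
    rw [Finset.sum_range_succ]
    push_cast
    have e : (k:ℝ) + 1 + 1 = k + 2 := by ring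
    rw [e]
    have hk : (0:ℝ) ≤ k := by positivity
    have h1 : Real.log ((k:ℝ) + 2) - Real.log (k + 1) ≤ 1 / (k + 1) := by
      rw [← Real.log_div (by positivity) (by positivity)]
      refine (Real.log_le_sub_one_of_pos (by positivity)).trans (le_of_eq ?_)
      field_simp; ring
    have h2 : ((k:ℝ) + 2) * (Real.log ((k:ℝ) + 2) - Real.log (k + 1)) ≤ 2 := by
      have : ((k:ℝ) + 2) * (1 / (k + 1)) ≤ 2 := by
        rw [mul_one_div, div_le_iff₀ (by positivity)]; linarith
      exact le_trans (mul_le_mul_of_nonneg_left h1 (by positivity)) this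
    have h3 : Real.log ((k:ℝ) + 2) / (((k:ℝ) + 2) * (k + 1)) ≤
        (Real.log ((k:ℝ) + 1) + 2) / (k + 1) - (Real.log ((k:ℝ) + 2) + 2) / (k + 2) := by
      rw [div_sub_div _ _ (by positivity) (by positivity), mul_comm ((k:ℝ) + 2) (k + 1)]
      apply div_le_div_of_nonneg_right _ (by positivity)
      nlinarith
    linarith

lemma log_fact (n : ℕ) : Real.log (n.factorial : ℝ) =
    ∑ p ∈ (Finset.Icc 1 n).filter Nat.Prime, (n.factorial.factorization p : ℝ) * Real.log p := by
  rw [Real.log_nat_eq_sum_factorization, Finsupp.sum]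
  apply Finset.sum_subset
  · intro p hp
    rw [Nat.support_factorization, Nat.mem_primeFactors] at hp
    rw [Finset.mem_filter, Finset.mem_Icc]
    exact ⟨⟨hp.1.one_le, (hp.1.dvd_factorial).1 hp.2.1⟩, hp.1⟩
  · intro p _ hp
    rw [Finsupp.notMem_support_iff] at hp
    simp [hp]

lemma mertens_nat (n : ℕ) (hn : 1 ≤ n) :
    |(∑ p ∈ (Finset.Icc 1 n).filter Nat.Prime, 1 / (p:ℝ) * Real.log p) - Real.log n| ≤ 3 := by
  have hn0 : (0:ℝ) < n := by exact_mod_cast hn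
  have hf : (0:ℝ) < n.factorial := by exact_mod_cast n.factorial_pos
  have up : Real.log (n.factorial : ℝ) ≤ n * Real.log n := by
    rw [← Real.log_pow]
    apply Real.log_le_log hf
    exact_mod_cast Nat.factorial_le_pow n
  have lo : n * Real.log n - n ≤ Real.log (n.factorial : ℝ) := by
    have h := Real.pow_div_factorial_le_exp _ hn0.le n
    have := Real.log_le_log (by positivity) h
    rw [Real.log_exp, Real.log_div (by positivity) (by positivity), Real.log_pow] at this
    linarith
  rw [log_fact] at up lo
  have hth : ∑ p ∈ (Finset.Icc 1 n).filter Nat.Prime, Real.log p ≤ Real.log 4 * n := by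
    have := Chebyshev.theta_le_log4_mul_x hn0.le
    rw [Chebyshev.theta, Nat.floor_natCast] at this
    exact this
  have h4 : Real.log 4 ≤ 3 := by
    have := Real.log_le_sub_one_of_pos (show (0:ℝ) < 4 by norm_num)
    linarith
  have hlp : ∀ p ∈ (Finset.Icc 1 n).filter Nat.Prime, 0 ≤ Real.log (p:ℝ) := fun p _ => Real.log_natCast_nonneg p
  have A : n * (∑ p ∈ (Finset.Icc 1 n).filter Nat.Prime, 1 / (p:ℝ) * Real.log p) -
      ∑ p ∈ (Finset.Icc 1 n).filter Nat.Prime, Real.log p ≤ n * Real.log n := by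
    refine le_trans ?_ up
    rw [Finset.mul_sum, ← Finset.sum_sub_distrib]
    apply Finset.sum_le_sum
    intro p hp
    have hl := hlp p hp
    rw [Finset.mem_filter, Finset.mem_Icc] at hp
    have h1 : n / p ≤ n.factorial.factorization p := by
      rw [Nat.factorization_factorial hp.2 (lt_add_one _)]
      have : 1 ∈ Finset.Ico 1 (Nat.log p n + 1) := by
        rw [Finset.mem_Ico]
        have := Nat.log_pos hp.2.one_lt hp.1.2
        omega
      have := Finset.single_le_sum (f := fun i => n / p ^ i) (fun _ _ => Nat.zero_le _) this
      simpa using this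
    have h2 : (n:ℝ) / p - 1 ≤ n.factorial.factorization p := by
      have a : (n:ℝ) / p < (n / p : ℕ) + 1 := by
        rw [← Nat.floor_div_eq_div (K := ℝ)]; exact Nat.lt_floor_add_one _
      have b : ((n / p : ℕ):ℝ) ≤ n.factorial.factorization p := by exact_mod_cast h1
      linarith
    calc (n:ℝ) * (1 / p * Real.log p) - Real.log p = (n / p - 1) * Real.log p := by ring
      _ ≤ _ := by gcongr
  have T : ∑ p ∈ (Finset.Icc 1 n).filter Nat.Prime, (1 / ((p:ℝ) - 1) - 1 / p) * Real.log p ≤ 2 := by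
    have h1 := tele n
    have h2 : 0 ≤ (Real.log ((n:ℝ) + 1) + 2) / (n + 1) := by
      have := Real.log_nonneg (show (1:ℝ) ≤ n + 1 by linarith)
      positivity
    refine le_trans ?_ (h1.trans (by linarith))
    have e : ∀ p ∈ (Finset.Icc 1 n).filter Nat.Prime, (1 / ((p:ℝ) - 1) - 1 / p) * Real.log p =
       (fun m : ℕ => Real.log ((m:ℝ) + 2) / (((m:ℝ) + 2) * (m + 1))) (p - 2) := by
      intro p hp
      rw [Finset.mem_filter, Finset.mem_Icc] at hp
      obtain ⟨m, rfl⟩ := Nat.exists_eq_add_of_le hp.2.two_le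
      have : 2 + m - 2 = m := by omega
      simp only [this]
      push_cast
      have hm : (0:ℝ) ≤ m := by positivity
      have h1 : (2 + (m:ℝ) - 1) = m + 1 := by ring
      rw [h1, add_comm (2:ℝ)]
      field_simp
      ring
    rw [Finset.sum_congr rfl e, ← Finset.sum_image (f := fun m : ℕ => Real.log ((m:ℝ) + 2) / (((m:ℝ) + 2) * (m + 1))) (g := fun p => p - 2)]
    · apply Finset.sum_le_sum_of_subset_of_nonneg
      · intro m hm
        rw [Finset.mem_image] at hm
        obtain ⟨p, hp, rfl⟩ := hm
        rw [Finset.mem_filter, Finset.mem_Icc] at hp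
        rw [Finset.mem_range]
        have := hp.2.two_le
        omega
      · intro m _ _
        have := Real.log_nonneg (show (1:ℝ) ≤ m + 2 by linarith [(by positivity : (0:ℝ) ≤ m)])
        positivity
    · intro p hp q hq h
      simp only [Finset.coe_filter, Finset.mem_Icc, Set.mem_ofPred_eq] at hp hq
      have := hp.2.two_le
      have := hq.2.two_le
      simp only at h
      omega
  have B : n * Real.log n - n ≤ n * (∑ p ∈ (Finset.Icc 1 n).filter Nat.Prime, 1 / (p:ℝ) * Real.log p) +
      n * ∑ p ∈ (Finset.Icc 1 n).filter Nat.Prime, (1 / ((p:ℝ) - 1) - 1 / p) * Real.log p := by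
    refine lo.trans ?_
    rw [Finset.mul_sum, Finset.mul_sum, ← Finset.sum_add_distrib]
    apply Finset.sum_le_sum
    intro p hp
    have hl := hlp p hp
    rw [Finset.mem_filter, Finset.mem_Icc] at hp
    have h1 : (p - 1) * n.factorial.factorization p ≤ n := by
      rw [Nat.sub_one_mul_factorization_factorial hp.2]; omega
    have hp2 : (2:ℝ) ≤ p := by exact_mod_cast hp.2.two_le
    have h2 : (n.factorial.factorization p : ℝ) ≤ n / (p - 1) := by
      rw [le_div_iff₀ (by linarith), mul_comm]
      have : (((p - 1 : ℕ) * n.factorial.factorization p : ℕ) : ℝ) ≤ n := by exact_mod_cast h1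
      rwa [Nat.cast_mul, Nat.cast_sub hp.2.one_le, Nat.cast_one] at this
    calc _ ≤ (n:ℝ) / (p - 1) * Real.log p := by gcongr
      _ = _ := by ring
  rw [abs_le]
  set S := ∑ p ∈ (Finset.Icc 1 n).filter Nat.Prime, 1 / (p:ℝ) * Real.log p
  set U := ∑ p ∈ (Finset.Icc 1 n).filter Nat.Prime, (1 / ((p:ℝ) - 1) - 1 / p) * Real.log p
  constructor
  · have : n * (Real.log n - 3) ≤ n * S := by nlinarith
    have := le_of_mul_le_mul_left this hn0
    linarith
  · have : n * S ≤ n * (Real.log n + 3) := by nlinarith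
    have := le_of_mul_le_mul_left this hn0
    linarith

lemma mertens (x : ℝ) (hx : 2 ≤ x) :
    |(∑ p ∈ (Finset.Icc 1 ⌊x⌋₊).filter Nat.Prime, 1 / (p:ℝ) * Real.log p) - Real.log x| ≤ 4 := by
  have h1 : 1 ≤ ⌊x⌋₊ := Nat.le_floor (by push_cast; linarith)
  have h := mertens_nat _ h1
  have h1r : (1:ℝ) ≤ ⌊x⌋₊ := by exact_mod_cast h1
  have h2 : (⌊x⌋₊:ℝ) ≤ x := Nat.floor_le (by linarith)
  have h3 : x < ⌊x⌋₊ + 1 := Nat.lt_floor_add_one x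
  have h4 : Real.log ⌊x⌋₊ ≤ Real.log x := Real.log_le_log (by linarith) h2
  have h5 : Real.log x - Real.log ⌊x⌋₊ ≤ 1 := by
    rw [← Real.log_div (by positivity) (by positivity)]
    refine (Real.log_le_sub_one_of_pos (by positivity)).trans ?_
    have : x / ⌊x⌋₊ ≤ 2 := by rw [div_le_iff₀ (by linarith)]; linarith
    linarith
  rw [abs_le] at h ⊢
  constructor <;> linarith [h.1, h.2]

end TM

namespace TM

noncomputable def tseq (n : ℕ) : ℝ := if 1 ≤ n ∧ Even ((Nat.digits 2 n).sum) then 1 else 0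

lemma tseq_eq (n : ℕ) (hn : 1 ≤ n) : tseq n = (1 + t n) / 2 := by
  unfold tseq t
  rcases Nat.even_or_odd ((Nat.digits 2 n).sum) with h | h
  · simp [h, hn, h.neg_one_pow]
  · have h1 := Nat.not_even_iff_odd.2 h
    simp [h1, h.neg_one_pow]

lemma tseq_nonneg (n : ℕ) : 0 ≤ tseq n := by
  unfold tseq; split_ifs <;> norm_num

lemma tseq_le (n : ℕ) : tseq n ≤ 1 := by
  unfold tseq; split_ifs <;> norm_num

lemma Nd_eq (d : ℕ) (hd : 1 ≤ d) (x : ℝ) :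
    Nd tseq d x = (((⌊x⌋₊ / d : ℕ) : ℝ) + Sd ⌊x⌋₊ d - 1) / 2 := by
  unfold Nd Sd
  have h : (Finset.Icc 1 ⌊x⌋₊).filter (fun n => d ∣ n) =
      (range (⌊x⌋₊ / d)).image (fun m => d * (m + 1)) := by
    ext n
    simp only [Finset.mem_filter, Finset.mem_Icc, Finset.mem_image, Finset.mem_range]
    constructor
    · rintro ⟨⟨h1, h2⟩, k, rfl⟩
      have hk : 1 ≤ k := by
        rcases Nat.eq_zero_or_pos k with rfl | hk
        · simp at h1
        · exact hk
      have : k ≤ ⌊x⌋₊ / d := by rw [Nat.le_div_iff_mul_le (by omega), mul_comm]; exact h2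
      exact ⟨k - 1, by omega, by rw [Nat.sub_add_cancel hk]⟩
    · rintro ⟨m, hm, rfl⟩
      have h2 : m + 1 ≤ ⌊x⌋₊ / d := hm
      rw [Nat.le_div_iff_mul_le (by omega), mul_comm] at h2
      exact ⟨⟨Nat.mul_pos (by omega) (by omega), h2⟩, dvd_mul_right _ _⟩
  rw [h, Finset.sum_image, Finset.sum_range_succ', mul_zero, t_zero]
  · rw [Finset.sum_congr rfl (fun m _ => tseq_eq (d * (m + 1)) (Nat.mul_pos (by omega) (by omega))),
      ← Finset.sum_div, Finset.sum_add_distrib]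
    simp
    ring
  · intro a _ b _ hab
    have := Nat.eq_of_mul_eq_mul_left (by omega) hab
    omega

lemma N_eq_Nd (x : ℝ) : N tseq x = Nd tseq 1 x := by
  unfold N Nd; simp

lemma S_even (k : ℕ) : ∑ m ∈ range (2 * k), t m = 0 := by
  induction k with
  | zero => simp
  | succ k ih =>
    rw [show 2 * (k + 1) = 2 * k + 1 + 1 by ring, Finset.sum_range_succ, Finset.sum_range_succ, ih,
      t_two_mul_add_one, t_two_mul]; ring

lemma abs_Sd_one (X : ℕ) : |Sd X 1| ≤ 1 := by
  unfold Sd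
  simp only [one_mul, Nat.div_one]
  rcases Nat.even_or_odd' (X + 1) with ⟨k, h | h⟩
  · rw [h, S_even]; simp
  · rw [h, Finset.sum_range_succ, S_even, zero_add, abs_t]

lemma N_eq (x : ℝ) : N tseq x = ((⌊x⌋₊ : ℝ) + Sd ⌊x⌋₊ 1 - 1) / 2 := by
  rw [N_eq_Nd, Nd_eq 1 le_rfl, Nat.div_one]

lemma N_nonneg (x : ℝ) : 0 ≤ N tseq x := Finset.sum_nonneg fun n _ => tseq_nonneg n

lemma Nd_nonneg (d : ℕ) (x : ℝ) : 0 ≤ Nd tseq d x := Finset.sum_nonneg fun n _ => tseq_nonneg n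

lemma Nd_le_N (d : ℕ) (x : ℝ) : Nd tseq d x ≤ N tseq x :=
  Finset.sum_le_sum_of_subset_of_nonneg (Finset.filter_subset _ _) fun n _ _ => tseq_nonneg n

lemma N_le (x : ℝ) (hx : 0 ≤ x) : N tseq x ≤ x := by
  refine le_trans ?_ (Nat.floor_le hx)
  calc N tseq x ≤ ∑ n ∈ Finset.Icc 1 ⌊x⌋₊, (1:ℝ) := Finset.sum_le_sum fun n _ => tseq_le n
    _ = _ := by simp

lemma N_ge (x : ℝ) (hx : 3 ≤ x) : x / 8 ≤ N tseq x := by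
  rw [N_eq]
  have h := abs_le.1 (abs_Sd_one ⌊x⌋₊)
  have h3 : 3 ≤ ⌊x⌋₊ := Nat.le_floor (by exact_mod_cast hx)
  have h3r : (3:ℝ) ≤ ⌊x⌋₊ := by exact_mod_cast h3
  have := Nat.lt_floor_add_one x
  linarith [h.1]

lemma N_small (x : ℝ) (hx : 2 ≤ x) (hx3 : x < 3) : N tseq x = 0 := by
  have h : ⌊x⌋₊ = 2 := by
    rw [Nat.floor_eq_iff (by linarith)]; push_cast; constructor <;> linarith
  rw [N_eq, h]
  have : Sd 2 1 = -1 := by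
    unfold Sd
    have h1 := t_two_mul_add_one 0
    have h2 := t_two_mul 1
    rw [t_zero] at h1
    simp [Finset.sum_range_succ] at h1 h2 ⊢
    rw [h2, h1, t_zero]; norm_num
  rw [this]; norm_num

lemma Nd_small (d : ℕ) (x : ℝ) (hx : 2 ≤ x) (hx3 : x < 3) : Nd tseq d x = 0 :=
  le_antisymm ((Nd_le_N d x).trans (N_small x hx hx3).le) (Nd_nonneg d x)

lemma Nd_le (d : ℕ) (hd : 1 ≤ d) (x : ℝ) (hx : 0 ≤ x) : Nd tseq d x ≤ x / d := by
  have hd0 : (0:ℝ) < d := by exact_mod_cast hd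
  rw [Nd_eq d hd]
  have h1 : ((⌊x⌋₊ / d : ℕ) : ℝ) ≤ x / d := by
    refine Nat.cast_div_le.trans ?_
    gcongr
    exact Nat.floor_le hx
  have h2 : Sd ⌊x⌋₊ d ≤ (⌊x⌋₊ / d : ℕ) + 1 := by
    unfold Sd
    calc _ ≤ ∑ m ∈ range (⌊x⌋₊ / d + 1), (1:ℝ) :=
          Finset.sum_le_sum fun m _ => (le_abs_self _).trans (abs_t _).le
      _ = _ := by simp
  linarith

lemma discN (d : ℕ) (hd : 1 ≤ d) (x : ℝ) :
    |Nd tseq d x - 1 / (d:ℝ) * N tseq x| ≤ 2 + |Sd ⌊x⌋₊ d| := by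
  rw [Nd_eq d hd, N_eq]
  set X := ⌊x⌋₊
  have hd1 : (1:ℝ) ≤ d := by exact_mod_cast hd
  have h1 : ((X / d : ℕ) : ℝ) ≤ (X:ℝ) / d := Nat.cast_div_le
  have h2 : (X:ℝ) / d < (X / d : ℕ) + 1 := by
    rw [← Nat.floor_div_eq_div (K := ℝ)]; exact Nat.lt_floor_add_one _
  have h3 := abs_le.1 (abs_Sd_one X)
  have h4 : |(Sd X 1 - 1) / d| ≤ 2 := by
    rw [abs_div, abs_of_pos (by linarith : (0:ℝ) < d), div_le_iff₀ (by linarith)]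
    have : |Sd X 1 - 1| ≤ 2 := abs_le.2 ⟨by linarith [h3.1], by linarith [h3.2]⟩
    linarith
  have h4' := abs_le.1 h4
  have h5 := neg_abs_le (Sd X d)
  have h6 := le_abs_self (Sd X d)
  have e : 1 / (d:ℝ) * (((X:ℝ) + Sd X 1 - 1) / 2) = (X / d + (Sd X 1 - 1) / d) / 2 := by ring
  have h7 := abs_nonneg (Sd X d)
  rw [e, abs_le]
  constructor <;> linarith [h4'.1, h4'.2]

lemma poly_bdd (n : ℕ) : ∃ B : ℝ, 0 ≤ B ∧ ∀ β : ℕ, ((β:ℝ) + 1) ^ n / 2 ^ β ≤ B := by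
  have h := tendsto_pow_const_div_const_pow_of_one_lt n (show (1:ℝ) < 2 by norm_num)
  obtain ⟨B, hB⟩ := h.bddAbove_range
  refine ⟨2 * max B 0, by positivity, fun β => ?_⟩
  have := hB ⟨β + 1, rfl⟩
  simp only at this
  push_cast at this
  have e : ((β:ℝ) + 1) ^ n / 2 ^ β = 2 * (((β:ℝ) + 1) ^ n / 2 ^ (β + 1)) := by
    rw [pow_succ]; field_simp
  rw [e]
  have := le_max_left B 0
  linarith

lemma level (c : ℝ) (hc0 : 0 < c) (hc1 : c < 1) (A : ℝ) (hA : 0 < A) : ∃ K : ℝ, ∀ x : ℝ, 2 ≤ x →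
    ∑ d ∈ Finset.Icc 1 ⌊x ^ c⌋₊, |Nd tseq d x - 1 / (d:ℝ) * N tseq x| ≤
      K * N tseq x / Real.log x ^ A := by
  obtain ⟨C, hC, R, h⟩ := scale_bound c hc0 hc1
  obtain ⟨n, hn⟩ := exists_nat_ge A
  obtain ⟨B, hB0, hB⟩ := poly_bdd (n + 1)
  refine ⟨8 * C * ((R + 1) ^ A * B), fun x hx => ?_⟩
  rcases lt_or_ge x 3 with hx3 | hx3
  · rw [N_small x hx hx3]
    simp [Nd_small _ x hx hx3]
  obtain ⟨β, hβ, hs⟩ := h x hx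
  have hlog : 0 < Real.log x := Real.log_pos (by linarith)
  have hlogu : Real.log x ≤ (R + 1) * (β + 1) := by
    have h1 := Real.log_le_log (by linarith) hβ.le
    rw [Real.log_pow] at h1
    push_cast at h1
    have h2 : Real.log 2 ≤ 1 := by
      have := Real.log_le_sub_one_of_pos (show (0:ℝ) < 2 by norm_num)
      linarith
    have h3 : (R:ℝ) * (β + 1) * Real.log 2 ≤ R * (β + 1) * 1 := by gcongr
    have h4 : (0:ℝ) ≤ β := by positivity
    linarith
  have hpow : Real.log x ^ A * ((β + 1) / 2 ^ β) ≤ (R + 1) ^ A * B := by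
    calc Real.log x ^ A * ((β + 1) / 2 ^ β) ≤ ((R + 1) * (β + 1)) ^ A * ((β + 1) / 2 ^ β) := by
          gcongr
      _ = (R + 1) ^ A * ((β + 1) ^ A * ((β + 1) / 2 ^ β)) := by
          rw [Real.mul_rpow (by positivity) (by positivity)]; ring
      _ ≤ (R + 1) ^ A * (((β:ℝ) + 1) ^ n * ((β + 1) / 2 ^ β)) := by
          gcongr
          rw [← Real.rpow_natCast]
          apply Real.rpow_le_rpow_of_exponent_le _ hn
          have h4 : (0:ℝ) ≤ β := by positivity
          linarith
      _ = (R + 1) ^ A * (((β:ℝ) + 1) ^ (n + 1) / 2 ^ β) := by ring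
      _ ≤ _ := by gcongr; exact hB β
  have hN := N_ge x hx3
  have hN0 := N_nonneg x
  calc ∑ d ∈ Finset.Icc 1 ⌊x ^ c⌋₊, |Nd tseq d x - 1 / (d:ℝ) * N tseq x|
      ≤ ∑ d ∈ Finset.Icc 1 ⌊x ^ c⌋₊, (2 + |Sd ⌊x⌋₊ d|) :=
        Finset.sum_le_sum fun d hd => discN d (Finset.mem_Icc.1 hd).1 x
    _ ≤ C * (β + 1) * x / 2 ^ β := hs
    _ ≤ C * (β + 1) * (8 * N tseq x) / 2 ^ β := by
        gcongr; linarith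
    _ = 8 * C * ((β + 1) / 2 ^ β) * N tseq x := by ring
    _ ≤ _ := by
        rw [le_div_iff₀ (by positivity)]
        calc 8 * C * (((β:ℝ) + 1) / 2 ^ β) * N tseq x * Real.log x ^ A
            = 8 * C * (Real.log x ^ A * ((β + 1) / 2 ^ β)) * N tseq x := by ring
          _ ≤ _ := by gcongr

lemma regular : Regular tseq := by
  intro c hc0 hc1
  have h1 : (fun x : ℝ => N tseq (x ^ c)) =O[atTop] fun x : ℝ => x ^ c := by
    apply Asymptotics.IsBigO.of_bound 1
    filter_upwards [eventually_ge_atTop 0] with x hx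
    have := Real.rpow_nonneg hx c
    rw [Real.norm_of_nonneg (N_nonneg _), Real.norm_of_nonneg this, one_mul]
    exact N_le _ this
  have h2 : (fun x : ℝ => x ^ (1:ℝ)) =O[atTop] fun x : ℝ => N tseq x := by
    apply Asymptotics.IsBigO.of_bound 8
    filter_upwards [eventually_ge_atTop 3] with x hx
    rw [Real.norm_of_nonneg (N_nonneg _), Real.rpow_one, Real.norm_of_nonneg (by linarith)]
    linarith [N_ge x hx]
  have h3 : (fun x : ℝ => x ^ c) =o[atTop] fun x : ℝ => x ^ (1:ℝ) := by
    apply Asymptotics.isLittleO_of_tendsto'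
    · filter_upwards [eventually_gt_atTop 0] with x hx h
      exact absurd h (Real.rpow_pos_of_pos hx 1).ne'
    · refine (tendsto_rpow_neg_atTop (sub_pos.2 hc1)).congr' ?_
      filter_upwards [eventually_gt_atTop 0] with x hx
      rw [← Real.rpow_sub hx, neg_sub]
  exact (h1.trans_isLittleO h3).trans_isBigO h2

lemma main : Regular tseq ∧ HasLevel tseq 1 (fun d => 1 / (d : ℝ)) ∧ LocallyUniform tseq := by
  refine ⟨regular, ⟨⟨by simp, fun m n _ => ?_⟩, fun d hd => ⟨by positivity, ?_⟩, ⟨4, mertens⟩,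
    ⟨1, le_rfl, 1, fun d _ => by simp⟩, level⟩, ?_⟩
  · simp; ring
  · have : (1:ℝ) ≤ d := by exact_mod_cast hd
    exact (div_le_one (by linarith)).2 this
  · refine ⟨1, one_pos, 0, le_rfl, 1, le_rfl, 8, fun x hx d hd _ => ?_⟩
    rw [Real.rpow_zero, one_pow, mul_one, mul_one]
    rcases lt_or_ge x 3 with hx3 | hx3
    · rw [N_small x hx hx3, Nd_small d x hx hx3]; simp
    · refine (Nd_le d hd x (by linarith)).trans ?_
      gcongr
      linarith [N_ge x hx3]

end TM

/-- the positive integers whose binary digit sum is even (the `0`s of the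
Thue–Morse sequence) are regular, have level of distribution `1` with density
`g(d) = 1/d`, and are locally uniform. -/
theorem thueMorse_regular_level_locallyUniform :
    let seq : ℕ → ℝ :=
      fun n => if 1 ≤ n ∧ Even ((Nat.digits 2 n).sum) then 1 else 0
    Regular seq ∧
    HasLevel seq 1 (fun d => 1 / (d : ℝ)) ∧
    LocallyUniform seq := by
  exact TM.main
end

section
/- Let h : ℕ → ℝ be a multiplicative function such that the function g(d) := h(d)/d satisfies g(d) ∈ [0,1] for all d ≥ 1, and such that g(d) ≤ K·C^{Ω(d)}/d for all d ≥ 1, for some constants K, C ≥ 1. Then there exists a constant A > 0 such that ∑_{n ≤ x} g(n) ≪ (log x)^A for all x ≥ 2. -/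
open Finset Filter Real

open scoped Classical

open Finset Filter Real

open scoped Classical

lemma block_bound (L : ℕ) :
    ∑ p ∈ (Finset.Ico (2^(L+1)) (2^(L+2))).filter Nat.Prime, (1:ℝ)/p ≤ 4 / ((L:ℝ)+1) := by
  set S := (Finset.Ico (2^(L+1)) (2^(L+2))).filter Nat.Prime with hS
  have h1 : (2^(L+1))^S.card ≤ 4^(2^(L+2)) := by
    calc (2^(L+1))^S.card ≤ ∏ p ∈ S, p := by
          apply Finset.pow_card_le_prod
          intro p hp
          simp [hS] at hp
          exact hp.1.1
      _ ≤ primorial (2^(L+2)) := by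
          unfold primorial
          apply Finset.prod_le_prod_of_subset_of_one_le'
          · intro p hp
            simp [hS] at hp ⊢
            exact ⟨by omega, hp.2⟩
          · intro p hp _
            simp at hp
            exact hp.2.one_lt.le
      _ ≤ _ := primorial_le_four_pow _
  have h2 : (L+1) * S.card ≤ 2 * 2^(L+2) := by
    rw [show (4:ℕ) = 2^2 by norm_num, ← pow_mul, ← pow_mul] at h1
    exact (Nat.pow_le_pow_iff_right (by norm_num)).1 h1
  have h3 : ∑ p ∈ S, (1:ℝ)/p ≤ S.card * (1 / 2^(L+1)) := by
    rw [← nsmul_eq_mul]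
    apply Finset.sum_le_card_nsmul
    intro p hp
    simp only [hS, Finset.mem_filter, Finset.mem_Ico] at hp
    apply one_div_le_one_div_of_le (by positivity)
    exact_mod_cast hp.1.1
  refine h3.trans ?_
  have h4 : ((L:ℝ)+1) * S.card ≤ 2 * 2^(L+2) := by exact_mod_cast h2
  rw [mul_one_div, div_le_div_iff₀ (by positivity) (by positivity)]
  calc _ = ((L:ℝ)+1) * S.card := by ring
    _ ≤ _ := h4
    _ = _ := by ring

lemma recip_bound (L : ℕ) :
    ∑ p ∈ (Finset.range (2^(L+1))).filter Nat.Prime, (1:ℝ)/p ≤ 4 * (harmonic L : ℝ) := by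
  induction L with
  | zero =>
    have : (Finset.range (2^(0+1))).filter Nat.Prime = ∅ := by
      ext p
      simp
      intro h hp
      have := hp.two_le
      omega
    rw [this]; simp
  | succ L ih =>
    have hsp : (Finset.range (2^(L+1+1))).filter Nat.Prime
        = (Finset.range (2^(L+1))).filter Nat.Prime ∪
          (Finset.Ico (2^(L+1)) (2^(L+2))).filter Nat.Prime := by
      ext p
      have : 2^(L+1) ≤ 2^(L+2) := Nat.pow_le_pow_right (by norm_num) (by omega)
      simp only [Finset.mem_filter, Finset.mem_union, Finset.mem_range, Finset.mem_Ico]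
      constructor
      · rintro ⟨a, b⟩
        by_cases hh : p < 2^(L+1)
        · exact Or.inl ⟨hh, b⟩
        · exact Or.inr ⟨⟨by omega, a⟩, b⟩
      · rintro (⟨a, b⟩ | ⟨a, b⟩)
        · exact ⟨by omega, b⟩
        · exact ⟨a.2, b⟩
    rw [hsp, Finset.sum_union, harmonic_succ]
    · have := block_bound L
      push_cast
      rw [mul_add]
      have e : 4 * ((L:ℝ)+1)⁻¹ = 4 / ((L:ℝ)+1) := by rw [div_eq_mul_inv]
      linarith
    · rw [Finset.disjoint_left]
      intro p hp hq
      simp only [Finset.mem_filter, Finset.mem_range, Finset.mem_Ico] at hp hq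
      omega

lemma euler_bound (g : ℕ → ℝ) (h1 : g 1 = 1)
    (hm : ∀ m n : ℕ, Nat.Coprime m n → g (m * n) = g m * g n)
    (h0 : ∀ n, 1 ≤ n → 0 ≤ g n) (X L : ℕ) (hX : X < 2^(L+1)) :
    ∑ n ∈ Finset.Icc 1 X, g n ≤
      ∏ p ∈ (Finset.range (2^(L+1))).filter Nat.Prime, ∑ k ∈ Finset.range (L+1+1), g (p^k) := by
  set P := (Finset.range (2^(L+1))).filter Nat.Prime with hP
  have hPp : ∀ p ∈ P, p.Prime := fun p hp => (Finset.mem_filter.1 hp).2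
  have hsub : ∀ n ∈ Finset.Icc 1 X, n.primeFactors ⊆ P := by
    intro n hn p hp
    rw [Finset.mem_Icc] at hn
    have := Nat.le_of_mem_primeFactors hp
    simp only [hP, Finset.mem_filter, Finset.mem_range]
    exact ⟨by omega, Nat.prime_of_mem_primeFactors hp⟩
  rw [Finset.prod_sum]
  let φ : ℕ → (∀ p ∈ P, ℕ) := fun n p _ => n.factorization p
  have hinj : Set.InjOn φ (Finset.Icc 1 X : Finset ℕ) := by
    intro a ha b hb hab
    have ha' := hsub a ha
    have hb' := hsub b hb
    simp only [Finset.coe_Icc, Set.mem_Icc] at ha hb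
    apply Nat.eq_of_factorization_eq (by omega) (by omega)
    intro p
    by_cases hp : p ∈ P
    · exact congrFun (congrFun hab p) hp
    · rw [Finsupp.notMem_support_iff.1 (fun h => hp (ha' h)),
        Finsupp.notMem_support_iff.1 (fun h => hp (hb' h))]
  have hval : ∀ n ∈ Finset.Icc 1 X, g n = ∏ x ∈ P.attach, g (x.1 ^ (φ n x.1 x.2)) := by
    intro n hn
    have hs := hsub n hn
    rw [Finset.mem_Icc] at hn
    rw [Nat.multiplicative_factorization g hm h1 (by omega),
      Finset.prod_attach P (fun p => g (p ^ n.factorization p))]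
    exact Finsupp.prod_of_support_subset _ hs _ (by intros; simp [h1])
  rw [Finset.sum_congr rfl hval, ← Finset.sum_image (f := fun q : (∀ p ∈ P, ℕ) =>
    ∏ x ∈ P.attach, g (x.1 ^ (q x.1 x.2))) hinj]
  apply Finset.sum_le_sum_of_subset_of_nonneg
  · intro q hq
    rw [Finset.mem_image] at hq
    obtain ⟨n, hn, rfl⟩ := hq
    rw [Finset.mem_pi]
    intro p hp
    rw [Finset.mem_Icc] at hn
    rw [Finset.mem_range]
    apply Nat.lt_succ_of_le
    apply Nat.factorization_le_of_le_pow
    have : 2^(L+1) ≤ p^(L+1) := Nat.pow_le_pow_left (hPp p hp).two_le _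
    omega
  · intro q _ _
    apply Finset.prod_nonneg
    intro x _
    exact h0 _ (Nat.one_le_pow _ _ (hPp x.1 x.2).pos)

lemma big_factor (g : ℕ → ℝ) (h1 : g 1 = 1) (K C : ℝ) (hK : 1 ≤ K) (hC : 1 ≤ C)
    (hb : ∀ d : ℕ, 1 ≤ d → g d ≤ K * C ^ d.primeFactorsList.length / d) (p : ℕ) (hp : p.Prime)
    (hpC : 2 * C ≤ p) (L : ℕ) :
    ∑ k ∈ Finset.range (L+1), g (p^k) ≤ Real.exp (2 * K * C * (1/p)) := by
  have hp0 : (0:ℝ) < p := by exact_mod_cast hp.pos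
  have hr : C / p ≤ 1/2 := by rw [div_le_div_iff₀ hp0 (by norm_num)]; linarith
  have hr0 : 0 ≤ C / p := by positivity
  rw [Finset.sum_range_succ', pow_zero, h1]
  have : ∑ k ∈ Finset.range L, g (p^(k+1)) ≤ ∑ k ∈ Finset.range L, K * (C/p) * (1/2:ℝ)^k := by
    apply Finset.sum_le_sum
    intro k _
    have h := hb (p^(k+1)) (Nat.one_le_pow _ _ hp.pos)
    rw [hp.primeFactorsList_pow, List.length_replicate] at h
    calc _ ≤ _ := h
      _ = K * (C/p) * (C/p)^k := by push_cast; rw [div_pow]; field_simp; ring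
      _ ≤ _ := by gcongr
  rw [← Finset.mul_sum] at this
  have h2 := sum_geometric_two_le L
  have h3 : K * (C/p) * ∑ k ∈ Finset.range L, (1/2:ℝ)^k ≤ K * (C/p) * 2 := by gcongr
  have h4 := Real.add_one_le_exp (2 * K * C * (1/p))
  have h5 : 2 * K * C * (1/p) = K * (C/p) * 2 := by ring
  linarith

/-- if `h` is multiplicative, `g(d) = h(d)/d ∈ [0,1]` and
`g(d) ≤ K C^{Ω(d)}/d`, then `∑_{n ≤ x} g(n) ≪ (log x)^A` for some constant `A > 0`. -/
theorem sum_g_bound (h : ℕ → ℝ) (hmul : MultOn h)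
    (h01 : ∀ d : ℕ, 1 ≤ d → h d / d ∈ Set.Icc (0:ℝ) 1)
    (K C : ℝ) (hK : 1 ≤ K) (hC : 1 ≤ C)
    (hbound : ∀ d : ℕ, 1 ≤ d → h d / d ≤ K * C ^ bigOmega d / d) :
    ∃ A : ℝ, 0 < A ∧ ∃ K' : ℝ, ∀ x : ℝ, 2 ≤ x →
      ∑ n ∈ Finset.Icc 1 ⌊x⌋₊, h n / n ≤ K' * Real.log x ^ A := by
  set g : ℕ → ℝ := fun n => h n / n with hg
  have h1 : g 1 = 1 := by simp [hg, hmul.1]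
  have hm : ∀ m n : ℕ, Nat.Coprime m n → g (m * n) = g m * g n := by
    intro m n hmn
    simp only [hg]
    rw [hmul.2 m n hmn, Nat.cast_mul, div_mul_div_comm]
  set M : ℕ := ⌈2 * C⌉₊ with hM
  set D : ℝ := 8 * K * C with hD
  have hD0 : 0 < D := by positivity
  have hl2 : 0 < Real.log 2 := Real.log_pos (by norm_num)
  refine ⟨M + D, by positivity, Real.exp D * (3 / Real.log 2) ^ ((M:ℝ) + D), ?_⟩
  intro x hx
  set X := ⌊x⌋₊ with hX
  have hX2 : 2 ≤ X := Nat.le_floor (by exact_mod_cast hx)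
  set L := Nat.log 2 X with hL
  have hXL : X < 2^(L+1) := Nat.lt_pow_succ_log_self (by norm_num) X
  have hLX : 2^L ≤ X := Nat.pow_log_le_self 2 (by omega)
  have hL1 : 1 ≤ L := by
    by_contra hh
    have : L = 0 := by omega
    rw [this] at hXL
    omega
  have hE := euler_bound g h1 hm (fun n hn => (h01 n hn).1) X L hXL
  set P := (Finset.range (2^(L+1))).filter Nat.Prime with hP
  set T : ℝ := (L:ℝ) + 2 with hT
  have hT1 : 1 ≤ T := by rw [hT]; linarith [Nat.cast_nonneg (α := ℝ) L]
  have hfac : ∀ p ∈ P, ∑ k ∈ Finset.range (L+1+1), g (p^k) ≤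
      (if p < M then T else 1) * Real.exp (2 * K * C * (1/p)) := by
    intro p hp
    have hpp : p.Prime := (Finset.mem_filter.1 hp).2
    split_ifs with hpM
    · have : ∑ k ∈ Finset.range (L+1+1), g (p^k) ≤ T := by
        calc _ ≤ ∑ k ∈ Finset.range (L+1+1), (1:ℝ) :=
              Finset.sum_le_sum fun k _ => (h01 _ (Nat.one_le_pow _ _ hpp.pos)).2
          _ = T := by simp [hT]; ring
      refine this.trans ?_
      apply le_mul_of_one_le_right (by linarith)
      apply Real.one_le_exp
      positivity
    · rw [one_mul]
      apply big_factor g h1 K C hK hC hbound p hpp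
      have : M ≤ p := by omega
      exact (Nat.le_ceil _).trans (by exact_mod_cast this)
  have hprod : ∏ p ∈ P, ∑ k ∈ Finset.range (L+1+1), g (p^k) ≤
      (∏ p ∈ P, if p < M then T else 1) * Real.exp (2 * K * C * ∑ p ∈ P, (1:ℝ)/p) := by
    rw [Finset.mul_sum, Real.exp_sum, ← Finset.prod_mul_distrib]
    apply Finset.prod_le_prod
    · intro p hp
      have hpp : p.Prime := (Finset.mem_filter.1 hp).2
      exact Finset.sum_nonneg fun k _ => (h01 _ (Nat.one_le_pow _ _ hpp.pos)).1
    · exact hfac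
  have hsmall : (∏ p ∈ P, if p < M then T else 1) ≤ T ^ M := by
    rw [← Finset.prod_filter, Finset.prod_const]
    apply pow_le_pow_right₀ hT1
    calc _ ≤ (Finset.range M).card := by
          apply Finset.card_le_card
          intro p hp
          simpa using (Finset.mem_filter.1 hp).2
      _ = M := by simp
  have hexp : Real.exp (2 * K * C * ∑ p ∈ P, (1:ℝ)/p) ≤ Real.exp D * T ^ D := by
    rw [Real.rpow_def_of_pos (by linarith), ← Real.exp_add]
    apply Real.exp_le_exp.2
    have a1 := recip_bound L
    have a2 := harmonic_le_one_add_log L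
    have a3 : Real.log L ≤ Real.log T :=
      Real.log_le_log (by exact_mod_cast hL1) (by rw [hT]; linarith)
    calc 2 * K * C * ∑ p ∈ P, (1:ℝ)/p ≤ 2 * K * C * (4 * (1 + Real.log T)) := by
          gcongr
          linarith
      _ = _ := by rw [hD]; ring
  have hTx : T ≤ 3 / Real.log 2 * Real.log x := by
    have b1 : (L:ℝ) * Real.log 2 ≤ Real.log x := by
      rw [← Real.log_pow]
      apply Real.log_le_log (by positivity)
      have : ((2^L : ℕ) : ℝ) ≤ X := by exact_mod_cast hLX
      push_cast at this
      exact this.trans (Nat.floor_le (by linarith))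
    have b2 : Real.log 2 ≤ Real.log x := Real.log_le_log (by norm_num) hx
    rw [div_mul_eq_mul_div, le_div_iff₀ hl2, hT]
    nlinarith
  have hlx : 0 ≤ Real.log x := Real.log_nonneg (by linarith)
  calc ∑ n ∈ Finset.Icc 1 X, h n / n ≤ _ := hE
    _ ≤ _ := hprod
    _ ≤ T ^ M * (Real.exp D * T ^ D) := by gcongr
    _ = Real.exp D * T ^ ((M:ℝ) + D) := by
        rw [Real.rpow_add (by linarith), Real.rpow_natCast]; ring
    _ ≤ Real.exp D * (3 / Real.log 2 * Real.log x) ^ ((M:ℝ) + D) := by gcongr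
    _ = _ := by rw [Real.mul_rpow (by positivity) hlx]; ring
end

section
/- Let h : ℕ → ℝ be a multiplicative function such that the function g(d) := h(d)/d satisfies g(d) ∈ [0,1] for all d ≥ 1, and such that g(d) ≤ K·C^{Ω(d)}/d for all d ≥ 1, for some constants K, C ≥ 1. Then there exists a constant A > 0 such that ∑_{n ≤ x} h(n) ≪ x·(log x)^A for all x ≥ 2. -/
open Finset Filter Real

open scoped Classical

theorem aux_mertens (J : ℕ) :
    ∑ p ∈ Nat.primesBelow (2 ^ (J + 1)), (1 / p : ℝ) ≤ 4 * (harmonic J : ℝ) := by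
  induction J with
  | zero =>
    have : Nat.primesBelow (2 ^ (0 + 1)) = ∅ := by decide
    rw [this]; simp
  | succ J ih =>
    have hsub : Nat.primesBelow (2 ^ (J + 1)) ⊆ Nat.primesBelow (2 ^ (J + 1 + 1)) := by
      intro p hp
      rw [Nat.mem_primesBelow] at hp ⊢
      exact ⟨hp.1.trans_le (Nat.pow_le_pow_right (by norm_num) (by omega)), hp.2⟩
    rw [← Finset.sum_sdiff hsub, harmonic_succ]
    have hl2 : 0 < Real.log 2 := Real.log_pos (by norm_num)
    have hJ : (0:ℝ) < (J:ℝ) + 1 := by positivity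
    set D : ℝ := 2 ^ (J + 1) * ((J + 1) * Real.log 2) with hD
    have hDpos : 0 < D := by positivity
    have h1 : ∑ p ∈ Nat.primesBelow (2 ^ (J + 1 + 1)) \ Nat.primesBelow (2 ^ (J + 1)), (1 / p : ℝ)
        ≤ ∑ p ∈ Nat.primesBelow (2 ^ (J + 1 + 1)) \ Nat.primesBelow (2 ^ (J + 1)),
          Real.log p / D := by
      apply Finset.sum_le_sum
      intro p hp
      rw [Finset.mem_sdiff, Nat.mem_primesBelow, Nat.mem_primesBelow] at hp
      obtain ⟨⟨_, hpp⟩, h3⟩ := hp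
      have h4 : 2 ^ (J + 1) ≤ p := by
        by_contra h; exact h3 ⟨by omega, hpp⟩
      have h5 : (2:ℝ) ^ (J + 1) ≤ p := by exact_mod_cast h4
      have hp0 : (0:ℝ) < p := by exact_mod_cast hpp.pos
      have h6 : ((J:ℝ) + 1) * Real.log 2 ≤ Real.log p := by
        have := Real.log_le_log (by positivity) h5
        rw [Real.log_pow] at this
        push_cast at this; exact this
      rw [div_le_div_iff₀ hp0 hDpos, one_mul, hD, mul_comm (Real.log p)]
      exact mul_le_mul h5 h6 (by positivity) hp0.le
    have h2 : ∑ p ∈ Nat.primesBelow (2 ^ (J + 1 + 1)) \ Nat.primesBelow (2 ^ (J + 1)),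
          Real.log p ≤ Chebyshev.theta ((2 ^ (J + 1 + 1) : ℕ) : ℝ) := by
      rw [Chebyshev.theta_eq_sum_primesLE_log]
      apply Finset.sum_le_sum_of_subset_of_nonneg
      · intro p hp
        rw [Finset.mem_sdiff, Nat.mem_primesBelow] at hp
        rw [Nat.mem_primesLE]
        exact ⟨hp.1.1.le, hp.1.2⟩
      · intro p _ _
        exact Real.log_natCast_nonneg p
    have h3 := Chebyshev.theta_le_log4_mul_x (x := ((2 ^ (J + 1 + 1) : ℕ) : ℝ)) (by positivity)
    have hl4 : Real.log 4 = 2 * Real.log 2 := by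
      rw [show (4:ℝ) = 2 ^ 2 by norm_num, Real.log_pow]; norm_num
    rw [← Finset.sum_div] at h1
    have h4 : (∑ p ∈ Nat.primesBelow (2 ^ (J + 1 + 1)) \ Nat.primesBelow (2 ^ (J + 1)),
          Real.log p) / D ≤ 4 * ((J:ℝ) + 1)⁻¹ := by
      rw [div_le_iff₀ hDpos]
      refine h2.trans (h3.trans (le_of_eq ?_))
      rw [hl4, hD]; push_cast; field_simp; ring
    push_cast
    linarith

theorem aux_local (g : ℕ → ℝ) (h1 : g 1 = 1) (g1 : ∀ d : ℕ, g d ≤ 1)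
    (K C : ℝ) (hK : 1 ≤ K) (hC : 1 ≤ C)
    (hb : ∀ d : ℕ, 1 ≤ d → g d ≤ K * C ^ bigOmega d / d) (M : ℕ) (hM : 2 * C ≤ M)
    (L p : ℕ) (hp : p.Prime) :
    ∑ k ∈ Finset.range (L + 1), g (p ^ k) ≤
      (if p < M then (L + 1 : ℝ) else 1) * Real.exp (2 * K * C * (1 / p)) := by
  have hp0 : (0:ℝ) < p := by exact_mod_cast hp.pos
  have hexp := Real.add_one_le_exp (2 * K * C * (1 / p))
  have hnn : 0 ≤ 2 * K * C * (1 / p : ℝ) := by positivity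
  split_ifs with hpM
  · have : ∑ k ∈ Finset.range (L + 1), g (p ^ k) ≤ ∑ k ∈ Finset.range (L + 1), (1:ℝ) :=
      Finset.sum_le_sum fun k _ => g1 _
    simp at this
    have h2 : (0:ℝ) ≤ L + 1 := by positivity
    nlinarith
  · rw [one_mul, Finset.sum_range_succ', pow_zero, h1]
    have hr : C / p ≤ 1 / 2 := by
      have : (M:ℝ) ≤ p := by exact_mod_cast (not_lt.mp hpM)
      rw [div_le_iff₀ hp0]; linarith
    have hr0 : 0 ≤ C / p := by positivity
    have h3 : ∑ k ∈ Finset.range L, g (p ^ (k + 1)) ≤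
        ∑ k ∈ Finset.range L, K * (C / p) * (1 / 2 : ℝ) ^ k := by
      apply Finset.sum_le_sum
      intro k _
      have := hb (p ^ (k + 1)) (Nat.one_le_pow _ _ hp.pos)
      have hO : bigOmega (p ^ (k + 1)) = k + 1 := by
        simp [bigOmega, hp.primeFactorsList_pow]
      rw [hO] at this
      refine this.trans ?_
      have e : K * C ^ (k + 1) / ((p ^ (k + 1) : ℕ) : ℝ) = K * (C / p) * (C / p) ^ k := by
        push_cast; rw [mul_assoc, ← pow_succ', div_pow]; ring
      rw [e]
      gcongr
    rw [← Finset.mul_sum] at h3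
    have h4 := sum_geometric_two_le L
    have h5 : K * (C / p) * ∑ k ∈ Finset.range L, (1 / 2 : ℝ) ^ k ≤ K * (C / p) * 2 := by
      gcongr
    have h6 : K * (C / p) * 2 = 2 * K * C * (1 / p) := by ring
    linarith

theorem aux_euler (g : ℕ → ℝ) (h1 : g 1 = 1)
    (hmul : ∀ m n : ℕ, Nat.Coprime m n → g (m * n) = g m * g n)
    (g0 : ∀ d : ℕ, 0 ≤ g d) (L : ℕ) :
    ∑ n ∈ Finset.Ico 1 (2 ^ (L + 1)), g n ≤
      ∏ p ∈ Nat.primesBelow (2 ^ (L + 1)), ∑ k ∈ Finset.range (L + 1), g (p ^ k) := by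
  set F : ℕ → ℝ := fun n => if ∀ p, n.factorization p ≤ L then g n else 0 with hF
  have F1 : F 1 = 1 := by simp [hF, h1]
  have F0 : ∀ n, 0 ≤ F n := by
    intro n; simp only [hF]; split_ifs
    · exact g0 n
    · exact le_rfl
  have Fmul : ∀ {m n : ℕ}, Nat.Coprime m n → F (m * n) = F m * F n := by
    intro m n hmn
    have key : (∀ p, (m * n).factorization p ≤ L) ↔
        (∀ p, m.factorization p ≤ L) ∧ (∀ p, n.factorization p ≤ L) := by
      rw [Nat.factorization_mul_of_coprime hmn, ← forall_and]
      refine forall_congr' fun p => ?_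
      have hd := hmn.disjoint_primeFactors
      have : m.factorization p = 0 ∨ n.factorization p = 0 := by
        by_contra hh
        push Not at hh
        have a : p ∈ m.primeFactors := by
          rw [← Nat.support_factorization]; exact Finsupp.mem_support_iff.mpr hh.1
        have b : p ∈ n.primeFactors := by
          rw [← Nat.support_factorization]; exact Finsupp.mem_support_iff.mpr hh.2
        exact Finset.disjoint_left.mp hd a b
      rw [Finsupp.add_apply]
      omega
    simp only [hF, key, hmul m n hmn]
    by_cases a : ∀ p, m.factorization p ≤ L <;> by_cases b : ∀ p, n.factorization p ≤ L <;>
      simp [a, b]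
  have Fpow : ∀ {p : ℕ}, p.Prime → ∀ k, F (p ^ k) = if k ≤ L then g (p ^ k) else 0 := by
    intro p hp k
    have : (∀ q, (p ^ k).factorization q ≤ L) ↔ k ≤ L := by
      rw [hp.factorization_pow]
      constructor
      · intro h; simpa using h p
      · intro h q
        rw [Finsupp.single_apply]; split_ifs <;> omega
    simp only [hF, this]
  have Fsupp : ∀ {p : ℕ}, p.Prime → ∀ k ∉ Finset.range (L + 1), F (p ^ k) = 0 := by
    intro p hp k hk
    rw [Fpow hp, if_neg]
    simpa using hk
  have Fsum : ∀ {p : ℕ}, p.Prime → Summable (fun k => ‖F (p ^ k)‖) := by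
    intro p hp
    apply summable_of_ne_finset_zero (s := Finset.range (L + 1))
    intro k hk
    rw [Fsupp hp k hk, norm_zero]
  obtain ⟨hs, hh⟩ := EulerProduct.summable_and_hasSum_smoothNumbers_prod_primesBelow_tsum
    F1 Fmul Fsum (2 ^ (L + 1))
  have e : ∏ p ∈ Nat.primesBelow (2 ^ (L + 1)), ∑' k, F (p ^ k) =
      ∏ p ∈ Nat.primesBelow (2 ^ (L + 1)), ∑ k ∈ Finset.range (L + 1), g (p ^ k) := by
    apply Finset.prod_congr rfl
    intro p hp
    have hp := (Nat.mem_primesBelow.mp hp).2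
    rw [tsum_eq_sum (Fsupp hp)]
    apply Finset.sum_congr rfl
    intro k hk
    rw [Fpow hp, if_pos]
    have := Finset.mem_range.mp hk; omega
  rw [e] at hh
  replace hh := hasSum_subtype_iff_indicator.mp (show HasSum (F ∘ Subtype.val) _ from hh)
  refine le_trans (le_of_eq ?_) (sum_le_hasSum (Finset.Ico 1 (2 ^ (L + 1))) ?_ hh)
  · apply Finset.sum_congr rfl
    intro n hn
    rw [Finset.mem_Ico] at hn
    rw [Set.indicator_of_mem (Nat.mem_smoothNumbers_of_lt (by omega) hn.2)]
    simp only [hF]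
    rw [if_pos]
    intro p
    have := Nat.factorization_lt p (n := n) (by omega)
    by_cases hp : p.Prime
    · have h2 : p ^ n.factorization p ≤ n := Nat.ordProj_le p (by omega)
      have h3 : 2 ^ n.factorization p < 2 ^ (L + 1) :=
        lt_of_le_of_lt ((Nat.pow_le_pow_left hp.two_le _).trans h2) hn.2
      have := (Nat.pow_lt_pow_iff_right (by norm_num : 1 < 2)).mp h3
      omega
    · simp [Nat.factorization_eq_zero_of_not_prime _ hp]
  · intro n _
    exact Set.indicator_nonneg (fun n _ => F0 n) n

/-- if `h` is multiplicative, `g(d) = h(d)/d ∈ [0,1]` and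
`g(d) ≤ K C^{Ω(d)}/d`, then `∑_{n ≤ x} h(n) ≪ x (log x)^A` for some constant `A > 0`. -/
theorem sum_h_bound (h : ℕ → ℝ) (hmul : MultOn h)
    (h01 : ∀ d : ℕ, 1 ≤ d → h d / d ∈ Set.Icc (0:ℝ) 1)
    (K C : ℝ) (hK : 1 ≤ K) (hC : 1 ≤ C)
    (hbound : ∀ d : ℕ, 1 ≤ d → h d / d ≤ K * C ^ bigOmega d / d) :
    ∃ A : ℝ, 0 < A ∧ ∃ K' : ℝ, ∀ x : ℝ, 2 ≤ x →
      ∑ n ∈ Finset.Icc 1 ⌊x⌋₊, h n ≤ K' * x * Real.log x ^ A := by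
  set g : ℕ → ℝ := fun d => h d / d with hg
  have g0 : ∀ d, 0 ≤ g d := by
    intro d
    rcases Nat.eq_zero_or_pos d with rfl | hd
    · simp [hg]
    · exact (h01 d hd).1
  have g1 : ∀ d, g d ≤ 1 := by
    intro d
    rcases Nat.eq_zero_or_pos d with rfl | hd
    · simp [hg]
    · exact (h01 d hd).2
  have gone : g 1 = 1 := by simp [hg, hmul.1]
  have gmul : ∀ m n : ℕ, Nat.Coprime m n → g (m * n) = g m * g n := by
    intro m n hmn
    simp only [hg, hmul.2 m n hmn]
    push_cast
    rw [mul_div_mul_comm]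
  obtain ⟨M, hM⟩ := exists_nat_ge (2 * C)
  set B : ℝ := 8 * K * C with hB
  have hBpos : 0 < B := by positivity
  refine ⟨M + B, by positivity, Real.exp B * 4 ^ ((M:ℝ) + B), ?_⟩
  intro x hx
  have hX2 : 2 ≤ ⌊x⌋₊ := Nat.le_floor (by exact_mod_cast hx)
  set X := ⌊x⌋₊ with hX
  set L := Nat.log 2 X with hL
  have hL1 : 1 ≤ L := Nat.log_pos (by norm_num) hX2
  have hL1' : (1:ℝ) ≤ L := by exact_mod_cast hL1
  have hXlt : X < 2 ^ (L + 1) := Nat.lt_pow_succ_log_self (by norm_num) X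
  have hXx : (X:ℝ) ≤ x := Nat.floor_le (by linarith)
  -- bound of L
  have hLlog : (L:ℝ) + 1 ≤ 4 * Real.log x := by
    have h2 : 2 ^ L ≤ X := Nat.pow_log_le_self 2 (by omega)
    have h3 : (2:ℝ) ^ L ≤ x := le_trans (by exact_mod_cast h2) hXx
    have h4 := Real.log_le_log (by positivity) h3
    rw [Real.log_pow] at h4
    have := Real.log_two_gt_d9
    nlinarith
  -- the sum
  have s1 : ∑ n ∈ Finset.Icc 1 X, h n ≤ x * ∑ n ∈ Finset.Ico 1 (2 ^ (L + 1)), g n := by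
    have a : ∑ n ∈ Finset.Icc 1 X, h n ≤ ∑ n ∈ Finset.Icc 1 X, x * g n := by
      apply Finset.sum_le_sum
      intro n hn
      rw [Finset.mem_Icc] at hn
      have hn0 : (0:ℝ) < n := by exact_mod_cast hn.1
      have hnx : (n:ℝ) ≤ x := le_trans (by exact_mod_cast hn.2) hXx
      have : h n = n * g n := by simp only [hg]; field_simp
      rw [this]
      exact mul_le_mul_of_nonneg_right hnx (g0 n)
    rw [← Finset.mul_sum] at a
    refine a.trans ?_
    apply mul_le_mul_of_nonneg_left _ (by linarith)
    apply Finset.sum_le_sum_of_subset_of_nonneg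
    · intro n hn
      rw [Finset.mem_Icc] at hn
      rw [Finset.mem_Ico]
      omega
    · intro n _ _; exact g0 n
  have s2 := aux_euler g gone gmul g0 L
  have s3 : ∏ p ∈ Nat.primesBelow (2 ^ (L + 1)), ∑ k ∈ Finset.range (L + 1), g (p ^ k) ≤
      ∏ p ∈ Nat.primesBelow (2 ^ (L + 1)),
        ((if p < M then (L + 1 : ℝ) else 1) * Real.exp (2 * K * C * (1 / p))) := by
    apply Finset.prod_le_prod
    · intro p _; exact Finset.sum_nonneg fun k _ => g0 _
    · intro p hp
      exact aux_local g gone g1 K C hK hC hbound M hM L p (Nat.mem_primesBelow.mp hp).2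
  rw [Finset.prod_mul_distrib, ← Real.exp_sum, ← Finset.mul_sum, Finset.prod_ite,
    Finset.prod_const_one, mul_one, Finset.prod_const] at s3
  have s4 : ((L:ℝ) + 1) ^ ((Nat.primesBelow (2 ^ (L + 1))).filter (fun p => p < M)).card ≤
      ((L:ℝ) + 1) ^ (M : ℝ) := by
    rw [Real.rpow_natCast]
    apply pow_le_pow_right₀ (by linarith)
    calc _ ≤ (Finset.range M).card := by
          apply Finset.card_le_card
          intro p hp
          rw [Finset.mem_filter] at hp
          exact Finset.mem_range.mpr hp.2
      _ = M := Finset.card_range M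
  have s5 : Real.exp (2 * K * C * ∑ p ∈ Nat.primesBelow (2 ^ (L + 1)), (1 / p : ℝ)) ≤
      Real.exp B * ((L:ℝ) + 1) ^ B := by
    rw [Real.rpow_def_of_pos (by linarith), ← Real.exp_add]
    apply Real.exp_le_exp.mpr
    have m1 := aux_mertens L
    have m2 := harmonic_le_one_add_log L
    have m3 : Real.log L ≤ Real.log ((L:ℝ) + 1) := Real.log_le_log (by linarith) (by linarith)
    have m4 : ∑ p ∈ Nat.primesBelow (2 ^ (L + 1)), (1 / p : ℝ) ≤ 4 * (1 + Real.log ((L:ℝ) + 1)) := by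
      linarith
    have m5 := mul_le_mul_of_nonneg_left m4 (show 0 ≤ 2 * K * C by positivity)
    refine m5.trans (le_of_eq ?_)
    rw [hB]; ring
  have s6 : ∑ n ∈ Finset.Ico 1 (2 ^ (L + 1)), g n ≤
      ((L:ℝ) + 1) ^ (M : ℝ) * (Real.exp B * ((L:ℝ) + 1) ^ B) :=
    s2.trans (s3.trans (mul_le_mul s4 s5 (Real.exp_pos _).le (by positivity)))
  have hlog : 0 ≤ Real.log x := Real.log_nonneg (by linarith)
  have s7 : ((L:ℝ) + 1) ^ (M : ℝ) * (Real.exp B * ((L:ℝ) + 1) ^ B) ≤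
      Real.exp B * (4 ^ ((M:ℝ) + B) * Real.log x ^ ((M:ℝ) + B)) := by
    rw [← Real.mul_rpow (by norm_num) hlog, mul_left_comm, ← Real.rpow_add (by linarith)]
    apply mul_le_mul_of_nonneg_left _ (Real.exp_pos _).le
    exact Real.rpow_le_rpow (by linarith) hLlog (by positivity)
  calc ∑ n ∈ Finset.Icc 1 X, h n ≤ x * ∑ n ∈ Finset.Ico 1 (2 ^ (L + 1)), g n := s1
    _ ≤ x * (Real.exp B * (4 ^ ((M:ℝ) + B) * Real.log x ^ ((M:ℝ) + B))) :=
        mul_le_mul_of_nonneg_left (s6.trans s7) (by linarith)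
    _ = _ := by ring
end
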